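/- arXiv:1808.09245 — 2 statements merged into one kernel-verified Lean document; each statement's English description precedes it below -/
import Mathlib

section
/- For all integers m and n with 4 ≤ m < n, m even and n odd, the two-color Ramsey number of cycles satisfies R(C_m, C_n) = max{n − 1 + m/2, 2m − 1}. -/
open SimpleGraph

/-- Every red/blue coloring of the edges of `K_N` (red = `0`, blue = `1`) contains a red
copy of `G` or a blue copy of `H`. -/
def RamseyProp {V W : Type*} (G : SimpleGraph V) (H : SimpleGraph W) (N : ℕ) : Prop :=
  ∀ c : Sym2 (Fin N) → Fin 2,
    (∃ f : V ↪ Fin N, ∀ u v, G.Adj u v → c s(f u, f v) = 0) ∨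
    (∃ f : W ↪ Fin N, ∀ u v, H.Adj u v → c s(f u, f v) = 1)

/-- The two-color Ramsey number `R(G, H)`: the minimum `N` such that every red/blue
coloring of the edges of `K_N` contains a red copy of `G` or a blue copy of `H`. -/
noncomputable def ramseyNumber {V W : Type*} (G : SimpleGraph V) (H : SimpleGraph W) : ℕ :=
  sInf {N | RamseyProp G H N}

/-- `Pth G u v S`: there is a path from `u` to `v` in `G` with vertex set exactly `S`. -/
inductive Pth {V : Type*} [DecidableEq V] (G : SimpleGraph V) : V → V → Finset V → Prop
  | single (u : V) : Pth G u u {u}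
  | cons {u w v : V} {S : Finset V} :
      G.Adj u w → u ∉ S → Pth G w v S → Pth G u v (insert u S)

theorem Pth.append {V : Type*} [DecidableEq V] {G : SimpleGraph V} {u v w x : V}
    {S T : Finset V} (h : Pth G u v S) (ha : G.Adj v w) (h2 : Pth G w x T)
    (hd : Disjoint S T) : Pth G u x (S ∪ T) := by
  induction h with
  | single u =>
    have := Pth.cons ha (by simpa using hd) h2
    rwa [Finset.insert_eq] at this
  | cons ha' hn hp ih =>
    rw [Finset.disjoint_insert_left] at hd
    have := Pth.cons ha' (by simp [hn, hd.1]) (ih ha hd.2)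
    rwa [Finset.insert_union]

theorem Pth.symm {V : Type*} [DecidableEq V] {G : SimpleGraph V} {u v : V}
    {S : Finset V} (h : Pth G u v S) : Pth G v u S := by
  induction h with
  | single u => exact Pth.single u
  | @cons u w v S ha hn hp ih =>
    have := ih.append ha.symm (Pth.single u) (by simpa using hn)
    rwa [Finset.union_comm, ← Finset.insert_eq] at this

theorem Pth.mono {V : Type*} [DecidableEq V] {G H : SimpleGraph V} (hGH : G ≤ H) {u v : V}
    {S : Finset V} (h : Pth G u v S) : Pth H u v S := by
  induction h with
  | single u => exact Pth.single u
  | cons ha hn hp ih => exact Pth.cons (hGH ha) hn ih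

theorem Pth.two {V : Type*} [DecidableEq V] {G : SimpleGraph V} {u v : V} (h : G.Adj u v) :
    Pth G u v {u, v} := Pth.cons h (by simpa using h.ne) (Pth.single v)

theorem Pth.three {V : Type*} [DecidableEq V] {G : SimpleGraph V} {u v w : V} (h : G.Adj u v)
    (h2 : G.Adj v w) (hne : u ≠ w) :
    Pth G u w {u, v, w} := Pth.cons h (by simp [h.ne, hne]) (Pth.two h2)

theorem Pth.fn {V : Type*} [DecidableEq V] {G : SimpleGraph V} {u v : V}
    {S : Finset V} (h : Pth G u v S) :
    ∃ (f : ℕ → V) (l : ℕ), S.card = l + 1 ∧ f 0 = u ∧ f l = v ∧ (∀ i, i ≤ l → f i ∈ S) ∧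
      (∀ i j, i < j → j ≤ l → f i ≠ f j) ∧ (∀ i, i < l → G.Adj (f i) (f (i + 1))) := by
  induction h with
  | single u => exact ⟨fun _ => u, 0, by simp, rfl, rfl, by simp, by omega, by omega⟩
  | @cons u w v S ha hn hp ih =>
    obtain ⟨f, l, hc, h0, hl, hm, hi, hadj⟩ := ih
    refine ⟨fun i => Nat.casesOn i u f, l + 1, by simp [hn, hc], rfl, hl, ?_, ?_, ?_⟩
    · rintro (_ | i) h
      · simp
      · exact Finset.mem_insert_of_mem (hm i (by omega))
    · rintro (_ | i) (_ | j) h h'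
      · omega
      · intro e
        exact hn (by have := hm j (by omega); simp only at e; rwa [← e] at this)
      · omega
      · exact hi i j (by omega) (by omega)
    · rintro (_ | i) h
      · simpa [h0] using ha
      · exact hadj i (by omega)

/-- `G` has a cycle of length `n` (sensible for `3 ≤ n`). -/
def HasCyc {V : Type*} [DecidableEq V] (G : SimpleGraph V) (n : ℕ) : Prop :=
  ∃ (S : Finset V) (u v : V), Pth G u v S ∧ G.Adj v u ∧ S.card = n

theorem HasCyc.mono {V : Type*} [DecidableEq V] {G H : SimpleGraph V} (hGH : G ≤ H) {n : ℕ}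
    (h : HasCyc G n) : HasCyc H n := by
  obtain ⟨S, u, v, h1, h2, h3⟩ := h
  exact ⟨S, u, v, h1.mono hGH, hGH h2, h3⟩

/-- An indexed cycle: an `n`-periodic sequence of vertices. -/
structure IsCyc {V : Type*} (G : SimpleGraph V) (n : ℕ) (v : ℕ → V) : Prop where
  per : ∀ i, v (i + n) = v i
  inj : ∀ i j, i < j → j < i + n → v i ≠ v j
  adj : ∀ i, G.Adj (v i) (v (i + 1))

theorem HasCyc.isCyc {V : Type*} [DecidableEq V] {G : SimpleGraph V} {n : ℕ}
    (h : HasCyc G n) : ∃ v, IsCyc G n v := by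
  obtain ⟨S, u, w, h1, h2, h3⟩ := h
  obtain ⟨f, l, hc, h0, hl, hm, hi, hadj⟩ := h1.fn
  have hn : n = l + 1 := by omega
  subst hn
  refine ⟨fun i => f (i % (l + 1)), ⟨by simp, ?_, ?_⟩⟩
  · intro i j hij hj
    have a := Nat.mod_lt i (show 0 < l + 1 by omega)
    have b := Nat.mod_lt j (show 0 < l + 1 by omega)
    have hne : i % (l + 1) ≠ j % (l + 1) := by
      intro e
      have : (l + 1) ∣ j - i := (Nat.modEq_iff_dvd' hij.le).1 e
      have := Nat.le_of_dvd (by omega) this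
      omega
    rcases lt_or_gt_of_ne hne with h | h
    · exact hi _ _ h (by omega)
    · exact (hi _ _ h (by omega)).symm
  · intro i
    have a := Nat.mod_lt i (show 0 < l + 1 by omega)
    show G.Adj (f (i % (l + 1))) (f ((i + 1) % (l + 1)))
    by_cases hi : i % (l + 1) = l
    · have : (i + 1) % (l + 1) = 0 := by rw [Nat.add_mod, hi]; cases l <;> simp
      rw [hi, this, hl, h0]; exact h2
    · have : (i + 1) % (l + 1) = i % (l + 1) + 1 := by
        rw [Nat.add_mod]
        rcases l with _ | l
        · omega
        · rw [Nat.mod_eq_of_lt (a := 1) (by omega), Nat.mod_eq_of_lt (by omega)]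
      rw [this]; exact hadj _ (by omega)

theorem IsCyc.shift {V : Type*} {G : SimpleGraph V} {n : ℕ} {v : ℕ → V} (h : IsCyc G n v)
    (s : ℕ) : IsCyc G n (fun i => v (i + s)) where
  per i := by show v (i + n + s) = _; rw [← h.per (i + s)]; congr 1; omega
  inj i j h1 h2 := h.inj _ _ (by omega) (by omega)
  adj i := by
    have := h.adj (i + s)
    rwa [show i + s + 1 = i + 1 + s by omega] at this

theorem IsCyc.arc {V : Type*} [DecidableEq V] {G : SimpleGraph V} {n : ℕ} {v : ℕ → V}
    (h : IsCyc G n v) (p q : ℕ) (hpq : p ≤ q) (hq : q < p + n) :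
    Pth G (v p) (v q) ((Finset.Icc p q).image v) := by
  obtain ⟨l, rfl⟩ := Nat.exists_eq_add_of_le hpq
  clear hpq
  induction l generalizing p with
  | zero => simpa using Pth.single (v p)
  | succ l ih =>
    have := ih (p + 1) (by omega)
    have h2 := Pth.cons (h.adj p) (by
      simp only [Finset.mem_image, Finset.mem_Icc, not_exists, not_and]
      intro i hi e
      exact h.inj p i (by omega) (by omega) e.symm) this
    rw [← Finset.image_insert] at h2
    have e : insert p (Finset.Icc (p + 1) (p + 1 + l)) = Finset.Icc p (p + (l + 1)) := by
      ext i; simp only [Finset.mem_insert, Finset.mem_Icc]; omega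
    rw [e] at h2
    rwa [show p + (l + 1) = p + 1 + l by omega] at h2 ⊢

theorem IsCyc.arc_card {V : Type*} [DecidableEq V] {G : SimpleGraph V} {n : ℕ} {v : ℕ → V}
    (h : IsCyc G n v) (p q : ℕ) (hq : q < p + n) :
    ((Finset.Icc p q).image v).card = q + 1 - p := by
  rw [Finset.card_image_of_injOn, Nat.card_Icc]
  intro i hi j hj e
  simp only [Finset.coe_Icc, Set.mem_Icc] at hi hj
  by_contra hne
  rcases lt_or_gt_of_ne hne with h1 | h1
  · exact h.inj i j h1 (by omega) e
  · exact h.inj j i h1 (by omega) e.symm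

/-- Closing one arc of a cycle by a new path. -/
theorem IsCyc.one {V : Type*} [DecidableEq V] {G : SimpleGraph V} {n : ℕ} {v : ℕ → V}
    (h : IsCyc G n v) {p q : ℕ} (hpq : p ≤ q) (hq : q < p + n) {w w' : V} {T : Finset V}
    (hT : Pth G w w' T) (hd : ∀ i, v i ∉ T) (h1 : G.Adj (v q) w) (h2 : G.Adj w' (v p)) :
    HasCyc G (q + 1 - p + T.card) := by
  have hdis : Disjoint ((Finset.Icc p q).image v) T := by
    rw [Finset.disjoint_left]
    simp only [Finset.mem_image, forall_exists_index, and_imp]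
    rintro _ i _ rfl; exact hd i
  refine ⟨_, _, _, (h.arc p q hpq hq).append h1 hT hdis, h2, ?_⟩
  rw [Finset.card_union_of_disjoint hdis, h.arc_card p q hq]

theorem IsCyc.arcs_disj {V : Type*} [DecidableEq V] {G : SimpleGraph V} {n : ℕ} {v : ℕ → V}
    (h : IsCyc G n v) {p q r s : ℕ} (hqr : q < r) (hs : s < p + n) :
    Disjoint ((Finset.Icc p q).image v) ((Finset.Icc r s).image v) := by
  rw [Finset.disjoint_left]
  simp only [Finset.mem_image, Finset.mem_Icc, forall_exists_index, and_imp]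
  rintro _ i h1 h2 rfl ⟨j, ⟨h3, h4⟩, e⟩
  exact h.inj i j (by omega) (by omega) e.symm

/-- Joining two arcs of a cycle, the second one reversed, by one new path and one edge. -/
theorem IsCyc.two0 {V : Type*} [DecidableEq V] {G : SimpleGraph V} {n : ℕ} {v : ℕ → V}
    (h : IsCyc G n v) {p q r s : ℕ} (hpq : p ≤ q) (hqr : q < r) (hrs : r ≤ s) (hs : s < p + n)
    {w w' : V} {T : Finset V}
    (hT : Pth G w w' T) (hd : ∀ i, v i ∉ T) (h1 : G.Adj (v q) w) (h2 : G.Adj w' (v s))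
    (h3 : G.Adj (v r) (v p)) :
    HasCyc G ((q + 1 - p) + T.card + (s + 1 - r)) := by
  have hdis : ∀ a b, Disjoint ((Finset.Icc a b).image v) T := by
    intro a b
    rw [Finset.disjoint_left]
    simp only [Finset.mem_image, forall_exists_index, and_imp]
    rintro _ i _ rfl; exact hd i
  have hd2 : Disjoint ((Finset.Icc p q).image v ∪ T) ((Finset.Icc r s).image v) := by
    rw [Finset.disjoint_union_left]
    exact ⟨h.arcs_disj hqr hs, (hdis _ _).symm⟩
  refine ⟨_, _, _, ((h.arc p q hpq (by omega)).append h1 hT (hdis _ _)).append h2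
    (h.arc r s hrs (by omega)).symm hd2, h3, ?_⟩
  rw [Finset.card_union_of_disjoint hd2, Finset.card_union_of_disjoint (hdis _ _),
    h.arc_card p q (by omega), h.arc_card r s (by omega)]

/-- Joining two arcs of a cycle, the second one reversed, by two new vertices. -/
theorem IsCyc.two {V : Type*} [DecidableEq V] {G : SimpleGraph V} {n : ℕ} {v : ℕ → V}
    (h : IsCyc G n v) {p q r s : ℕ} (hpq : p ≤ q) (hqr : q < r) (hrs : r ≤ s) (hs : s < p + n)
    {x z : V} (hxz : x ≠ z) (hx : ∀ i, v i ≠ x) (hz : ∀ i, v i ≠ z)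
    (h1 : G.Adj (v q) x) (h2 : G.Adj x (v s))
    (h3 : G.Adj (v r) z) (h4 : G.Adj z (v p)) :
    HasCyc G ((q + 1 - p) + (s + 1 - r) + 2) := by
  have hdis : ∀ y : V, (∀ i, v i ≠ y) → ∀ a b, Disjoint ((Finset.Icc a b).image v) {y} := by
    intro y hy a b
    rw [Finset.disjoint_left]
    simp only [Finset.mem_image, forall_exists_index, and_imp]
    rintro _ i _ rfl; simpa using hy i
  have hd2 : Disjoint ((Finset.Icc p q).image v ∪ {x}) ((Finset.Icc r s).image v) := by
    rw [Finset.disjoint_union_left]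
    exact ⟨h.arcs_disj hqr hs, (hdis x hx _ _).symm⟩
  have hd3 : Disjoint ((Finset.Icc p q).image v ∪ {x} ∪ ((Finset.Icc r s).image v)) {z} := by
    rw [Finset.disjoint_union_left, Finset.disjoint_union_left]
    exact ⟨⟨hdis z hz _ _, by simpa using hxz⟩, hdis z hz _ _⟩
  refine ⟨_, _, _, (((h.arc p q hpq (by omega)).append h1 (Pth.single x) (hdis x hx _ _)).append h2
    (h.arc r s hrs (by omega)).symm hd2).append h3 (Pth.single z) hd3, h4, ?_⟩
  rw [Finset.card_union_of_disjoint hd3, Finset.card_union_of_disjoint hd2,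
    Finset.card_union_of_disjoint (hdis x hx _ _),
    h.arc_card p q (by omega), h.arc_card r s (by omega)]
  simp only [Finset.card_singleton]; omega

/-- Zigzag paths: `Q` and `J` completely joined, and `Q` a clique unless `|Q| = |J| + 1`. -/
theorem zig {V : Type*} [DecidableEq V] {G : SimpleGraph V} (k : ℕ) :
    ∀ (Q J : Finset V), Q.card = k → Disjoint Q J → (∀ q ∈ Q, ∀ j ∈ J, G.Adj q j) →
    ((∀ q ∈ Q, ∀ q' ∈ Q, q ≠ q' → G.Adj q q') ∨ Q.card = J.card + 1) →
    J.card + 1 ≤ Q.card → ∀ u ∈ Q, ∀ v ∈ Q, (u ≠ v ∨ Q.card = 1) → Pth G u v (Q ∪ J) := by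
  induction k with
  | zero => intro Q J hk _ _ _ h; omega
  | succ k ih =>
    intro Q J hk hd hj hq hc u hu v hv huv
    by_cases h1 : Q.card = 1
    · obtain ⟨a, rfl⟩ := Finset.card_eq_one.1 h1
      simp only [Finset.mem_singleton] at hu hv
      subst hu; subst hv
      have : J = ∅ := by rw [← Finset.card_eq_zero]; simp at hc; simp [hc]
      subst this
      simpa using Pth.single _
    · have huv : u ≠ v := by tauto
      have hce : (Q.erase u).card = k := by rw [Finset.card_erase_of_mem hu]; omega
      have hve : v ∈ Q.erase u := by simp [hv, huv.symm]
      have hw : ∃ w ∈ Q.erase u, (w ≠ v ∨ (Q.erase u).card = 1) := by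
        by_cases h2 : (Q.erase u).card = 1
        · exact ⟨v, hve, Or.inr h2⟩
        · have : 1 < (Q.erase u).card := by
            have := Finset.card_pos.2 ⟨v, hve⟩; omega
          obtain ⟨w, hw, hwv⟩ := Finset.exists_mem_ne this v
          exact ⟨w, hw, Or.inl hwv⟩
      obtain ⟨w, hw, hw2⟩ := hw
      have hwQ := Finset.mem_of_mem_erase hw
      have hwu : w ≠ u := Finset.ne_of_mem_erase hw
      rcases J.eq_empty_or_nonempty with rfl | ⟨j, hjJ⟩
      · have hcl : ∀ q ∈ Q, ∀ q' ∈ Q, q ≠ q' → G.Adj q q' := by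
          rcases hq with h | h
          · exact h
          · simp at h; omega
        have := ih (Q.erase u) ∅ hce (by simp) (by simp)
          (Or.inl fun q hq q' hq' => hcl q (Finset.mem_of_mem_erase hq) q'
            (Finset.mem_of_mem_erase hq')) (by simp only [Finset.card_empty]; have := Finset.card_pos.2 ⟨v, hve⟩; omega) w hw v hve hw2
        have := Pth.cons (hcl u hu w hwQ hwu.symm) (by simp) this
        rw [← Finset.insert_union, Finset.insert_erase hu] at this
        exact this
      · have hJc : (J.erase j).card + 1 = J.card := Finset.card_erase_add_one hjJ
        have huJ : u ∉ J := Finset.disjoint_left.1 hd hu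
        have hjQ : j ∉ Q := Finset.disjoint_right.1 hd hjJ
        have := ih (Q.erase u) (J.erase j) hce
          (hd.mono (Finset.erase_subset _ _) (Finset.erase_subset _ _))
          (fun q hq i hi => hj q (Finset.mem_of_mem_erase hq) i (Finset.mem_of_mem_erase hi))
          (by
            rcases hq with h | h
            · exact Or.inl fun q hq q' hq' => h q (Finset.mem_of_mem_erase hq) q'
                (Finset.mem_of_mem_erase hq')
            · exact Or.inr (by omega)) (by omega) w hw v hve hw2
        have h3 := Pth.cons (hj w hwQ j hjJ).symm (by simp [hjQ]) this
        have h4 := Pth.cons (hj u hu j hjJ) (by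
          simp only [Finset.mem_insert, Finset.mem_union, Finset.mem_erase]
          have : u ≠ j := fun e => huJ (e ▸ hjJ)
          tauto) h3
        have e : insert u (insert j (Q.erase u ∪ J.erase j)) = Q ∪ J := by
          ext x
          simp only [Finset.mem_insert, Finset.mem_union, Finset.mem_erase]
          by_cases hxu : x = u <;> by_cases hxj : x = j <;> simp_all
        rwa [e] at h4

/-- The bipartite subgraph of `G` between `A` and `B`. -/
def bipSub {V : Type*} (G : SimpleGraph V) (A B : Finset V) : SimpleGraph V where
  Adj u v := G.Adj u v ∧ ((u ∈ A ∧ v ∈ B) ∨ (u ∈ B ∧ v ∈ A))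
  symm := ⟨fun u v h => ⟨h.1.symm, by tauto⟩⟩
  loopless := ⟨fun u h => G.loopless.irrefl u h.1⟩

open scoped Classical in
theorem jackson_step {V : Type*} [DecidableEq V] (G : SimpleGraph V) (A B : Finset V)
    (hAB : Disjoint A B) (d : ℕ) (hdA : A.card ≤ d) (hb : B.card + 2 ≤ 2 * d)
    (hdeg : ∀ a ∈ A, d ≤ (B.filter (G.Adj a)).card) (c : ℕ) (hc2 : 2 ≤ c) (hcA : c < A.card)
    (hcyc : HasCyc (bipSub G A B) (2 * c)) : HasCyc (bipSub G A B) (2 * (c + 1)) := by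
  by_contra hno
  set H := bipSub G A B with hH
  have hHA : ∀ a ∈ A, ∀ b ∈ B, (H.Adj a b ↔ G.Adj a b) := by
    intro a ha b hb; simp only [hH, bipSub]; tauto
  have hnAB : ∀ a ∈ A, a ∉ B := fun a ha hb => Finset.disjoint_left.1 hAB ha hb
  have hAtoB : ∀ u w, H.Adj u w → u ∈ A → w ∈ B := by
    intro u w h hu
    rcases h.2 with h | h
    · exact h.2
    · exact absurd h.1 (hnAB u hu)
  have hBtoA : ∀ u w, H.Adj u w → u ∈ B → w ∈ A := by
    intro u w h hu
    rcases h.2 with h | h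
    · exact absurd hu (hnAB u h.1)
    · exact h.2
  -- a cycle starting in `A`
  obtain ⟨v, hv, hv0⟩ : ∃ v, IsCyc H (2 * c) v ∧ v 0 ∈ A := by
    obtain ⟨v, hv⟩ := hcyc.isCyc
    by_cases h0 : v 0 ∈ A
    · exact ⟨v, hv, h0⟩
    · refine ⟨_, hv.shift 1, ?_⟩
      rcases (hv.adj 0).2 with h | h
      · exact absurd h.1 h0
      · exact h.2
  have hpar : ∀ i, v (2 * i) ∈ A ∧ v (2 * i + 1) ∈ B := by
    intro i
    induction i with
    | zero => exact ⟨hv0, hAtoB _ _ (hv.adj 0) hv0⟩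
    | succ i ih =>
      have h1 := hBtoA _ _ (hv.adj (2 * i + 1)) ih.2
      exact ⟨h1, hAtoB _ _ (hv.adj (2 * i + 2)) h1⟩
  have hinj : ∀ i j, i < 2 * c → j < 2 * c → v i = v j → i = j := by
    intro i j hi hj e
    by_contra hne
    rcases lt_or_gt_of_ne hne with h1 | h1
    · exact hv.inj i j h1 (by omega) e
    · exact hv.inj j i h1 (by omega) e.symm
  have hmod : ∀ i, v i = v (i % (2 * c)) := by
    intro i
    have : ∀ k r, v (r + 2 * c * k) = v r := by
      intro k r
      induction k with
      | zero => rfl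
      | succ k ih => rw [Nat.mul_succ, ← Nat.add_assoc, hv.per, ih]
    conv_lhs => rw [← Nat.mod_add_div i (2 * c)]
    exact this _ _
  set CA := (Finset.range c).image (fun i => v (2 * i)) with hCA
  set CB := (Finset.range c).image (fun i => v (2 * i + 1)) with hCB
  have hCBc : CB.card = c := by
    rw [hCB, Finset.card_image_of_injOn, Finset.card_range]
    intro i hi j hj e
    simp only [Finset.coe_range, Set.mem_Iio] at hi hj
    have := hinj _ _ (by omega) (by omega) e
    omega
  have hCBB : CB ⊆ B := by
    intro x hx
    simp only [hCB, Finset.mem_image] at hx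
    obtain ⟨i, _, rfl⟩ := hx
    exact (hpar i).2
  obtain ⟨a, haA, haC⟩ : ∃ a ∈ A, a ∉ CA := by
    apply Finset.exists_mem_notMem_of_card_lt_card
    refine lt_of_le_of_lt Finset.card_image_le ?_
    simpa using hcA
  have hcov : ∀ i, v i ∈ CA ∨ v i ∈ CB := by
    intro i
    rw [hmod i]
    have h1 := Nat.mod_lt i (show 0 < 2 * c by omega)
    set r := i % (2 * c)
    rcases Nat.even_or_odd' r with ⟨s, hs | hs⟩
    · left; rw [hs]; exact Finset.mem_image.2 ⟨s, by simp; omega, rfl⟩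
    · right; rw [hs]; exact Finset.mem_image.2 ⟨s, by simp; omega, rfl⟩
  have hva : ∀ i, v i ≠ a := by
    intro i e
    rcases hcov i with h | h
    · exact haC (e ▸ h)
    · exact hnAB a haA (hCBB (e ▸ h))
  set R := B \ CB with hR
  have hRc : R.card = B.card - c := by rw [hR, Finset.card_sdiff_of_subset hCBB, hCBc]
  have hcB : c ≤ B.card := hCBc ▸ Finset.card_le_card hCBB
  have hvR : ∀ r ∈ R, ∀ i, v i ≠ r := by
    intro r hr i e
    rw [hR, Finset.mem_sdiff] at hr
    rcases hcov i with h | h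
    · simp only [hCA, Finset.mem_image] at h
      obtain ⟨j, _, hj⟩ := h
      exact hnAB r (by rw [← e, ← hj]; exact (hpar j).1) hr.1
    · exact hr.2 (e ▸ h)
  set NR : V → Finset V := fun u => R.filter (H.Adj u) with hNR
  have hNRmem : ∀ u r, r ∈ NR u ↔ r ∈ R ∧ H.Adj u r := by intro u r; simp [hNR]
  have hRB : R ⊆ B := Finset.sdiff_subset
  set T := (Finset.range c).filter (fun i => H.Adj a (v (2 * i + 1))) with hT
  -- degrees into `R`
  have hdegH : ∀ u ∈ A, d ≤ (B.filter (H.Adj u)).card := by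
    intro u hu
    refine le_trans (hdeg u hu) (Finset.card_le_card ?_)
    intro b hb
    rw [Finset.mem_filter] at hb ⊢
    exact ⟨hb.1, (hHA u hu b hb.1).2 hb.2⟩
  have hNRa : d ≤ (NR a).card + T.card := by
    refine le_trans (hdegH a haA) ?_
    have : B.filter (H.Adj a) ⊆ NR a ∪ T.image (fun i => v (2 * i + 1)) := by
      intro b hb
      rw [Finset.mem_filter] at hb
      rw [Finset.mem_union, hNRmem, hR, Finset.mem_sdiff]
      by_cases hbC : b ∈ CB
      · right
        simp only [hCB, Finset.mem_image] at hbC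
        obtain ⟨i, hi, rfl⟩ := hbC
        exact Finset.mem_image.2 ⟨i, by rw [hT, Finset.mem_filter]; exact ⟨hi, hb.2⟩, rfl⟩
      · left; exact ⟨⟨hb.1, hbC⟩, hb.2⟩
    refine le_trans (Finset.card_le_card this) (le_trans (Finset.card_union_le _ _) ?_)
    have := Finset.card_image_le (s := T) (f := fun i => v (2 * i + 1))
    omega
  have hNRu : ∀ u ∈ A, d ≤ (NR u).card + c := by
    intro u hu
    refine le_trans (hdegH u hu) ?_
    have : B.filter (H.Adj u) ⊆ NR u ∪ CB := by
      intro b hb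
      rw [Finset.mem_filter] at hb
      rw [Finset.mem_union, hNRmem, hR, Finset.mem_sdiff]
      tauto
    refine le_trans (Finset.card_le_card this) (le_trans (Finset.card_union_le _ _) ?_)
    omega
  have hAA : ∀ i, v (2 * i + 2) ∈ A := fun i => (hpar (i + 1)).1
  -- disjointness
  have hdis1 : ∀ i ∈ T, Disjoint (NR a) (NR (v (2 * i + 2))) := by
    intro i hi
    rw [Finset.disjoint_left]
    intro r hr hr2
    rw [hNRmem] at hr hr2
    rw [hT, Finset.mem_filter] at hi
    apply hno
    have := hv.one (p := 2 * i + 2) (q := 2 * i + 1 + 2 * c) (by omega) (by omega)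
      (Pth.two hr.2) (by
        intro j; simp only [Finset.mem_insert, Finset.mem_singleton, not_or]
        exact ⟨hva j, hvR r hr.1 j⟩) (by rw [hv.per]; exact hi.2.symm) hr2.2.symm
    rw [Finset.card_pair hr.2.ne] at this
    convert this using 1; omega
  have hdis2 : ∀ i ∈ T, ∀ j ∈ T, i < j →
      Disjoint (NR (v (2 * i + 2))) (NR (v (2 * j + 2))) := by
    intro i hi j hj hij
    rw [Finset.disjoint_left]
    intro r hr hr2
    rw [hNRmem] at hr hr2
    rw [hT, Finset.mem_filter, Finset.mem_range] at hi hj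
    apply hno
    have := hv.two (p := 2 * i + 2) (q := 2 * j + 1) (r := 2 * j + 2) (s := 2 * i + 1 + 2 * c)
      (by omega) (by omega) (by omega) (by omega) (x := a) (z := r)
      (by rintro rfl; exact hnAB _ haA (hRB hr.1)) hva (hvR r hr.1) hj.2.symm
      (by rw [hv.per]; exact hi.2) hr2.2 hr.2.symm
    convert this using 1; omega
  rcases T.eq_empty_or_nonempty with hT0 | hTn
  · -- no neighbour on the cycle
    rw [hT0, Finset.card_empty] at hNRa
    have hcommon : ∀ u ∈ A, 2 ≤ (NR a ∩ B.filter (H.Adj u)).card := by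
      intro u hu
      have h1 := Finset.card_union_add_card_inter (NR a) (B.filter (H.Adj u))
      have h2 : (NR a ∪ B.filter (H.Adj u)).card ≤ B.card := by
        apply Finset.card_le_card
        apply Finset.union_subset _ (Finset.filter_subset _ _)
        intro r hr; exact hRB ((hNRmem _ _).1 hr).1
      have h3 := hdegH u hu
      omega
    obtain ⟨r, hr⟩ := Finset.card_pos.1 (lt_of_lt_of_le (by norm_num) (hcommon _ (hpar 0).1))
    obtain ⟨r', hr', hne⟩ := Finset.exists_mem_ne (lt_of_lt_of_le (by norm_num)
      (hcommon _ (hpar 1).1)) r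
    rw [Finset.mem_inter, hNRmem, Finset.mem_filter] at hr hr'
    apply hno
    have := hv.one (p := 2) (q := 2 * c) (by omega) (by omega)
      (Pth.three hr.1.2.symm hr'.1.2 hne.symm) (by
        intro j; simp only [Finset.mem_insert, Finset.mem_singleton, not_or]
        exact ⟨hvR r hr.1.1 j, hva j, hvR r' hr'.1.1 j⟩)
        (by have := hv.per 0; rw [Nat.zero_add] at this; rw [this]; exact hr.2.2) hr'.2.2.symm
    rw [Finset.card_eq_three.2 ⟨_, _, _, hr.1.2.ne.symm, hne.symm, hr'.1.2.ne, rfl⟩] at this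
    convert this using 1; omega
  · have hsub : NR a ∪ T.biUnion (fun i => NR (v (2 * i + 2))) ⊆ R := by
      intro r hr
      rw [Finset.mem_union, Finset.mem_biUnion] at hr
      rcases hr with hr | ⟨i, _, hr⟩
      · exact ((hNRmem _ _).1 hr).1
      · exact ((hNRmem _ _).1 hr).1
    have h1 := Finset.card_le_card hsub
    rw [Finset.card_union_of_disjoint (by
      rw [Finset.disjoint_biUnion_right]; exact hdis1), Finset.card_biUnion (by
      intro i hi j hj hij
      rcases lt_or_gt_of_ne hij with h | h
      · exact hdis2 i hi j hj h
      · exact (hdis2 j hj i hi h).symm)] at h1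
    have h2 : T.card * (d - c) ≤ ∑ i ∈ T, (NR (v (2 * i + 2))).card := by
      rw [← smul_eq_mul]
      apply Finset.card_nsmul_le_sum
      intro i _
      have := hNRu _ (hAA i)
      omega
    have h3 : 1 ≤ T.card := Finset.card_pos.2 hTn
    obtain ⟨g, hg⟩ : ∃ g, d = c + 1 + g := ⟨d - c - 1, by omega⟩
    have h4 : T.card * (d - c) = T.card + T.card * g := by
      rw [show d - c = 1 + g by omega, Nat.mul_add, Nat.mul_one]
    have h5 : g ≤ T.card * g := Nat.le_mul_of_pos_left _ h3
    omega

open scoped Classical in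
theorem jackson {V : Type*} [DecidableEq V] (G : SimpleGraph V) (A B : Finset V)
    (hAB : Disjoint A B) (d : ℕ) (hA : 2 ≤ A.card) (hdA : A.card ≤ d) (hb : B.card + 2 ≤ 2 * d)
    (hdeg : ∀ a ∈ A, d ≤ (B.filter (G.Adj a)).card) : HasCyc G (2 * A.card) := by
  have key : ∀ c, 2 ≤ c → c ≤ A.card → HasCyc (bipSub G A B) (2 * c) := by
    intro c hc
    induction c, hc using Nat.le_induction with
    | base =>
      intro _
      obtain ⟨a, ha, a', ha', hne⟩ := Finset.one_lt_card.1 (show 1 < A.card by omega)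
      have h1 := Finset.card_union_add_card_inter (B.filter (G.Adj a)) (B.filter (G.Adj a'))
      have h2 : (B.filter (G.Adj a) ∪ B.filter (G.Adj a')).card ≤ B.card :=
        Finset.card_le_card (Finset.union_subset (Finset.filter_subset _ _)
          (Finset.filter_subset _ _))
      have h3 := hdeg a ha
      have h4 := hdeg a' ha'
      obtain ⟨r, hr, r', hr', hrr⟩ := Finset.one_lt_card.1
        (show 1 < (B.filter (G.Adj a) ∩ B.filter (G.Adj a')).card by omega)
      rw [Finset.mem_inter, Finset.mem_filter, Finset.mem_filter] at hr hr'
      refine ⟨_, _, _, Pth.cons (u := r') (w := a) ⟨hr'.1.2.symm, Or.inr ⟨hr'.1.1, ha⟩⟩ ?_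
        (Pth.three (v := r) (w := a') ⟨hr.1.2, Or.inl ⟨ha, hr.1.1⟩⟩
          ⟨hr.2.2.symm, Or.inr ⟨hr.1.1, ha'⟩⟩ hne), ⟨hr'.2.2, Or.inl ⟨ha', hr'.1.1⟩⟩, ?_⟩
      · simp [hr'.1.2.ne.symm, hr'.2.2.ne.symm, hrr.symm]
      · rw [Finset.card_insert_of_notMem (by simp [hr'.1.2.ne.symm, hr'.2.2.ne.symm, hrr.symm]),
          Finset.card_eq_three.2 ⟨_, _, _, hr.1.2.ne, hne, hr.2.2.ne.symm, rfl⟩]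
    | succ c hc ih =>
      intro h
      exact jackson_step G A B hAB d hdA hb hdeg c hc (by omega) (ih (by omega))
  exact (key _ hA le_rfl).mono (fun u v (h : (bipSub G A B).Adj u v) => h.1)

theorem IsCyc.per_mul {V : Type*} {G : SimpleGraph V} {K : ℕ} {v : ℕ → V}
    (h : IsCyc G K v) (k r : ℕ) : v (r + K * k) = v r := by
  induction k with
  | zero => rfl
  | succ k ih => rw [Nat.mul_succ, ← Nat.add_assoc, h.per, ih]

theorem IsCyc.mod {V : Type*} {G : SimpleGraph V} {K : ℕ} {v : ℕ → V}
    (h : IsCyc G K v) (i : ℕ) : v i = v (i % K) := by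
  conv_lhs => rw [← Nat.mod_add_div i K]
  exact h.per_mul _ _

theorem IsCyc.injOn {V : Type*} {G : SimpleGraph V} {K : ℕ} {v : ℕ → V}
    (h : IsCyc G K v) (i j : ℕ) (hi : i < K) (hj : j < K) (e : v i = v j) : i = j := by
  by_contra hne
  rcases lt_or_gt_of_ne hne with h1 | h1
  · exact h.inj i j h1 (by omega) e
  · exact h.inj j i h1 (by omega) e.symm

/-- Every index is congruent to one in a given window. -/
theorem IsCyc.window {V : Type*} {G : SimpleGraph V} {K : ℕ} {v : ℕ → V}
    (h : IsCyc G K v) (hK : 0 < K) (i j : ℕ) :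
    ∃ i', j ≤ i' ∧ i' < j + K ∧ ∀ s, v (i' + s) = v (i + s) := by
  refine ⟨j + (i + (K - 1) * j) % K, by omega, ?_, ?_⟩
  · have := Nat.mod_lt (i + (K - 1) * j) hK
    omega
  · intro s
    rw [h.mod (_ + s), h.mod (i + s)]
    congr 1
    have h1 : (j + (i + (K - 1) * j) % K + s) ≡ (j + (i + (K - 1) * j) + s) [MOD K] :=
      Nat.ModEq.add_right _ (Nat.ModEq.add_left _ (Nat.mod_modEq _ _))
    have h2 : j + (i + (K - 1) * j) + s = i + s + K * j := by
      obtain ⟨L, rfl⟩ := Nat.exists_eq_add_of_le' hK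
      simp; ring
    rw [h2] at h1
    have h3 : (i + s + K * j) ≡ (i + s) [MOD K] := by simp [Nat.ModEq]
    exact h1.trans h3

theorem IsCyc.F1 {V : Type*} [DecidableEq V] {G : SimpleGraph V} {K : ℕ} {v : ℕ → V}
    (h : IsCyc G K v) (hK : 0 < K) (hno : ¬ HasCyc G (K + 1)) {x : V} (hx : ∀ i, v i ≠ x) (i : ℕ)
    (h1 : G.Adj x (v i)) (h2 : G.Adj x (v (i + 1))) : False := by
  apply hno
  have := h.one (p := i + 1) (q := i + K) (by omega) (by omega) (Pth.single x)
    (by simpa using hx) (by rw [h.per]; exact h1.symm) h2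
  convert this using 1
  rw [Finset.card_singleton]; omega

theorem IsCyc.F2 {V : Type*} [DecidableEq V] {G : SimpleGraph V} {K : ℕ} {v : ℕ → V}
    (h : IsCyc G K v) (hno : ¬ HasCyc G (K + 1)) {x : V} (hx : ∀ i, v i ≠ x) (i j : ℕ)
    (hij : i < j) (hj : j < i + K)
    (h1 : G.Adj x (v i)) (h2 : G.Adj x (v j)) : ¬ G.Adj (v (i + 1)) (v (j + 1)) := by
  intro h3
  apply hno
  have := h.two0 (p := i + 1) (q := j) (r := j + 1) (s := i + K) (by omega) (by omega) (by omega)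
    (by omega) (Pth.single x)
    (by simpa using hx) h2.symm (by rw [h.per]; exact h1) h3.symm
  convert this using 1
  rw [Finset.card_singleton]; omega

theorem IsCyc.R1 {V : Type*} [DecidableEq V] {G : SimpleGraph V} {K : ℕ} {v : ℕ → V}
    (h : IsCyc G K v) (hK : 0 < K) (hno : ¬ HasCyc G (K + 1)) {x z : V} (hxz : x ≠ z)
    (hx : ∀ i, v i ≠ x)
    (hz : ∀ i, v i ≠ z) (i j : ℕ)
    (h1 : G.Adj x (v i)) (h2 : G.Adj z (v (i + 2))) (h3 : G.Adj x (v j))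
    (h4 : G.Adj z (v (j + 1))) : False := by
  obtain ⟨i', hi1, hi2, hs⟩ := h.window hK i j
  have e0 := hs 0
  have e1 := hs 1
  have e2 := hs 2
  simp only [Nat.add_zero] at e0
  rw [← e0] at h1
  rw [← e2] at h2
  rcases Nat.eq_or_lt_of_le hi1 with rfl | hlt
  · exact h.F1 hK hno hz _ h4 h2
  by_cases hq : i' + 1 = j + K
  · refine h.F1 hK hno hx _ h1 ?_
    rw [hq, h.per]; exact h3
  apply hno
  have := h.two (p := j + 1) (q := i') (r := i' + 2) (s := j + K) (by omega) (by omega) (by omega)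
    (by omega) hxz hx hz h1.symm (by rw [h.per]; exact h3) h2.symm h4
  convert this using 1
  omega

open scoped Classical in
/-- Index set of neighbours of `x` on the cycle. -/
noncomputable def nbI {V : Type*} (G : SimpleGraph V) (K : ℕ) (v : ℕ → V) (x : V) : Finset ℕ :=
  (Finset.range K).filter (fun i => G.Adj x (v i))

open scoped Classical in
theorem IsCyc.gaps {V : Type*} [DecidableEq V] {G : SimpleGraph V} {K : ℕ} {v : ℕ → V}
    (h : IsCyc G K v) (hK : 0 < K) (hno : ¬ HasCyc G (K + 1)) {x : V} (hx : ∀ i, v i ≠ x) :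
    ((Finset.range K).filter (fun i => ¬ G.Adj x (v i) ∧ ¬ G.Adj x (v (i + 1)))).card
      + 2 * (nbI G K v x).card = K := by
  have e1 : (nbI G K v x).card
      = ((Finset.range K).filter (fun i => G.Adj x (v (i + 1)))).card := by
    symm
    apply Finset.card_bij (fun i _ => (i + 1) % K)
    · intro i hi
      simp only [nbI, Finset.mem_filter, Finset.mem_range] at hi ⊢
      exact ⟨Nat.mod_lt _ hK, by rw [← h.mod]; exact hi.2⟩
    · intro i hi j hj e
      simp only [Finset.mem_filter, Finset.mem_range] at hi hj
      have := Nat.ModEq.add_right_cancel' 1 (show i + 1 ≡ j + 1 [MOD K] from e)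
      exact Nat.ModEq.eq_of_lt_of_lt this hi.1 hj.1
    · intro j hj
      simp only [nbI, Finset.mem_filter, Finset.mem_range] at hj
      refine ⟨(j + (K - 1)) % K, ?_, ?_⟩
      · simp only [Finset.mem_filter, Finset.mem_range]
        refine ⟨Nat.mod_lt _ hK, ?_⟩
        rw [h.mod, Nat.mod_add_mod, show j + (K - 1) + 1 = j + K by omega, Nat.add_mod_right,
          ← h.mod]
        exact hj.2
      · rw [Nat.mod_add_mod, show j + (K - 1) + 1 = j + K by omega, Nat.add_mod_right,
          Nat.mod_eq_of_lt hj.1]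
  have e2 : Finset.range K = (Finset.range K).filter (fun i => ¬ G.Adj x (v i) ∧ ¬ G.Adj x (v (i + 1)))
      ∪ (nbI G K v x ∪ (Finset.range K).filter (fun i => G.Adj x (v (i + 1)))) := by
    ext i
    simp only [nbI, Finset.mem_union, Finset.mem_filter]
    tauto
  have e3 := congrArg Finset.card e2
  rw [Finset.card_union_of_disjoint, Finset.card_union_of_disjoint, Finset.card_range] at e3
  · omega
  · rw [Finset.disjoint_left]
    intro i hi hj
    simp only [nbI, Finset.mem_filter] at hi hj
    exact h.F1 hK hno hx i hi.2 hj.2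
  · rw [Finset.disjoint_left]
    intro i hi hj
    simp only [nbI, Finset.mem_union, Finset.mem_filter] at hi hj
    tauto

/-- Vertex set of the cycle. -/
def cycV {V : Type*} [DecidableEq V] (K : ℕ) (v : ℕ → V) : Finset V := (Finset.range K).image v

theorem IsCyc.mem_cycV {V : Type*} [DecidableEq V] {G : SimpleGraph V} {K : ℕ} {v : ℕ → V}
    (h : IsCyc G K v) (hK : 0 < K) (i : ℕ) : v i ∈ cycV K v := by
  rw [h.mod, cycV]
  exact Finset.mem_image_of_mem _ (Finset.mem_range.2 (Nat.mod_lt _ hK))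

theorem IsCyc.card_cycV {V : Type*} [DecidableEq V] {G : SimpleGraph V} {K : ℕ} {v : ℕ → V}
    (h : IsCyc G K v) : (cycV K v).card = K := by
  rw [cycV, Finset.card_image_of_injOn, Finset.card_range]
  intro i hi j hj e
  exact h.injOn i j (by simpa using hi) (by simpa using hj) e

open scoped Classical in
theorem IsCyc.red_card {V : Type*} [DecidableEq V] {G : SimpleGraph V} {K : ℕ} {v : ℕ → V}
    (h : IsCyc G K v) {x : V} (hx : ∀ i, v i ≠ x) :
    ((cycV K v).filter (Gᶜ.Adj x)).card + (nbI G K v x).card = K := by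
  have e1 : (nbI G K v x).card = ((cycV K v).filter (G.Adj x)).card := by
    apply Finset.card_bij (fun i _ => v i)
    · intro i hi
      simp only [nbI, cycV, Finset.mem_filter, Finset.mem_image] at hi ⊢
      exact ⟨⟨i, hi.1, rfl⟩, hi.2⟩
    · intro i hi j hj e
      simp only [nbI, Finset.mem_filter, Finset.mem_range] at hi hj
      exact h.injOn i j hi.1 hj.1 e
    · intro b hb
      simp only [nbI, cycV, Finset.mem_filter, Finset.mem_image] at hb ⊢
      obtain ⟨⟨i, hi, rfl⟩, hb⟩ := hb
      exact ⟨i, ⟨hi, hb⟩, rfl⟩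
  have e2 : (cycV K v).filter (Gᶜ.Adj x) = (cycV K v).filter (fun u => ¬ G.Adj x u) := by
    apply Finset.filter_congr
    intro u hu
    simp only [cycV, Finset.mem_image] at hu
    obtain ⟨i, _, rfl⟩ := hu
    rw [SimpleGraph.compl_adj]
    have := hx i
    tauto
  have e3 : ((cycV K v).filter (G.Adj x)).card
      + ((cycV K v).filter (fun u => ¬ G.Adj x u)).card = K := by
    conv_rhs => rw [← h.card_cycV]
    convert Finset.card_filter_add_card_filter_not (s := cycV K v) (fun u => G.Adj x u)
  rw [e1, e2]
  omega

open scoped Classical in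
/-- Neighbours of `x` inside `A`. -/
noncomputable def nbF {V : Type*} (G : SimpleGraph V) (A : Finset V) (x : V) : Finset V :=
  A.filter (fun u => G.Adj x u)

theorem mem_nbF {V : Type*} {G : SimpleGraph V} {A : Finset V} {x u : V} :
    u ∈ nbF G A x ↔ u ∈ A ∧ G.Adj x u := by
  classical
  simp [nbF]

theorem jackson' {V : Type*} [DecidableEq V] (G : SimpleGraph V) (A B : Finset V)
    (hAB : Disjoint A B) (d : ℕ) (hA : 2 ≤ A.card) (hdA : A.card ≤ d) (hb : B.card + 2 ≤ 2 * d)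
    (hdeg : ∀ a ∈ A, d ≤ (nbF G B a).card) : HasCyc G (2 * A.card) :=
  jackson G A B hAB d hA hdA hb hdeg

theorem IsCyc.red_card' {V : Type*} [DecidableEq V] {G : SimpleGraph V} {K : ℕ} {v : ℕ → V}
    (h : IsCyc G K v) {x : V} (hx : ∀ i, v i ≠ x) :
    (nbF Gᶜ (cycV K v) x).card + (nbI G K v x).card = K := by
  classical
  refine Eq.trans ?_ (h.red_card hx)
  congr 2
  ext u
  rw [mem_nbF, Finset.mem_filter]

theorem IsCyc.cycV_shift {V : Type*} [DecidableEq V] {G : SimpleGraph V} {K : ℕ} {v : ℕ → V}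
    (h : IsCyc G K v) (hK : 0 < K) (s : ℕ) : cycV K (fun i => v (i + s)) = cycV K v := by
  apply Finset.eq_of_subset_of_card_le
  · intro x hx
    simp only [cycV, Finset.mem_image] at hx
    obtain ⟨i, _, rfl⟩ := hx
    exact h.mem_cycV hK _
  · rw [h.card_cycV, (h.shift s).card_cycV]

theorem IsCyc.nbI_shift {V : Type*} [DecidableEq V] {G : SimpleGraph V} {K : ℕ} {v : ℕ → V}
    (h : IsCyc G K v) (hK : 0 < K) (s : ℕ) {x : V} (hx : ∀ i, v i ≠ x) :
    (nbI G K (fun i => v (i + s)) x).card = (nbI G K v x).card := by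
  classical
  have h1 := h.red_card hx
  have h2 := (h.shift s).red_card (x := x) (fun i => hx _)
  rw [h.cycV_shift hK] at h2
  omega

theorem IsCyc.gap_unique {V : Type*} [DecidableEq V] {G : SimpleGraph V} {e : ℕ} {v : ℕ → V}
    (h : IsCyc G (2 * e + 1) v) (hno : ¬ HasCyc G (2 * e + 2)) {y : V} (hy : ∀ i, v i ≠ y)
    (hp : (nbI G (2 * e + 1) v y).card = e) :
    (∃ t, t < 2 * e + 1 ∧ ¬ G.Adj y (v t) ∧ ¬ G.Adj y (v (t + 1))) ∧
    ∀ i j, i < 2 * e + 1 → j < 2 * e + 1 → i ≠ j →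
      G.Adj y (v i) ∨ G.Adj y (v (i + 1)) ∨ G.Adj y (v j) ∨ G.Adj y (v (j + 1)) := by
  classical
  have h1 := h.gaps (by omega) hno hy
  rw [hp] at h1
  have h2 : ((Finset.range (2 * e + 1)).filter
    (fun i => ¬ G.Adj y (v i) ∧ ¬ G.Adj y (v (i + 1)))).card = 1 := by omega
  obtain ⟨t, ht⟩ := Finset.card_eq_one.1 h2
  constructor
  · have : t ∈ ({t} : Finset ℕ) := by simp
    rw [← ht, Finset.mem_filter, Finset.mem_range] at this
    exact ⟨t, this⟩
  · intro i j hi hj hij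
    by_contra hcon
    push Not at hcon
    have a1 : i ∈ ({t} : Finset ℕ) := by
      rw [← ht, Finset.mem_filter, Finset.mem_range]; exact ⟨hi, hcon.1, hcon.2.1⟩
    have a2 : j ∈ ({t} : Finset ℕ) := by
      rw [← ht, Finset.mem_filter, Finset.mem_range]; exact ⟨hj, hcon.2.2.1, hcon.2.2.2⟩
    simp only [Finset.mem_singleton] at a1 a2
    omega

/-- The case where the perfect vertex `x` is normalised. -/
theorem IsCyc.odd_aux {V : Type*} [DecidableEq V] {G : SimpleGraph V} {e : ℕ} {v : ℕ → V}
    (h : IsCyc G (2 * e + 1) v) (he : 2 ≤ e) (hno : ¬ HasCyc G (2 * e + 2)) {x y : V}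
    (hx : ∀ i, v i ≠ x) (hy : ∀ i, v i ≠ y)
    (hS : ∀ l, l < e → G.Adj x (v (2 * l)))
    (hp : (nbI G (2 * e + 1) v y).card = e) :
    G.Adj y (v 0) ∨ (e = 2 ∧ G.Adj y (v 2) ∧ G.Adj y (v 4)) := by
  by_cases hxy : x = y
  · subst hxy; left; exact hS 0 (by omega)
  by_contra hcon
  push Not at hcon
  obtain ⟨hy0, hcon⟩ := hcon
  obtain ⟨-, hu⟩ := h.gap_unique hno hy hp
  have hyK : ¬ G.Adj y (v (2 * e + 1)) := by
    have := h.per 0; rw [Nat.zero_add] at this; rwa [this]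
  have hxK : G.Adj x (v (2 * e + 1)) := by
    have := h.per 0; rw [Nat.zero_add] at this; rw [this]; exact hS 0 (by omega)
  have hR := h.R1 (by omega) hno hxy hx hy
  have hR' := h.R1 (by omega) hno (Ne.symm hxy) hy hx
  by_cases hA : ∃ l, l < e ∧ G.Adj y (v (2 * l + 1))
  · obtain ⟨l, hl, hyl⟩ := hA
    have hB : ∀ l, l < e → ¬ G.Adj y (v (2 * l + 2)) :=
      fun l' hl' hyl' => hR _ _ (hS l' hl') hyl' (hS l hl) hyl
    have hgap := hu (2 * e)
    have hodd : ∀ l, l < e → G.Adj y (v (2 * l + 1)) := by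
      intro l hl
      have h2 := hu (2 * e) (2 * l + 1) (by omega) (by omega) (by omega)
      have h3 := hB (e - 1) (by omega)
      rw [show 2 * (e - 1) + 2 = 2 * e by omega] at h3
      have h4 := hB l hl
      tauto
    refine hR' (2 * e - 1) 1 ?_ ?_ (hodd 0 (by omega)) (hS 1 (by omega))
    · have := hodd (e - 1) (by omega)
      rwa [show 2 * (e - 1) + 1 = 2 * e - 1 by omega] at this
    · rw [show 2 * e - 1 + 2 = 2 * e + 1 by omega]; exact hxK
  · push Not at hA
    have hev : ∀ l, l < e → G.Adj y (v (2 * l + 2)) := by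
      intro l hl
      have h2 := hu 0 (2 * l + 1) (by omega) (by omega) (by omega)
      have h3 := hA 0 (by omega)
      have h4 := hA l hl
      tauto
    by_cases he2 : e = 2
    · exact hcon he2 (hev 0 (by omega)) (hev 1 (by omega))
    · refine hR' 2 (2 * e) (hev 0 (by omega)) (hS 2 (by omega)) ?_ hxK
      have := hev (e - 1) (by omega)
      rwa [show 2 * (e - 1) + 2 = 2 * e by omega] at this

theorem IsCyc.odd_common {V : Type*} [DecidableEq V] {G : SimpleGraph V} {e : ℕ} {v : ℕ → V}
    (h : IsCyc G (2 * e + 1) v) (he : 2 ≤ e) (hno : ¬ HasCyc G (2 * e + 2)) :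
    ∃ t, ∀ y, (∀ i, v i ≠ y) → (nbI G (2 * e + 1) v y).card = e → G.Adj y (v t) := by
  by_cases hex : ∃ x, (∀ i, v i ≠ x) ∧ (nbI G (2 * e + 1) v x).card = e
  swap
  · push Not at hex
    exact ⟨0, fun y hy hc => absurd hc (hex y hy)⟩
  obtain ⟨x, hx, hxp⟩ := hex
  obtain ⟨⟨t, ht, ht0, ht1⟩, -⟩ := h.gap_unique hno hx hxp
  have hw := h.shift (t + 2)
  have hsh := fun y (hy : ∀ i, v i ≠ y) => h.nbI_shift (by omega) (t + 2) hy
  suffices ∃ s, ∀ y, (∀ i, v i ≠ y) → (nbI G (2 * e + 1) (fun i => v (i + (t + 2))) y).card = e →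
      G.Adj y ((fun i => v (i + (t + 2))) s) by
    obtain ⟨s, hs⟩ := this
    exact ⟨s + (t + 2), fun y hy hc => hs y hy (by rw [hsh y hy]; exact hc)⟩
  have hvw : ∀ y, (∀ i, v i ≠ y) → ∀ i, (fun i => v (i + (t + 2))) i ≠ y := fun y hy i => hy _
  rw [← hsh x hx] at hxp
  have hg1 : ¬ G.Adj x ((fun i => v (i + (t + 2))) (2 * e)) := by
    show ¬ G.Adj x (v (2 * e + (t + 2)))
    rwa [show 2 * e + (t + 2) = t + 1 + (2 * e + 1) by omega, h.per]
  have hg0 : ¬ G.Adj x ((fun i => v (i + (t + 2))) (2 * e - 1)) := by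
    show ¬ G.Adj x (v (2 * e - 1 + (t + 2)))
    rwa [show 2 * e - 1 + (t + 2) = t + (2 * e + 1) by omega, h.per]
  generalize hwd : (fun i => v (i + (t + 2))) = w at *
  obtain ⟨-, hu⟩ := hw.gap_unique hno (hvw x hx) hxp
  have hS : ∀ l, l < e → G.Adj x (w (2 * l)) := by
    intro l
    induction l with
    | zero =>
      intro _
      have h1 := hu (2 * e - 1) (2 * e) (by omega) (by omega) (by omega)
      rw [show 2 * e - 1 + 1 = 2 * e by omega] at h1
      have := hw.per 0; rw [Nat.zero_add] at this
      rw [this] at h1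
      simpa [hg0, hg1] using h1
    | succ l ih =>
      intro hl
      have h0 := ih (by omega)
      have h1 := hu (2 * e - 1) (2 * l + 1) (by omega) (by omega) (by omega)
      rw [show 2 * e - 1 + 1 = 2 * e by omega] at h1
      have h2 : ¬ G.Adj x (w (2 * l + 1)) := fun h2 => hw.F1 (by omega) hno (hvw x hx) _ h0 h2
      simp only [hg0, hg1, h2, false_or] at h1
      exact h1
  have haux := fun y (hy : ∀ i, v i ≠ y) => hw.odd_aux he hno (hvw x hx) (hvw y hy) hS
  by_cases hall : ∀ y, (∀ i, v i ≠ y) → (nbI G (2 * e + 1) w y).card = e → G.Adj y (w 0)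
  · exact ⟨0, hall⟩
  push Not at hall
  obtain ⟨z, hz, hzp, hz0⟩ := hall
  have hz' := haux z hz hzp
  simp only [hz0, false_or] at hz'
  obtain ⟨rfl, hz2, hz4⟩ := hz'
  refine ⟨2, fun y hy hyp => ?_⟩
  by_contra hy2
  have hy0 : G.Adj y (w 0) := by
    have := haux y hy hyp
    simpa [hy2] using this
  have hy1 : ¬ G.Adj y (w 1) := fun h2 => hw.F1 (by omega) hno (hvw y hy) _ hy0 h2
  have hy4 : ¬ G.Adj y (w 4) := fun h2 => by
    refine hw.F1 (by omega) hno (hvw y hy) 4 h2 ?_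
    have := hw.per 0
    simp only [Nat.zero_add] at this
    rw [show 4 + 1 = 2 * 2 + 1 by omega, this]; exact hy0
  have hy3 : G.Adj y (w 3) := by
    obtain ⟨-, hu'⟩ := hw.gap_unique hno (hvw y hy) hyp
    have := hu' 1 3 (by omega) (by omega) (by omega)
    simpa [hy1, hy2, hy4] using this
  refine hw.R1 (by omega) hno (x := y) (z := z) ?_ (hvw y hy) (hvw z hz) 0 3 hy0 hz2 hy3 hz4
  rintro rfl; exact hz0 hy0

theorem odd_step {V : Type*} [DecidableEq V] [Fintype V] (B : SimpleGraph V) (e h : ℕ)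
    (he : 2 ≤ e) (hh : 2 ≤ h) (hhe : h ≤ e + 1) (hN : 2 * e + 2 + h ≤ Fintype.card V)
    (hB : HasCyc B (2 * e + 1)) (hno : ¬ HasCyc B (2 * e + 2)) : HasCyc Bᶜ (2 * h) := by
  classical
  obtain ⟨v, hv⟩ := hB.isCyc
  obtain ⟨t, ht⟩ := hv.odd_common he hno
  have hcard : h ≤ ((cycV (2 * e + 1) v)ᶜ).card := by
    rw [Finset.card_compl, hv.card_cycV]; omega
  obtain ⟨A, hAs, hAc⟩ := Finset.exists_subset_card_eq hcard
  have hAv : ∀ a ∈ A, ∀ i, v i ≠ a := by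
    rintro a ha i rfl
    exact (Finset.mem_compl.1 (hAs ha)) (hv.mem_cycV (by omega) i)
  have key := jackson' Bᶜ A ((cycV (2 * e + 1) v).erase (v t)) (by
      rw [Finset.disjoint_left]
      intro a ha ha'
      exact Finset.mem_compl.1 (hAs ha) (Finset.mem_of_mem_erase ha')) (e + 1) (by omega)
      (by omega) (by rw [Finset.card_erase_of_mem (hv.mem_cycV (by omega) t), hv.card_cycV]; omega)
      (by
        intro a ha
        have h1 := hv.red_card' (hAv a ha)
        have h2 := hv.gaps (by omega) hno (hAv a ha)
        have h4 : nbF Bᶜ ((cycV (2 * e + 1) v).erase (v t)) a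
            = (nbF Bᶜ (cycV (2 * e + 1) v) a).erase (v t) := by
          ext u; simp only [mem_nbF, Finset.mem_erase]; tauto
        rw [h4]
        by_cases hp : (nbI B (2 * e + 1) v a).card = e
        · have h3 := ht a (hAv a ha) hp
          rw [Finset.erase_eq_of_notMem]
          · omega
          · rw [mem_nbF, SimpleGraph.compl_adj]; tauto
        · have := Finset.pred_card_le_card_erase (s := nbF Bᶜ (cycV (2 * e + 1) v) a)
            (a := v t)
          omega)
  rwa [hAc] at key

theorem clique_cyc {V : Type*} [DecidableEq V] {G : SimpleGraph V} (Q : Finset V) (n : ℕ)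
    (hn : 2 ≤ n) (hQ : n ≤ Q.card) (hc : ∀ q ∈ Q, ∀ q' ∈ Q, q ≠ q' → G.Adj q q') :
    HasCyc G n := by
  obtain ⟨A, hA, hAc⟩ := Finset.exists_subset_card_eq hQ
  obtain ⟨a, ha, b, hb, hab⟩ := Finset.one_lt_card.1 (show 1 < A.card by omega)
  have := zig (G := G) n A ∅ hAc (by simp) (by simp)
    (Or.inl (fun q hq q' hq' => hc q (hA hq) q' (hA hq'))) (by rw [Finset.card_empty]; omega) a ha b hb (Or.inl hab)
  exact ⟨_, _, _, this, hc b (hA hb) a (hA ha) hab.symm, by simpa using hAc⟩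

theorem cyc4 {V : Type*} [DecidableEq V] {G : SimpleGraph V} {a b c d : V}
    (hac : a ≠ c) (hbd : b ≠ d) (h1 : G.Adj a b) (h2 : G.Adj b c) (h3 : G.Adj c d)
    (h4 : G.Adj d a) : HasCyc G 4 := by
  have hn : a ∉ ({b, c, d} : Finset V) := by simp [h1.ne, hac, h4.ne.symm]
  refine ⟨_, _, _, Pth.cons h1 hn (Pth.three h2 h3 hbd), h4, ?_⟩
  rw [Finset.card_insert_of_notMem hn, Finset.card_eq_three.2 ⟨_, _, _, h2.ne, hbd, h3.ne, rfl⟩]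

theorem base_two_aux {V : Type*} [DecidableEq V] [Fintype V] (G : SimpleGraph V) (v : V)
    (hv : 4 ≤ (nbF G Finset.univ v).card) (hno : ¬ HasCyc G 4) : HasCyc Gᶜ 4 := by
  have hP : ∀ a b c, G.Adj v a → G.Adj v c → a ≠ c → v ≠ b → G.Adj a b → G.Adj b c → False :=
    fun a b c ha hc hac hb h1 h2 => hno (cyc4 hb hac ha h1 h2 hc.symm)
  obtain ⟨S, hS, hSc⟩ := Finset.exists_subset_card_eq hv
  obtain ⟨a, b, c, d, hab, hac, had, hbc, hbd, hcd, rfl⟩ := Finset.card_eq_four.1 hSc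
  have h1 : G.Adj v a := (mem_nbF.1 (hS (by simp))).2
  have h2 : G.Adj v b := (mem_nbF.1 (hS (by simp))).2
  have h3 : G.Adj v c := (mem_nbF.1 (hS (by simp))).2
  have h4 : G.Adj v d := (mem_nbF.1 (hS (by simp))).2
  have comp : ∀ x y, x ≠ y → ¬ G.Adj x y → Gᶜ.Adj x y := by
    intro x y h h'; rw [SimpleGraph.compl_adj]; exact ⟨h, h'⟩
  have hM : ∀ x y z, G.Adj v x → G.Adj v y → G.Adj v z → x ≠ z → G.Adj x y → ¬ G.Adj y z :=
    fun x y z hx hy hz hxz e1 e2 => hP x y z hx hz hxz hy.ne e1 e2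
  by_cases e1 : G.Adj a b ∨ G.Adj c d
  · -- use the cycle a c b d
    have k1 : ¬ G.Adj a c := by
      rcases e1 with e | e
      · exact fun h => hM b a c h2 h1 h3 hbc e.symm h
      · exact fun h => hM d c a h4 h3 h1 had.symm e.symm h.symm
    have k2 : ¬ G.Adj c b := by
      rcases e1 with e | e
      · exact fun h => hM a b c h1 h2 h3 hac e h.symm
      · exact fun h => hM d c b h4 h3 h2 hbd.symm e.symm h
    have k3 : ¬ G.Adj b d := by
      rcases e1 with e | e
      · exact fun h => hM a b d h1 h2 h4 had e h
      · exact fun h => hM c d b h3 h4 h2 hbc.symm e h.symm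
    have k4 : ¬ G.Adj d a := by
      rcases e1 with e | e
      · exact fun h => hM b a d h2 h1 h4 hbd e.symm h.symm
      · exact fun h => hM c d a h3 h4 h1 hac.symm e h
    exact cyc4 hab hcd (comp _ _ hac k1) (comp _ _ hbc.symm k2) (comp _ _ hbd k3)
      (comp _ _ had.symm k4)
  · push Not at e1
    by_cases e2 : G.Adj a c ∨ G.Adj b d
    · -- cycle a b c d
      have k2 : ¬ G.Adj b c := by
        rcases e2 with e | e
        · exact fun h => hM a c b h1 h3 h2 hab e h.symm
        · exact fun h => hM d b c h4 h2 h3 hcd.symm e.symm h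
      have k4 : ¬ G.Adj d a := by
        rcases e2 with e | e
        · exact fun h => hM c a d h3 h1 h4 hcd e.symm h.symm
        · exact fun h => hM b d a h2 h4 h1 hab.symm e h
      exact cyc4 hac hbd (comp _ _ hab e1.1) (comp _ _ hbc k2) (comp _ _ hcd e1.2)
        (comp _ _ had.symm k4)
    · push Not at e2
      -- cycle a b d c
      exact cyc4 had hbc (comp _ _ hab e1.1) (comp _ _ hbd e2.2)
        (comp _ _ hcd.symm (fun h => e1.2 h.symm)) (comp _ _ hac.symm (fun h => e2.1 h.symm))

theorem base_two {V : Type*} [DecidableEq V] [Fintype V] (G : SimpleGraph V)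
    (hN : 7 ≤ Fintype.card V) : HasCyc G 4 ∨ HasCyc Gᶜ 4 := by
  classical
  by_contra hcon
  push Not at hcon
  have h1 : ∀ v, (nbF G Finset.univ v).card ≤ 3 := by
    intro v
    by_contra h
    exact hcon.2 (base_two_aux G v (by omega) hcon.1)
  have h2 : ∀ v, (nbF Gᶜ Finset.univ v).card ≤ 3 := by
    intro v
    by_contra h
    have := base_two_aux Gᶜ v (by omega) hcon.2
    rw [compl_compl] at this
    exact hcon.1 this
  have h3 : ∀ v, (nbF G Finset.univ v).card + (nbF Gᶜ Finset.univ v).card + 1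
      = Fintype.card V := by
    intro v
    have e : (Finset.univ : Finset V)
        = insert v (nbF G Finset.univ v ∪ nbF Gᶜ Finset.univ v) := by
      ext u
      simp only [Finset.mem_univ, Finset.mem_insert, Finset.mem_union, mem_nbF,
        SimpleGraph.compl_adj, true_and, true_iff]
      by_cases hu : u = v
      · left; exact hu
      · right
        have : v ≠ u := fun h => hu h.symm
        tauto
    have e' := congrArg Finset.card e
    rw [Finset.card_univ] at e'
    rw [e', Finset.card_insert_of_notMem, Finset.card_union_of_disjoint]
    · rw [Finset.disjoint_left]
      intro u hu hu'
      rw [mem_nbF] at hu hu'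
      rw [SimpleGraph.compl_adj] at hu'
      exact hu'.2.2 hu.2
    · simp only [Finset.mem_union, mem_nbF, SimpleGraph.compl_adj]
      simp
  have h4 : ∀ v, G.degree v = 3 := by
    intro v
    have : G.degree v = (nbF G Finset.univ v).card := by
      rw [← SimpleGraph.card_neighborFinset_eq_degree]
      congr 1
      ext u
      simp [mem_nbF]
    rw [this]
    have := h1 v
    have := h2 v
    have := h3 v
    omega
  have hne : Nonempty V := Fintype.card_pos_iff.1 (by omega)
  obtain ⟨v⟩ := hne
  have h5 : Fintype.card V = 7 := by
    have := h1 v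
    have := h2 v
    have := h3 v
    omega
  have h6 := G.even_card_odd_degree_vertices
  have h7 : (Finset.univ.filter (fun v => Odd (G.degree v))) = (Finset.univ : Finset V) := by
    apply Finset.filter_true_of_mem
    intro v _
    rw [h4 v]; decide
  rw [h7, Finset.card_univ, h5] at h6
  exact absurd h6 (by decide)

theorem IsCyc.even_perf {V : Type*} [DecidableEq V] {G : SimpleGraph V} {e : ℕ} {v : ℕ → V}
    (h : IsCyc G (2 * e) v) (he : 0 < e) (hno : ¬ HasCyc G (2 * e + 1)) {y : V}
    (hy : ∀ i, v i ≠ y) (hp : (nbI G (2 * e) v y).card = e) (i : ℕ) :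
    G.Adj y (v (i + 1)) ↔ ¬ G.Adj y (v i) := by
  classical
  constructor
  · exact fun h2 h1 => h.F1 (by omega) hno hy i h1 h2
  · intro h1
    by_contra h2
    have h3 := h.gaps (by omega) hno hy
    rw [hp] at h3
    have h4 : ((Finset.range (2 * e)).filter
      (fun i => ¬ G.Adj y (v i) ∧ ¬ G.Adj y (v (i + 1)))).card = 0 := by omega
    rw [Finset.card_eq_zero] at h4
    have h5 : i % (2 * e) ∈ (∅ : Finset ℕ) := by
      rw [← h4, Finset.mem_filter, Finset.mem_range]
      refine ⟨Nat.mod_lt _ (by omega), by rwa [← h.mod], ?_⟩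
      rwa [h.mod, Nat.mod_add_mod, ← h.mod]
    simp at h5

theorem alt_iff {p : ℕ → Prop} (h : ∀ i, p (i + 1) ↔ ¬ p i) (h0 : p 0) (i : ℕ) :
    p i ↔ Even i := by
  induction i with
  | zero => simpa using h0
  | succ i ih => rw [h, ih, Nat.even_add_one]

theorem base_step {V : Type*} [DecidableEq V] [Fintype V] (B : SimpleGraph V) (g : ℕ)
    (hg : 2 ≤ g) (hN : 4 * g + 3 ≤ Fintype.card V) (hB : HasCyc B (2 * g))
    (hno2 : ¬ HasCyc B (2 * g + 2)) : HasCyc Bᶜ (2 * (g + 1)) := by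
  classical
  by_contra hred
  have hno : ¬ HasCyc B (2 * g + 1) := fun hc =>
    hred (odd_step B g (g + 1) hg (by omega) le_rfl (by omega) hc hno2)
  obtain ⟨v0, hv0⟩ := hB.isCyc
  have hXc : 2 * g + 3 ≤ ((cycV (2 * g) v0)ᶜ).card := by
    rw [Finset.card_compl, hv0.card_cycV]; omega
  have hX : ∀ x, x ∈ (cycV (2 * g) v0)ᶜ → ∀ i, v0 i ≠ x := by
    rintro x hx i rfl
    exact Finset.mem_compl.1 hx (hv0.mem_cycV (by omega) i)
  set X := (cycV (2 * g) v0)ᶜ with hXd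
  set P := X.filter (fun x => (nbI B (2 * g) v0 x).card = g) with hP
  set Q := X.filter (fun x => ¬ (nbI B (2 * g) v0 x).card = g) with hQ
  have hPQ : P.card + Q.card = X.card := Finset.card_filter_add_card_filter_not _
  have hQc : Q.card ≤ g := by
    by_contra hlt
    obtain ⟨A, hA, hAc⟩ := Finset.exists_subset_card_eq (show g + 1 ≤ Q.card by omega)
    apply hred
    rw [← hAc]
    apply jackson' Bᶜ A (cycV (2 * g) v0) _ (g + 1) (by omega) (by omega)
      (by rw [hv0.card_cycV]; omega)
    · intro a ha
      have h0 := Finset.mem_filter.1 (hA ha)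
      have h1 := hv0.red_card' (hX a h0.1)
      have h2 := hv0.gaps (by omega) hno (hX a h0.1)
      omega
    · rw [Finset.disjoint_left]
      intro a ha
      exact Finset.mem_compl.1 (Finset.mem_filter.1 (hA ha)).1
  obtain ⟨x, hxP⟩ := Finset.card_pos.1 (show 0 < P.card by omega)
  have hPm : ∀ y ∈ P, ∀ i, v0 i ≠ y := fun y hy => hX y (Finset.mem_filter.1 hy).1
  have hPp : ∀ y ∈ P, (nbI B (2 * g) v0 y).card = g := fun y hy => (Finset.mem_filter.1 hy).2
  obtain ⟨v, hv, hvm, hvp, hx0⟩ : ∃ v, IsCyc B (2 * g) v ∧ (∀ y ∈ P, ∀ i, v i ≠ y) ∧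
      (∀ y ∈ P, (nbI B (2 * g) v y).card = g) ∧ B.Adj x (v 0) := by
    by_cases h0 : B.Adj x (v0 0)
    · exact ⟨v0, hv0, hPm, hPp, h0⟩
    · refine ⟨_, hv0.shift 1, fun y hy i => hPm y hy _, ?_, ?_⟩
      · intro y hy
        rw [hv0.nbI_shift (by omega) 1 (hPm y hy)]; exact hPp y hy
      · exact (hv0.even_perf (by omega) hno (hPm x hxP) (hPp x hxP) 0).2 h0
  have hperf := fun y hy => hv.even_perf (by omega) hno (hvm y hy) (hvp y hy)
  have hxE := alt_iff (p := fun i => B.Adj x (v i)) (hperf x hxP) hx0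
  have hy0 : ∀ y ∈ P, B.Adj y (v 0) := by
    intro y hy
    by_contra h0
    have h1 := (hperf y hy 0).2 h0
    have h2 : ¬ B.Adj y (v 2) := fun h2 => (hperf y hy 1).1 h2 h1
    have h3 := (hperf y hy 2).2 h2
    have hne : x ≠ y := by rintro rfl; exact h0 hx0
    apply hno2
    have := hv.two (p := 1) (q := 2) (r := 3) (s := 0 + 2 * g) (by omega) (by omega) (by omega)
      (by omega) hne (hvm x hxP) (hvm y hy) ((hxE 2).2 (by decide)).symm
      (by rw [hv.per]; exact hx0) h3.symm h1
    convert this using 1; omega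
  have hE := fun y hy => alt_iff (p := fun i => B.Adj y (v i)) (hperf y hy) (hy0 y hy)
  set O := (Finset.range g).image (fun i => v (2 * i + 1)) with hO
  have hOc : O.card = g := by
    rw [hO, Finset.card_image_of_injOn, Finset.card_range]
    intro i hi j hj e
    simp only [Finset.coe_range, Set.mem_Iio] at hi hj
    have := hv.injOn _ _ (by omega) (by omega) e
    omega
  have hPO : Disjoint P O := by
    rw [Finset.disjoint_left]
    intro y hy hy'
    simp only [hO, Finset.mem_image] at hy'
    obtain ⟨i, _, e⟩ := hy'
    exact hvm y hy _ e
  have hPOadj : ∀ y ∈ P, ∀ o ∈ O, ¬ B.Adj y o := by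
    intro y hy o ho
    simp only [hO, Finset.mem_image] at ho
    obtain ⟨i, _, rfl⟩ := ho
    rw [hE y hy]; simp
  have hOO : ∀ i j, i < j → j < g → ¬ B.Adj (v (2 * i + 1)) (v (2 * j + 1)) := by
    intro i j hij hj
    exact hv.F2 hno (hvm x hxP) (2 * i) (2 * j) (by omega) (by omega)
      ((hxE _).2 (by simp)) ((hxE _).2 (by simp))
  apply hred
  refine clique_cyc (P ∪ O) _ (by omega) (by
    rw [Finset.card_union_of_disjoint hPO]; omega) ?_
  intro q hq q' hq' hne
  rw [SimpleGraph.compl_adj]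
  refine ⟨hne, ?_⟩
  rw [Finset.mem_union] at hq hq'
  rcases hq with hq | hq <;> rcases hq' with hq' | hq'
  · intro hadj
    apply hno
    have := hv.one (p := 2) (q := 0 + 2 * g) (by omega) (by omega) (Pth.two hadj) (by
      intro j; simp only [Finset.mem_insert, Finset.mem_singleton, not_or]
      exact ⟨hvm q hq j, hvm q' hq' j⟩) (by rw [hv.per]; exact (hy0 q hq).symm)
      ((hE q' hq' 2).2 (by decide))
    rw [Finset.card_pair hne] at this
    convert this using 1; omega
  · exact hPOadj q hq q' hq'
  · exact fun h => hPOadj q' hq' q hq h.symm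
  · simp only [hO, Finset.mem_image, Finset.mem_range] at hq hq'
    obtain ⟨i, hi, rfl⟩ := hq
    obtain ⟨j, hj, rfl⟩ := hq'
    rcases lt_trichotomy i j with h | h | h
    · exact hOO i j h hj
    · subst h; exact absurd rfl hne
    · exact fun h' => hOO j i h hi h'.symm

theorem base {V : Type*} [DecidableEq V] [Fintype V] (h : ℕ) (hh : 2 ≤ h)
    (hN : 4 * h - 1 ≤ Fintype.card V) (B : SimpleGraph V) :
    HasCyc B (2 * h) ∨ HasCyc Bᶜ (2 * h) := by
  induction h, hh using Nat.le_induction with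
  | base => exact base_two B (by omega)
  | succ g hg ih =>
    rcases ih (by omega) with h1 | h1
    · by_cases h2 : HasCyc B (2 * g + 2)
      · left; exact h2
      · right; exact base_step B g hg (by omega) h1 h2
    · by_cases h2 : HasCyc Bᶜ (2 * g + 2)
      · right; exact h2
      · left
        have := base_step Bᶜ g hg (by omega) h1 h2
        rwa [compl_compl] at this

/-- Paths of all lengths inside a clique together with some vertices completely joined to it. -/
theorem mid_path {V : Type*} [DecidableEq V] {R : SimpleGraph V} (O J : Finset V)
    (hOJ : Disjoint O J) (hO : ∀ q ∈ O, ∀ q' ∈ O, q ≠ q' → R.Adj q q')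
    (hadj : ∀ q ∈ O, ∀ j ∈ J, R.Adj q j) (hc : J.card + 1 ≤ O.card) (b1 b2 : V) (h1 : b1 ∈ O)
    (h2 : b2 ∈ O) (t : ℕ) (ht : (b1 ≠ b2 ∧ 2 ≤ t) ∨ (b1 = b2 ∧ t = 1))
    (htc : t ≤ O.card + J.card) : ∃ T ⊆ O ∪ J, T.card = t ∧ Pth R b1 b2 T := by
  rcases ht with ⟨hne, ht⟩ | ⟨rfl, rfl⟩
  swap
  · exact ⟨{b1}, by simp [h1], by simp, Pth.single b1⟩
  have hsub : ({b1, b2} : Finset V) ⊆ O := by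
    intro x hx; simp only [Finset.mem_insert, Finset.mem_singleton] at hx
    rcases hx with rfl | rfl <;> assumption
  have hc2 : ({b1, b2} : Finset V).card = 2 := Finset.card_pair hne
  have hO2 := Finset.card_le_card hsub
  obtain ⟨Q, hQ1, hQ2, hQc⟩ := Finset.exists_subsuperset_card_eq hsub (n := min t O.card)
    (by omega) (by omega)
  obtain ⟨J', hJ', hJc⟩ := Finset.exists_subset_card_eq (s := J) (n := t - min t O.card) (by omega)
  have hd : Disjoint Q J' := Finset.disjoint_of_subset_left hQ2
    (Finset.disjoint_of_subset_right hJ' hOJ)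
  refine ⟨Q ∪ J', Finset.union_subset_union hQ2 hJ', ?_, ?_⟩
  · rw [Finset.card_union_of_disjoint hd]; omega
  · exact zig _ Q J' rfl hd (fun q hq j hj => hadj q (hQ2 hq) j (hJ' hj))
      (Or.inl fun q hq q' hq' => hO q (hQ2 hq) q' (hQ2 hq')) (by omega) _ (hQ1 (by simp)) _
      (hQ1 (by simp)) (Or.inl hne)

theorem a_path {V : Type*} [DecidableEq V] {R : SimpleGraph V} (O J : Finset V)
    (hOJ : Disjoint O J) (hO : ∀ q ∈ O, ∀ q' ∈ O, q ≠ q' → R.Adj q q')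
    (hadj : ∀ q ∈ O, ∀ j ∈ J, R.Adj q j) (hc : J.card + 1 ≤ O.card) (hO2 : 2 ≤ O.card)
    (a1 a2 : V) (h1 : a1 ∈ O ∪ J)
    (h2 : a2 ∈ O ∪ J) (hne : a1 ≠ a2) (t : ℕ) (ht : 3 ≤ t)
    (htc : t ≤ O.card + J.card) : ∃ T ⊆ O ∪ J, T.card = t ∧ Pth R a1 a2 T := by
  have hOJ' : ∀ a ∈ O, a ∉ J := fun a ha hb => Finset.disjoint_left.1 hOJ ha hb
  have mixed : ∀ a1 a2, a1 ∈ O → a2 ∈ J → ∃ T ⊆ O ∪ J, T.card = t ∧ Pth R a1 a2 T := by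
    intro a1 a2 h1 h2
    obtain ⟨b, hb, hba⟩ := Finset.exists_mem_ne (show 1 < O.card by omega) a1
    have hce := Finset.card_erase_of_mem h2
    have hJpos : 0 < J.card := Finset.card_pos.2 ⟨a2, h2⟩
    obtain ⟨T, hT, hTc, hp⟩ := mid_path (R := R) O (J.erase a2)
      (Finset.disjoint_of_subset_right (Finset.erase_subset _ _) hOJ) hO
      (fun q hq j hj => hadj q hq j (Finset.mem_of_mem_erase hj)) (by omega) a1 b h1 hb (t - 1)
      (Or.inl ⟨hba.symm, by omega⟩) (by omega)
    have hn : a2 ∉ T := by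
      intro h
      have := hT h
      rw [Finset.mem_union] at this
      rcases this with h | h
      · exact hOJ' _ h h2
      · simp at h
    have hd : Disjoint T {a2} := by simpa using hn
    refine ⟨T ∪ {a2}, ?_, ?_, hp.append (hadj b hb a2 h2) (Pth.single a2) hd⟩
    · apply Finset.union_subset
      · exact hT.trans (Finset.union_subset_union_right (Finset.erase_subset _ _))
      · simp [h2]
    · rw [Finset.card_union_of_disjoint hd, Finset.card_singleton]; omega
  rw [Finset.mem_union] at h1 h2
  rcases h1 with h1 | h1 <;> rcases h2 with h2 | h2
  · exact mid_path O J hOJ hO hadj hc a1 a2 h1 h2 t (Or.inl ⟨hne, by omega⟩) htc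
  · exact mixed a1 a2 h1 h2
  · obtain ⟨T, hT, hTc, hp⟩ := mixed a2 a1 h2 h1
    exact ⟨T, hT, hTc, hp.symm⟩
  · obtain ⟨b1, hb1, b2, hb2, hbne⟩ := Finset.one_lt_card.1 (show 1 < O.card by omega)
    have hce := Finset.card_erase_of_mem h2
    have h1' : a1 ∈ J.erase a2 := Finset.mem_erase.2 ⟨hne, h1⟩
    have hce' := Finset.card_erase_of_mem h1'
    have hJpos : 0 < (J.erase a2).card := Finset.card_pos.2 ⟨a1, h1'⟩
    obtain ⟨b, hb, hbt⟩ : ∃ b ∈ O, (b1 ≠ b ∧ 2 ≤ t - 2) ∨ (b1 = b ∧ t - 2 = 1) := by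
      by_cases h3 : t = 3
      · exact ⟨b1, hb1, Or.inr ⟨rfl, by omega⟩⟩
      · exact ⟨b2, hb2, Or.inl ⟨hbne, by omega⟩⟩
    obtain ⟨T, hT, hTc, hp⟩ := mid_path (R := R) O ((J.erase a2).erase a1)
      (Finset.disjoint_of_subset_right ((Finset.erase_subset _ _).trans (Finset.erase_subset _ _))
        hOJ) hO
      (fun q hq j hj => hadj q hq j (Finset.mem_of_mem_erase (Finset.mem_of_mem_erase hj)))
      (by omega) b1 b hb1 hb (t - 2) hbt (by omega)
    have hn2 : a2 ∉ T := by
      intro h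
      have := hT h
      rw [Finset.mem_union] at this
      rcases this with h | h
      · exact hOJ' _ h h2
      · simp at h
    have hn1 : a1 ∉ T := by
      intro h
      have := hT h
      rw [Finset.mem_union] at this
      rcases this with h | h
      · exact hOJ' _ h h1
      · simp at h
    have hd : Disjoint T {a2} := by simpa using hn2
    have hn3 : a1 ∉ T ∪ {a2} := by simp [hn1, hne]
    refine ⟨insert a1 (T ∪ {a2}), ?_, ?_,
      Pth.cons (hadj b1 hb1 a1 h1).symm hn3
        (hp.append (hadj b hb a2 h2) (Pth.single a2) hd)⟩
    · rw [Finset.insert_subset_iff]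
      refine ⟨by simp [h1], Finset.union_subset ?_ (by simp [h2])⟩
      exact hT.trans (Finset.union_subset_union_right
        ((Finset.erase_subset _ _).trans (Finset.erase_subset _ _)))
    · rw [Finset.card_insert_of_notMem hn3, Finset.card_union_of_disjoint hd,
        Finset.card_singleton]; omega

theorem d_path {V : Type*} [DecidableEq V] {R : SimpleGraph V} (E X : Finset V)
    (hEX : Disjoint E X)
    (hadj : ∀ q ∈ E, ∀ j ∈ X, R.Adj q j) (hX2 : 2 ≤ X.card) (hc : X.card ≤ E.card)
    (d1 d2 : V) (h1 : d1 ∈ E ∪ X)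
    (h2 : d2 ∈ E ∪ X) (hne : d1 ≠ d2) :
    ∃ T ⊆ E ∪ X, (T.card = 2 * X.card - 2 ∨ T.card = 2 * X.card - 1) ∧ Pth R d1 d2 T := by
  have mixed : ∀ d1 d2, d1 ∈ E → d2 ∈ X → ∃ T ⊆ E ∪ X,
      (T.card = 2 * X.card - 2 ∨ T.card = 2 * X.card - 1) ∧ Pth R d1 d2 T := by
    intro d1 d2 h1 h2
    have hce := Finset.card_erase_of_mem h2
    obtain ⟨Q, hQ1, hQ2, hQc⟩ := Finset.exists_subsuperset_card_eq
      (show {d1} ⊆ E by simpa using h1) (n := X.card - 1)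
      (by simp; omega) (by omega)
    obtain ⟨J, hJ, hJc⟩ := Finset.exists_subset_card_eq (s := X.erase d2) (n := X.card - 2)
      (by omega)
    have hd1Q : d1 ∈ Q := hQ1 (by simp)
    have hJX : J ⊆ X := hJ.trans (Finset.erase_subset _ _)
    obtain ⟨b, hb, hbt⟩ : ∃ b ∈ Q, (d1 ≠ b ∨ Q.card = 1) := by
      by_cases h3 : Q.card = 1
      · exact ⟨d1, hd1Q, Or.inr h3⟩
      · obtain ⟨b, hb, hbd⟩ := Finset.exists_mem_ne (show 1 < Q.card by omega) d1
        exact ⟨b, hb, Or.inl hbd.symm⟩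
    have hd : Disjoint Q J := Finset.disjoint_of_subset_left hQ2
      (Finset.disjoint_of_subset_right hJX hEX)
    have hp := zig (G := R) _ Q J rfl hd (fun q hq j hj => hadj q (hQ2 hq) j (hJX hj))
      (Or.inr (by omega)) (by omega) d1 hd1Q b hb hbt
    have hn : Disjoint (Q ∪ J) {d2} := by
      simp only [Finset.disjoint_singleton_right, Finset.mem_union, not_or]
      refine ⟨fun h => Finset.disjoint_left.1 hEX (hQ2 h) h2, fun h => ?_⟩
      have := hJ h
      simp at this
    refine ⟨Q ∪ J ∪ {d2}, ?_, ?_, hp.append (hadj b (hQ2 hb) d2 h2) (Pth.single d2) hn⟩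
    · exact Finset.union_subset (Finset.union_subset_union hQ2 hJX) (by simp [h2])
    · left
      rw [Finset.card_union_of_disjoint hn, Finset.card_union_of_disjoint hd,
        Finset.card_singleton]; omega
  rw [Finset.mem_union] at h1 h2
  have hc2 : ({d1, d2} : Finset V).card = 2 := Finset.card_pair hne
  rcases h1 with h1 | h1 <;> rcases h2 with h2 | h2
  · have hsub : ({d1, d2} : Finset V) ⊆ E := by
      intro x hx; simp only [Finset.mem_insert, Finset.mem_singleton] at hx
      rcases hx with rfl | rfl <;> assumption
    obtain ⟨Q, hQ1, hQ2, hQc⟩ := Finset.exists_subsuperset_card_eq hsub (n := X.card)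
      (by omega) (by omega)
    obtain ⟨J, hJ, hJc⟩ := Finset.exists_subset_card_eq (s := X) (n := X.card - 1) (by omega)
    have hd : Disjoint Q J := Finset.disjoint_of_subset_left hQ2
      (Finset.disjoint_of_subset_right hJ hEX)
    refine ⟨Q ∪ J, Finset.union_subset_union hQ2 hJ, Or.inr ?_, ?_⟩
    · rw [Finset.card_union_of_disjoint hd]; omega
    · exact zig _ Q J rfl hd (fun q hq j hj => hadj q (hQ2 hq) j (hJ hj))
        (Or.inr (by omega)) (by omega) _ (hQ1 (by simp)) _
        (hQ1 (by simp)) (Or.inl hne)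
  · exact mixed d1 d2 h1 h2
  · obtain ⟨T, hT, hTc, hp⟩ := mixed d2 d1 h2 h1
    exact ⟨T, hT, hTc, hp.symm⟩
  · obtain ⟨J, hJ, hJc⟩ := Finset.exists_subset_card_eq (s := E) (n := X.card - 1) (by omega)
    have hd : Disjoint X J := Finset.disjoint_of_subset_right hJ hEX.symm
    refine ⟨X ∪ J, ?_, Or.inr ?_, ?_⟩
    · rw [Finset.union_comm]; exact Finset.union_subset_union_left hJ
    · rw [Finset.card_union_of_disjoint hd]; omega
    · exact zig _ X J rfl hd (fun q hq j hj => (hadj j (hJ hj) q hq).symm)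
        (Or.inr (by omega)) (by omega) _ h1 _ h2 (Or.inl hne)

theorem khh {V : Type*} [DecidableEq V] {R : SimpleGraph V} (Q J : Finset V)
    (hd : Disjoint Q J) (hadj : ∀ q ∈ Q, ∀ j ∈ J, R.Adj q j) (h : ℕ) (hh : 2 ≤ h)
    (hQ : h ≤ Q.card) (hJ : h ≤ J.card) : HasCyc R (2 * h) := by
  obtain ⟨A, hA, hAc⟩ := Finset.exists_subset_card_eq hQ
  obtain ⟨C, hC, hCc⟩ := Finset.exists_subset_card_eq hJ
  rw [← hAc]
  apply jackson' R A C _ h (by omega) (by omega) (by omega)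
  · intro a ha
    have : nbF R C a = C := by
      ext u; rw [mem_nbF]
      exact ⟨fun h => h.1, fun h => ⟨h, hadj a (hA ha) u (hC h)⟩⟩
    rw [this, hCc]
  · exact Finset.disjoint_of_subset_left hA (Finset.disjoint_of_subset_right hC hd)

theorem even_core {V : Type*} [DecidableEq V] (B : SimpleGraph V) (O XO E XE : Finset V)
    (e h : ℕ) (hh : 2 ≤ h) (hhe : h ≤ e) (hOc : O.card = e) (hEc : E.card = e)
    (hOX : Disjoint O XO) (hEX : Disjoint E XE) (hAD : Disjoint (O ∪ XO) (E ∪ XE))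
    (hO : ∀ q ∈ O, ∀ q' ∈ O, q ≠ q' → Bᶜ.Adj q q')
    (hOXa : ∀ q ∈ O, ∀ j ∈ XO, Bᶜ.Adj q j)
    (hEXa : ∀ q ∈ E, ∀ j ∈ XE, Bᶜ.Adj q j)
    (hXO : 1 ≤ XO.card)
    (hN1 : h ≤ XO.card + XE.card) (hN2 : 4 * h - 1 ≤ 2 * e + XO.card + XE.card)
    (hred : ¬ HasCyc Bᶜ (2 * h)) (hblue : ¬ HasCyc B (2 * e + 1)) : False := by
  have hXO1 : XO.card < h := by
    by_contra hc
    exact hred (khh O XO hOX hOXa h hh (by omega) (by omega))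
  have hXE1 : XE.card < h := by
    by_contra hc
    exact hred (khh E XE hEX hEXa h hh (by omega) (by omega))
  have hA1 : e + XO.card < 2 * h := by
    by_contra hc
    obtain ⟨b1, hb1, b2, hb2, hbne⟩ := Finset.one_lt_card.1 (show 1 < O.card by omega)
    obtain ⟨T, _, hTc, hp⟩ := mid_path O XO hOX hO hOXa (by omega) b1 b2 hb1 hb2 (2 * h)
      (Or.inl ⟨hbne, by omega⟩) (by omega)
    exact hred ⟨T, b1, b2, hp, hO b2 hb2 b1 hb1 hbne.symm, hTc⟩
  have hAc : (O ∪ XO).card = e + XO.card := by rw [Finset.card_union_of_disjoint hOX, hOc]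
  have hDc : (E ∪ XE).card = e + XE.card := by rw [Finset.card_union_of_disjoint hEX, hEc]
  have hdis : ∀ a1 ∈ O ∪ XO, ∀ a2 ∈ O ∪ XO, ∀ d1 ∈ E ∪ XE, ∀ d2 ∈ E ∪ XE, a1 ≠ a2 → d1 ≠ d2 →
      Bᶜ.Adj a1 d1 → Bᶜ.Adj a2 d2 → False := by
    intro a1 ha1 a2 ha2 d1 hd1 d2 hd2 hane hdne e1 e2
    obtain ⟨T, hT, hTc, hp⟩ := d_path (R := Bᶜ) E XE hEX hEXa (by omega) (by omega) d2 d1 hd2 hd1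
      hdne.symm
    obtain ⟨S, hS, hSc, hq⟩ := a_path (R := Bᶜ) O XO hOX hO hOXa (by omega) (by omega) a1 a2
      ha1 ha2 hane (2 * h - T.card) (by omega) (by omega)
    have hST : Disjoint S T := Finset.disjoint_of_subset_left hS
      (Finset.disjoint_of_subset_right hT hAD)
    refine hred ⟨S ∪ T, _, _, hq.append e2 hp hST, e1.symm, ?_⟩
    rw [Finset.card_union_of_disjoint hST]
    omega
  obtain ⟨c, hc⟩ : ∃ c, ∀ a ∈ O ∪ XO, ∀ d ∈ E ∪ XE, a ≠ c → d ≠ c → ¬ Bᶜ.Adj a d := by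
    obtain ⟨x, hx⟩ := Finset.card_pos.1 (show 0 < XO.card by omega)
    by_contra hcon
    push Not at hcon
    obtain ⟨a, ha, d, hd, -, -, e1⟩ := hcon x
    obtain ⟨a1, ha1, d1, hd1, n1, -, e2⟩ := hcon a
    obtain ⟨a2, ha2, d2, hd2, -, n2, e3⟩ := hcon d
    have k1 : d1 = d := by
      by_contra hne
      exact hdis a1 ha1 a ha d1 hd1 d hd n1 hne e2 e1
    have k2 : a2 = a := by
      by_contra hne
      exact hdis a2 ha2 a ha d2 hd2 d hd hne n2 e3 e1
    subst k1 k2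
    exact hdis _ ha1 _ ha2 _ hd1 _ hd2 n1 n2.symm e2 e3
  have hblueAD : ∀ d ∈ (E ∪ XE).erase c, ∀ a ∈ (O ∪ XO).erase c, B.Adj d a := by
    intro d hd a ha
    rw [Finset.mem_erase] at hd ha
    have h1 := hc a ha.2 d hd.2 ha.1 hd.1
    rw [SimpleGraph.compl_adj] at h1
    have h2 : a ≠ d := by rintro rfl; exact Finset.disjoint_left.1 hAD ha.2 hd.2
    by_contra h3
    exact h1 ⟨h2, fun h => h3 h.symm⟩
  have hAe := Finset.pred_card_le_card_erase (s := O ∪ XO) (a := c)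
  have hDe := Finset.pred_card_le_card_erase (s := E ∪ XE) (a := c)
  have hDcl : ∀ q ∈ (E ∪ XE).erase c, ∀ q' ∈ (E ∪ XE).erase c, q ≠ q' → Bᶜ.Adj q q' := by
    intro d1 hd1 d2 hd2 hne
    by_contra hcon
    have hadj : B.Adj d1 d2 := by
      rw [SimpleGraph.compl_adj] at hcon; tauto
    have hsub : ({d1, d2} : Finset V) ⊆ (E ∪ XE).erase c := by
      intro x hx; simp only [Finset.mem_insert, Finset.mem_singleton] at hx
      rcases hx with rfl | rfl <;> assumption
    have hc2 : ({d1, d2} : Finset V).card = 2 := Finset.card_pair hne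
    obtain ⟨Q, hQ1, hQ2, hQc⟩ := Finset.exists_subsuperset_card_eq hsub (n := e + 1)
      (by omega) (by omega)
    obtain ⟨J, hJ, hJc⟩ := Finset.exists_subset_card_eq (s := (O ∪ XO).erase c) (n := e)
      (by omega)
    have hd : Disjoint Q J := Finset.disjoint_of_subset_left
      (hQ2.trans (Finset.erase_subset _ _))
      (Finset.disjoint_of_subset_right (hJ.trans (Finset.erase_subset _ _)) hAD.symm)
    have hp := zig (G := B) _ Q J rfl hd (fun q hq j hj => hblueAD q (hQ2 hq) j (hJ hj))
      (Or.inr (by omega)) (by omega) d1 (hQ1 (by simp)) d2 (hQ1 (by simp)) (Or.inl hne)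
    refine hblue ⟨_, _, _, hp, hadj.symm, ?_⟩
    rw [Finset.card_union_of_disjoint hd]; omega
  by_cases hcD : c ∈ E ∪ XE
  swap
  · rw [Finset.erase_eq_of_notMem hcD] at hDcl
    exact hred (clique_cyc (E ∪ XE) _ (by omega) (by omega) hDcl)
  obtain ⟨u, hu, w, hw, huw, hcu, hcw⟩ : ∃ u ∈ (E ∪ XE).erase c, ∃ w ∈ (E ∪ XE).erase c,
      u ≠ w ∧ Bᶜ.Adj c u ∧ Bᶜ.Adj c w := by
    have aux : ∀ S ⊆ E ∪ XE, 2 ≤ S.card → (∀ s ∈ S, Bᶜ.Adj c s) →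
      ∃ u ∈ (E ∪ XE).erase c, ∃ w ∈ (E ∪ XE).erase c,
      u ≠ w ∧ Bᶜ.Adj c u ∧ Bᶜ.Adj c w := by
      intro S hS hSc hSa
      obtain ⟨u, hu, w, hw, huw⟩ := Finset.one_lt_card.1 (show 1 < S.card by omega)
      exact ⟨u, Finset.mem_erase.2 ⟨(hSa u hu).ne.symm, hS hu⟩, w,
        Finset.mem_erase.2 ⟨(hSa w hw).ne.symm, hS hw⟩, huw, hSa u hu, hSa w hw⟩
    rw [Finset.mem_union] at hcD
    rcases hcD with hcE | hcX
    · exact aux XE Finset.subset_union_right (by omega) (hEXa c hcE)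
    · exact aux E Finset.subset_union_left (by omega) (fun s hs => (hEXa s hs c hcX).symm)
  have hsub : ({u, w} : Finset V) ⊆ (E ∪ XE).erase c := by
    intro x hx; simp only [Finset.mem_insert, Finset.mem_singleton] at hx
    rcases hx with rfl | rfl <;> assumption
  have hc2 : ({u, w} : Finset V).card = 2 := Finset.card_pair huw
  obtain ⟨Q, hQ1, hQ2, hQc⟩ := Finset.exists_subsuperset_card_eq hsub (n := 2 * h - 1)
    (by omega) (by omega)
  have hp := zig (G := Bᶜ) _ Q ∅ rfl (by simp) (by simp)
    (Or.inl fun q hq q' hq' => hDcl q (hQ2 hq) q' (hQ2 hq')) (by rw [Finset.card_empty]; omega)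
    u (hQ1 (by simp)) w (hQ1 (by simp)) (Or.inl huw)
  rw [Finset.union_empty] at hp
  have hcQ : c ∉ Q := fun h => by
    have := hQ2 h
    simp at this
  refine hred ⟨_, _, _, Pth.cons hcu hcQ hp, hcw.symm, ?_⟩
  rw [Finset.card_insert_of_notMem hcQ]; omega

theorem even_step {V : Type*} [DecidableEq V] [Fintype V] (B : SimpleGraph V) (e h : ℕ)
    (hh : 2 ≤ h) (hhe : h ≤ e) (hN : 2 * e + h ≤ Fintype.card V)
    (hN2 : 4 * h - 1 ≤ Fintype.card V)
    (hB : HasCyc B (2 * e)) (hno : ¬ HasCyc B (2 * e + 1)) : HasCyc Bᶜ (2 * h) := by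
  classical
  by_contra hred
  obtain ⟨v0, hv0⟩ := hB.isCyc
  have hXm : ∀ x, x ∈ (cycV (2 * e) v0)ᶜ → ∀ i, v0 i ≠ x := by
    rintro x hx i rfl
    exact Finset.mem_compl.1 hx (hv0.mem_cycV (by omega) i)
  have hXc : (cycV (2 * e) v0)ᶜ.card = Fintype.card V - 2 * e := by
    rw [Finset.card_compl, hv0.card_cycV]
  obtain ⟨x, hxX, hxp⟩ : ∃ x ∈ (cycV (2 * e) v0)ᶜ, (nbI B (2 * e) v0 x).card = e := by
    by_contra hcon
    push Not at hcon
    obtain ⟨A, hA, hAc⟩ := Finset.exists_subset_card_eq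
      (show h ≤ (cycV (2 * e) v0)ᶜ.card by omega)
    apply hred
    rw [← hAc]
    apply jackson' Bᶜ A (cycV (2 * e) v0) _ (e + 1) (by omega) (by omega)
      (by rw [hv0.card_cycV]; omega)
    · intro a ha
      have h1 := hv0.red_card' (hXm a (hA ha))
      have h2 := hv0.gaps (by omega) hno (hXm a (hA ha))
      have h3 := hcon a (hA ha)
      omega
    · rw [Finset.disjoint_left]
      intro a ha
      exact Finset.mem_compl.1 (hA ha)
  obtain ⟨v, hv, hcV, hvp, hx0⟩ : ∃ v, IsCyc B (2 * e) v ∧ cycV (2 * e) v = cycV (2 * e) v0 ∧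
      (nbI B (2 * e) v x).card = e ∧ B.Adj x (v 0) := by
    by_cases h0 : B.Adj x (v0 0)
    · exact ⟨v0, hv0, rfl, hxp, h0⟩
    · refine ⟨_, hv0.shift 1, hv0.cycV_shift (by omega) 1, ?_, ?_⟩
      · rw [hv0.nbI_shift (by omega) 1 (hXm x hxX)]; exact hxp
      · exact (hv0.even_perf (by omega) hno (hXm x hxX) hxp 0).2 h0
  rw [← hcV] at hXc hxX
  clear hXm hcV hxp
  have hXm : ∀ x, x ∈ (cycV (2 * e) v)ᶜ → ∀ i, v i ≠ x := by
    rintro x hx i rfl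
    exact Finset.mem_compl.1 hx (hv.mem_cycV (by omega) i)
  have hxE := alt_iff (p := fun i => B.Adj x (v i))
    (hv.even_perf (by omega) hno (hXm x hxX) hvp) hx0
  set X := (cycV (2 * e) v)ᶜ with hX
  set O := (Finset.range e).image (fun i => v (2 * i + 1)) with hO
  set E := (Finset.range e).image (fun i => v (2 * i)) with hE
  set XE := X.filter (fun z => ∃ i, B.Adj z (v (2 * i + 1))) with hXE
  set XO := X.filter (fun z => ¬ ∃ i, B.Adj z (v (2 * i + 1))) with hXO
  have hXX : XE.card + XO.card = X.card := Finset.card_filter_add_card_filter_not _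
  have hOc : O.card = e := by
    rw [hO, Finset.card_image_of_injOn, Finset.card_range]
    intro i hi j hj e
    simp only [Finset.coe_range, Set.mem_Iio] at hi hj
    have := hv.injOn _ _ (by omega) (by omega) e
    omega
  have hEc : E.card = e := by
    rw [hE, Finset.card_image_of_injOn, Finset.card_range]
    intro i hi j hj e
    simp only [Finset.coe_range, Set.mem_Iio] at hi hj
    have := hv.injOn _ _ (by omega) (by omega) e
    omega
  have memO : ∀ o ∈ O, ∃ i, i < e ∧ o = v (2 * i + 1) := by
    intro o ho
    simp only [hO, Finset.mem_image, Finset.mem_range] at ho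
    obtain ⟨i, hi, rfl⟩ := ho
    exact ⟨i, hi, rfl⟩
  have memE : ∀ o ∈ E, ∃ i, i < e ∧ o = v (2 * i) := by
    intro o ho
    simp only [hE, Finset.mem_image, Finset.mem_range] at ho
    obtain ⟨i, hi, rfl⟩ := ho
    exact ⟨i, hi, rfl⟩
  have hXEX : ∀ z ∈ XE, z ∈ X := fun z hz => (Finset.mem_filter.1 hz).1
  have hXOX : ∀ z ∈ XO, z ∈ X := fun z hz => (Finset.mem_filter.1 hz).1
  have hOO : ∀ i j, i < j → j < e → ¬ B.Adj (v (2 * i + 1)) (v (2 * j + 1)) := by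
    intro i j hij hj
    exact hv.F2 hno (hXm x hxX) (2 * i) (2 * j) (by omega) (by omega)
      ((hxE _).2 (by simp)) ((hxE _).2 (by simp))
  refine even_core B O XO E XE e h hh hhe hOc hEc ?_ ?_ ?_ ?_ ?_ ?_ ?_ (by omega) (by omega)
    hred hno
  · rw [Finset.disjoint_left]
    intro o ho ho'
    obtain ⟨i, _, rfl⟩ := memO o ho
    exact hXm _ (hXOX _ ho') _ rfl
  · rw [Finset.disjoint_left]
    intro o ho ho'
    obtain ⟨i, _, rfl⟩ := memE o ho
    exact hXm _ (hXEX _ ho') _ rfl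
  · rw [Finset.disjoint_left]
    intro o ho ho'
    rw [Finset.mem_union] at ho ho'
    rcases ho with ho | ho <;> rcases ho' with ho' | ho'
    · obtain ⟨i, hi, rfl⟩ := memO o ho
      obtain ⟨j, hj, e'⟩ := memE _ ho'
      have := hv.injOn _ _ (by omega) (by omega) e'
      omega
    · obtain ⟨i, _, rfl⟩ := memO o ho
      exact hXm _ (hXEX _ ho') _ rfl
    · obtain ⟨i, _, rfl⟩ := memE o ho'
      exact hXm _ (hXOX _ ho) _ rfl
    · exact (Finset.mem_filter.1 ho).2 (Finset.mem_filter.1 ho').2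
  · intro q hq q' hq' hne
    rw [SimpleGraph.compl_adj]
    refine ⟨hne, ?_⟩
    obtain ⟨i, hi, rfl⟩ := memO q hq
    obtain ⟨j, hj, rfl⟩ := memO q' hq'
    rcases lt_trichotomy i j with h | h | h
    · exact hOO i j h hj
    · subst h; exact absurd rfl hne
    · exact fun h' => hOO j i h hi h'.symm
  · intro q hq z hz
    obtain ⟨i, hi, rfl⟩ := memO q hq
    rw [SimpleGraph.compl_adj]
    refine ⟨hXm z (hXOX z hz) _, fun h => ?_⟩
    exact (Finset.mem_filter.1 hz).2 ⟨i, h.symm⟩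
  · intro q hq z hz
    obtain ⟨i, hi, rfl⟩ := memE q hq
    rw [SimpleGraph.compl_adj]
    refine ⟨hXm z (hXEX z hz) _, fun h => ?_⟩
    obtain ⟨j, hj⟩ := (Finset.mem_filter.1 hz).2
    have hne : x ≠ z := by
      rintro rfl
      rw [hxE] at hj
      exact absurd hj (by simp)
    refine hv.R1 (by omega) hno hne (hXm x hxX) (hXm z (hXEX z hz)) (2 * i + 2 * e - 2) (2 * j)
      ((hxE _).2 ?_) ?_ ((hxE _).2 (by simp)) hj
    · rw [show 2 * i + 2 * e - 2 = 2 * (i + e - 1) by omega]; simp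
    · rw [show 2 * i + 2 * e - 2 + 2 = 2 * i + 2 * e by omega, hv.per]; exact h.symm
  · apply Finset.card_pos.2
    refine ⟨x, Finset.mem_filter.2 ⟨hxX, ?_⟩⟩
    rintro ⟨i, hi⟩
    rw [hxE] at hi
    exact absurd hi (by simp)

theorem main_graph {V : Type*} [DecidableEq V] [Fintype V] (B : SimpleGraph V) (h k : ℕ)
    (hh : 2 ≤ h) (hk : h ≤ k) (hN : 2 * k + h ≤ Fintype.card V)
    (hN2 : 4 * h - 1 ≤ Fintype.card V) : HasCyc Bᶜ (2 * h) ∨ HasCyc B (2 * k + 1) := by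
  by_contra hcon
  push Not at hcon
  obtain ⟨hred, hblue⟩ := hcon
  have hev : ∀ e, 2 * e + h ≤ Fintype.card V → h ≤ e → HasCyc B (2 * e + 1) ∨ ¬ HasCyc B (2 * e) := by
    intro e he hhe
    by_contra hc
    push Not at hc
    exact hred (even_step B e h hh hhe he hN2 hc.2 hc.1)
  have key : ∀ e, h ≤ e → 2 * e + h ≤ Fintype.card V → HasCyc B (2 * e) := by
    intro e he
    induction e, he using Nat.le_induction with
    | base =>
      intro _
      rcases base h hh hN2 B with h1 | h1
      · exact h1
      · exact absurd h1 hred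
    | succ e he ih =>
      intro hc
      have h1 := ih (by omega)
      rcases hev e (by omega) he with h2 | h2
      · by_contra h3
        exact hred (odd_step B e h (by omega) hh (by omega) (by omega) h2 h3)
      · exact absurd h1 h2
  rcases hev k hN hk with h2 | h2
  · exact hblue h2
  · exact h2 (key k hk hN)

theorem cyc_adj_iff {n : ℕ} (hn : 3 ≤ n) (u v : Fin n) : (cycleGraph n).Adj u v ↔
    (u.val + 1 = v.val ∨ v.val + 1 = u.val ∨ (u.val = 0 ∧ v.val + 1 = n) ∨
      (v.val = 0 ∧ u.val + 1 = n)) := by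
  have key : ∀ a b : Fin n, (a - b).val = 1 ↔
      (b.val + 1 = a.val ∨ (a.val = 0 ∧ b.val + 1 = n)) := by
    intro a b
    have ha := a.2
    have hb := b.2
    rw [Fin.val_sub]
    by_cases h : b.val ≤ a.val
    · rw [show n - b.val + a.val = (a.val - b.val) + n by omega, Nat.add_mod_right,
        Nat.mod_eq_of_lt (by omega)]
      omega
    · rw [Nat.mod_eq_of_lt (by omega)]
      omega
  rw [cycleGraph_adj', key, key]
  omega

theorem HasCyc.emb {V : Type*} [DecidableEq V] {G : SimpleGraph V} {n : ℕ} (hn : 3 ≤ n)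
    (h : HasCyc G n) : ∃ f : Fin n ↪ V, ∀ u v, (cycleGraph n).Adj u v → G.Adj (f u) (f v) := by
  obtain ⟨v, hv⟩ := h.isCyc
  refine ⟨⟨fun i => v i.val, ?_⟩, ?_⟩
  · intro i j e
    exact Fin.ext (hv.injOn _ _ i.2 j.2 e)
  · intro i j hij
    rw [cyc_adj_iff hn] at hij
    show G.Adj (v i.val) (v j.val)
    have hper := hv.per 0
    rw [Nat.zero_add] at hper
    rcases hij with e | e | ⟨e1, e2⟩ | ⟨e1, e2⟩
    · rw [← e]; exact hv.adj _
    · rw [← e]; exact (hv.adj _).symm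
    · have := hv.adj j.val
      rw [e2, hper, ← e1] at this
      exact this.symm
    · have := hv.adj i.val
      rw [e2, hper, ← e1] at this
      exact this

theorem ramsey_upper (m n : ℕ) (hm : 4 ≤ m) (hmn : m < n)
    (hme : Even m) (hno : Odd n) :
    RamseyProp (cycleGraph m) (cycleGraph n) (max (n - 1 + m / 2) (2 * m - 1)) := by
  obtain ⟨h, rfl⟩ := hme
  obtain ⟨k, rfl⟩ := hno
  intro c
  let B : SimpleGraph (Fin (max (2 * k + 1 - 1 + (h + h) / 2) (2 * (h + h) - 1))) :=
    { Adj := fun u v => u ≠ v ∧ c s(u, v) = 1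
      symm := ⟨fun u v h => ⟨h.1.symm, by rw [Sym2.eq_swap]; exact h.2⟩⟩
      loopless := ⟨fun u h => h.1 rfl⟩ }
  have hB : ∀ u v, B.Adj u v ↔ u ≠ v ∧ c s(u, v) = 1 := fun _ _ => Iff.rfl
  rcases main_graph B h k (by omega) (by omega) (by rw [Fintype.card_fin]; omega)
    (by rw [Fintype.card_fin]; omega) with h1 | h1
  · left
    rw [show 2 * h = h + h by omega] at h1
    obtain ⟨f, hf⟩ := h1.emb (by omega)
    refine ⟨f, fun u v huv => ?_⟩
    have h2 := hf u v huv
    rw [SimpleGraph.compl_adj, hB] at h2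
    have h3 : c s(f u, f v) ≠ 1 := fun h => h2.2 ⟨h2.1, h⟩
    generalize c s(f u, f v) = t at h3 ⊢
    revert h3; revert t; decide
  · right
    obtain ⟨f, hf⟩ := h1.emb (by omega)
    exact ⟨f, fun u v huv => ((hB _ _).1 (hf u v huv)).2⟩

theorem emb_fn {m N : ℕ} (hm : 3 ≤ m) (f : Fin m ↪ Fin N) (col : ℕ → ℕ → Prop)
    (h : ∀ u v, (cycleGraph m).Adj u v → col (f u).val (f v).val) :
    ∃ F : ℕ → ℕ, (∀ i < m, F i < N) ∧ (∀ i < m, ∀ j < m, F i = F j → i = j) ∧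
      (∀ i, i + 1 < m → col (F i) (F (i + 1))) ∧ col (F (m - 1)) (F 0) := by
  have hF : ∀ i (hi : i < m), (fun i => if hi : i < m then (f ⟨i, hi⟩).val else 0) i
      = (f ⟨i, hi⟩).val := fun i hi => by simp [hi]
  refine ⟨fun i => if hi : i < m then (f ⟨i, hi⟩).val else 0, ?_, ?_, ?_, ?_⟩
  · intro i hi; rw [hF i hi]; exact (f _).2
  · intro i hi j hj e
    rw [hF i hi, hF j hj] at e
    have := f.injective (Fin.ext e)
    simpa using this
  · intro i hi
    rw [hF i (by omega), hF (i + 1) hi]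
    apply h
    rw [cyc_adj_iff hm]; left; rfl
  · rw [hF (m - 1) (by omega), hF 0 (by omega)]
    apply h
    rw [cyc_adj_iff hm]; right; right; right
    exact ⟨rfl, by show m - 1 + 1 = m; omega⟩

theorem no_inj {a b : ℕ} (hab : b < a) (g : ℕ → ℕ) (h1 : ∀ i < a, g i < b)
    (h2 : ∀ i < a, ∀ j < a, g i = g j → i = j) : False := by
  obtain ⟨x, hx, y, hy, hne, e⟩ := Finset.exists_ne_map_eq_of_card_lt_of_maps_to
    (s := Finset.range a) (t := Finset.range b) (f := g) (by simpa using hab) (by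
      intro i hi
      simp only [Finset.coe_range, Set.mem_Iio] at hi ⊢
      exact h1 i hi)
  rw [Finset.mem_range] at hx hy
  exact hne (h2 x hx y hy e)

theorem ramsey_lower_one (h n N : ℕ) (hm : 2 ≤ h) (hmn : 2 * h < n) (hN : N < n - 1 + h) :
    ¬ RamseyProp (cycleGraph (2 * h)) (cycleGraph n) N := by
  intro hR
  rcases hR (Sym2.lift ⟨fun a b => if a.val < n - 1 ∧ b.val < n - 1 then 1 else 0, fun a b => by
    simp only [and_comm]⟩) with ⟨f, hf⟩ | ⟨f, hf⟩
  · obtain ⟨F, hF1, hF2, hF3, -⟩ := emb_fn (by omega) f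
      (fun a b => ¬ (a < n - 1 ∧ b < n - 1)) (by
        intro u v huv hc
        have := hf u v huv
        rw [Sym2.lift_mk] at this
        simp only at this
        rw [if_pos hc] at this
        exact absurd this (by decide))
    refine no_inj (a := h) (b := h - 1) (by omega)
      (fun i => if n - 1 ≤ F (2 * i) then F (2 * i) - (n - 1) else F (2 * i + 1) - (n - 1)) ?_ ?_
    · intro i hi
      have h1 := hF1 (2 * i) (by omega)
      have h2 := hF1 (2 * i + 1) (by omega)
      have h3 := hF3 (2 * i) (by omega)
      show (if n - 1 ≤ F (2 * i) then F (2 * i) - (n - 1) else F (2 * i + 1) - (n - 1)) < h - 1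
      split_ifs <;> omega
    · intro i hi j hj e
      have h3 := hF3 (2 * i) (by omega)
      have h3' := hF3 (2 * j) (by omega)
      have k1 := hF2 (2 * i) (by omega) (2 * j) (by omega)
      have k2 := hF2 (2 * i) (by omega) (2 * j + 1) (by omega)
      have k3 := hF2 (2 * i + 1) (by omega) (2 * j) (by omega)
      have k4 := hF2 (2 * i + 1) (by omega) (2 * j + 1) (by omega)
      split_ifs at e <;> omega
  · obtain ⟨F, hF1, hF2, hF3, hF4⟩ := emb_fn (by omega) f
      (fun a b => a < n - 1 ∧ b < n - 1) (by
        intro u v huv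
        have := hf u v huv
        rw [Sym2.lift_mk] at this
        by_contra hc
        simp only at this
        rw [if_neg hc] at this
        exact absurd this (by decide))
    refine no_inj (a := n) (b := n - 1) (by omega) F ?_ hF2
    intro i hi
    by_cases h1 : i + 1 < n
    · exact (hF3 i h1).1
    · rw [show i = n - 1 by omega]; exact hF4.1

theorem ramsey_lower_two (m k N : ℕ) (hm : 4 ≤ m) (hmn : m < 2 * k + 1) (hN : N < 2 * m - 1) :
    ¬ RamseyProp (cycleGraph m) (cycleGraph (2 * k + 1)) N := by
  intro hR
  rcases hR (Sym2.lift ⟨fun a b => if (a.val < m - 1 ↔ b.val < m - 1) then 0 else 1, fun a b => by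
    simp only [iff_comm]⟩) with ⟨f, hf⟩ | ⟨f, hf⟩
  · obtain ⟨F, hF1, hF2, hF3, -⟩ := emb_fn (by omega) f
      (fun a b => (a < m - 1 ↔ b < m - 1)) (by
        intro u v huv
        have := hf u v huv
        rw [Sym2.lift_mk] at this
        by_contra hc
        simp only at this
        rw [if_neg hc] at this
        exact absurd this (by decide))
    have hall : ∀ i, i < m → (F i < m - 1 ↔ F 0 < m - 1) := by
      intro i
      induction i with
      | zero => intro _; exact Iff.rfl
      | succ i ih => intro hi; rw [← hF3 i hi]; exact ih (by omega)
    by_cases h0 : F 0 < m - 1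
    · exact no_inj (a := m) (b := m - 1) (by omega) F (fun i hi => (hall i hi).2 h0) hF2
    · refine no_inj (a := m) (b := m - 1) (by omega) (fun i => F i - (m - 1)) ?_ ?_
      · intro i hi
        have := hF1 i hi
        show F i - (m - 1) < m - 1
        omega
      · intro i hi j hj e
        have h1 : ¬ F i < m - 1 := fun h => h0 ((hall i hi).1 h)
        have h2 : ¬ F j < m - 1 := fun h => h0 ((hall j hj).1 h)
        exact hF2 i hi j hj (by omega)
  · obtain ⟨F, hF1, hF2, hF3, hF4⟩ := emb_fn (by omega) f
      (fun a b => ¬ (a < m - 1 ↔ b < m - 1)) (by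
        intro u v huv hc
        have := hf u v huv
        rw [Sym2.lift_mk] at this
        simp only at this
        rw [if_pos hc] at this
        exact absurd this (by decide))
    have hall : ∀ i, i ≤ k → (F (2 * i) < m - 1 ↔ F 0 < m - 1) := by
      intro i
      induction i with
      | zero => intro _; exact Iff.rfl
      | succ i ih =>
        intro hi
        have h1 := hF3 (2 * i) (by omega)
        have h2 := hF3 (2 * i + 1) (by omega)
        have h3 := ih (by omega)
        rw [show 2 * (i + 1) = 2 * i + 1 + 1 by omega]
        tauto
    exact hF4 (hall k le_rfl)

theorem ramsey_cycles_even_odd (m n : ℕ) (hm : 4 ≤ m) (hmn : m < n)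
    (hme : Even m) (hno : Odd n) :
    ramseyNumber (cycleGraph m) (cycleGraph n) = max (n - 1 + m / 2) (2 * m - 1) := by
  have hup := ramsey_upper m n hm hmn hme hno
  apply le_antisymm
  · exact Nat.sInf_le hup
  · apply le_csInf ⟨_, hup⟩
    intro N hN
    by_contra hlt
    rw [not_le, lt_max_iff] at hlt
    rcases hlt with hlt | hlt
    · obtain ⟨h, rfl⟩ := hme
      rw [← two_mul] at hN
      exact ramsey_lower_one h n N (by omega) (by omega) (by omega) hN
    · obtain ⟨k, rfl⟩ := hno
      exact ramsey_lower_two m k N hm hmn hlt hN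
end

section
/- For all integers n ≥ 2 and k ≥ 1, gr_k(K_3 : C_{2n}) ≤ (n − 1)k + 3n; that is, for every integer N ≥ (n − 1)k + 3n, every k-coloring of the edges of the complete graph K_N contains a rainbow triangle or a monochromatic copy of the even cycle C_{2n}. -/
open SimpleGraph

/-- The edge coloring `c` of the complete graph on `V` contains a rainbow triangle. -/
def HasRainbowTriangle {V α : Type*} (c : Sym2 V → α) : Prop :=
  ∃ x y z : V, x ≠ y ∧ x ≠ z ∧ y ≠ z ∧
    c s(x, y) ≠ c s(x, z) ∧ c s(x, y) ≠ c s(y, z) ∧ c s(x, z) ≠ c s(y, z)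

/-- The edge coloring `c` contains a copy of `H` all of whose edges have color `i`. -/
def HasMonoCopyIn {V W α : Type*} (c : Sym2 V → α) (H : SimpleGraph W) (i : α) : Prop :=
  ∃ f : W ↪ V, ∀ u v, H.Adj u v → c s(f u, f v) = i

/-- The edge coloring `c` contains a monochromatic copy of `H`. -/
def HasMonoCopy {V W α : Type*} (c : Sym2 V → α) (H : SimpleGraph W) : Prop :=
  ∃ i, HasMonoCopyIn c H i

/-- Every `k`-coloring of the edges of `K_n` contains a rainbow triangle or a
monochromatic copy of `H`. -/
def grProp {W : Type*} (k : ℕ) (H : SimpleGraph W) (n : ℕ) : Prop :=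
  ∀ c : Sym2 (Fin n) → Fin k, HasRainbowTriangle c ∨ HasMonoCopy c H

/-- The `k`-color Gallai–Ramsey number `gr_k(K₃ : H)`: the minimum `N` such that for all
`n ≥ N`, every `k`-coloring of the edges of `K_n` contains a rainbow triangle or a
monochromatic copy of `H`. -/
noncomputable def gr {W : Type*} (k : ℕ) (H : SimpleGraph W) : ℕ :=
  sInf {N | ∀ n, N ≤ n → grProp k H n}

/-- A closed chain of length `L` along the relation `R`, presented as a list. -/
def HasC {V : Type*} (R : V → V → Prop) (L : ℕ) : Prop :=
  ∃ l : List V, l.length = L ∧ l.Nodup ∧ l.IsChain R ∧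
    ∀ x ∈ l.head?, ∀ y ∈ l.getLast?, R y x

theorem HasC.mono {V : Type*} {R R' : V → V → Prop} {L : ℕ} (h : HasC R L)
    (hR : ∀ x y, R x y → R' x y) : HasC R' L := by
  obtain ⟨l, h1, h2, h3, h4⟩ := h
  exact ⟨l, h1, h2, h3.imp (fun x y => hR x y), fun x hx y hy => hR _ _ (h4 x hx y hy)⟩

theorem HasC.map {V W : Type*} {R : V → V → Prop} {R' : W → W → Prop} {L : ℕ} (h : HasC R L)
    (f : V → W) (hf : Function.Injective f)
    (hR : ∀ x y, R x y → R' (f x) (f y)) : HasC R' L := by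
  obtain ⟨l, h1, h2, h3, h4⟩ := h
  refine ⟨l.map f, by simpa using h1, h2.map hf, ?_, ?_⟩
  · rw [List.isChain_map]
    exact h3.imp (fun x y => hR x y)
  · intro x hx y hy
    rw [List.head?_map] at hx
    rw [List.getLast?_map] at hy
    simp only [Option.mem_def, Option.map_eq_some_iff] at hx hy
    obtain ⟨a, ha, rfl⟩ := hx
    obtain ⟨b, hb, rfl⟩ := hy
    exact hR _ _ (h4 a ha b hb)

theorem hasC_of_fun {V : Type*} {R : V → V → Prop} {L : ℕ} (hL : 1 ≤ L) (f : ℕ → V)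
    (hinj : ∀ i < L, ∀ j < L, f i = f j → i = j)
    (hch : ∀ i, i + 1 < L → R (f i) (f (i + 1))) (hcl : R (f (L - 1)) (f 0)) : HasC R L := by
  refine ⟨(List.range L).map f, by simp, ?_, ?_, ?_⟩
  · rw [List.nodup_map_iff_inj_on List.nodup_range]
    intro x hx y hy h
    exact hinj x (by simpa using hx) y (by simpa using hy) h
  · rw [List.isChain_map, List.isChain_range]
    intro m hm
    exact hch m (by omega)
  · intro x hx y hy
    rw [List.head?_map] at hx
    rw [List.getLast?_map] at hy
    simp only [Option.mem_def, Option.map_eq_some_iff] at hx hy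
    obtain ⟨a, ha, rfl⟩ := hx
    obtain ⟨b, hb, rfl⟩ := hy
    have h1 : a = 0 := by
      rw [List.head?_range] at ha
      split_ifs at ha <;> simp_all
    have h2 : b = L - 1 := by
      rw [List.getLast?_range] at hb
      split_ifs at hb <;> simp_all
    subst h1 h2
    exact hcl

theorem HasC.exists_fun {V : Type*} {R : V → V → Prop} {L : ℕ} (hL : 1 ≤ L) (h : HasC R L) :
    ∃ f : ℕ → V, (∀ i < L, ∀ j < L, f i = f j → i = j) ∧
      (∀ i, i + 1 < L → R (f i) (f (i + 1))) ∧ R (f (L - 1)) (f 0) := by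
  obtain ⟨l, h1, h2, h3, h4⟩ := h
  subst h1
  have hv : ∀ i (hi : i < l.length), l.getD i (l[0]) = l[i] := by
    intro i hi
    exact List.getD_eq_getElem _ _ hi
  refine ⟨fun i => l.getD i (l[0]), ?_, ?_, ?_⟩
  · intro i hi j hj hij
    simp only [hv i hi, hv j hj] at hij
    exact (h2.getElem_inj_iff).1 hij
  · intro i hi
    simp only [hv i (by omega), hv (i + 1) hi]
    exact (List.isChain_iff_getElem.1 h3) i hi
  · simp only [hv (l.length - 1) (by omega), hv 0 (by omega)]
    apply h4
    · rw [List.head?_eq_getElem?]; simp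
    · rw [List.getLast?_eq_getElem?]; simp

theorem HasC.exists_periodic {V : Type*} {R : V → V → Prop} {L : ℕ} (hL : 1 ≤ L)
    (h : HasC R L) :
    ∃ c : ℕ → V, (∀ i, c (i + L) = c i) ∧ (∀ i j, c i = c j → i % L = j % L) ∧
      (∀ i, R (c i) (c (i + 1))) := by
  obtain ⟨f, h1, h2, h3⟩ := h.exists_fun hL
  refine ⟨fun i => f (i % L), fun i => by simp, fun i j hij => ?_, fun i => ?_⟩
  · exact h1 _ (Nat.mod_lt _ hL) _ (Nat.mod_lt _ hL) hij
  · have hm := Nat.mod_lt i hL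
    by_cases hi : i % L + 1 < L
    · have : (i + 1) % L = i % L + 1 := by
        rw [Nat.add_mod, Nat.mod_eq_of_lt (b := L) (a := i % L + 1 % L)]
        · congr 1; apply Nat.mod_eq_of_lt; omega
        · rw [Nat.mod_eq_of_lt (b := L) (a := 1) (by omega)]; exact hi
      simp only [this]
      exact h2 _ hi
    · have h4 : i % L = L - 1 := by omega
      have : (i + 1) % L = 0 := by
        have := Nat.div_add_mod i L
        have h5 : i + 1 = L * (i / L) + L := by omega
        rw [h5]; simp
      simp only [this, h4]
      exact h3

open Classical in
theorem zigzag {V : Type*} (R : V → V → Prop) (Y : Finset V) :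
    ∀ xs : List V, xs ≠ [] → xs.Nodup → (∀ x ∈ xs, x ∉ Y) → ∀ F : Finset V,
    (∀ x ∈ xs, ∀ x' ∈ xs, x ≠ x' →
      F.card + (xs.length - 1) ≤ (Y.filter (fun y => R x y ∧ R y x')).card) →
    ∃ l : List V, l.length = 2 * xs.length - 1 ∧ l.Nodup ∧ l.IsChain R ∧
      l.head? = xs.head? ∧ l.getLast? = xs.getLast? ∧
      ∀ v ∈ l, v ∈ xs ∨ (v ∈ Y ∧ v ∉ F) := by
  intro xs
  induction xs with
  | nil => intro h; exact absurd rfl h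
  | cons x t ih =>
    intro _ hnd hY F hF
    cases t with
    | nil => exact ⟨[x], by simp, by simp, by simp, by simp, by simp, by simp⟩
    | cons x' t =>
      have hxx : x ≠ x' := by
        intro h; subst h; simp at hnd
      have hc := hF x (by simp) x' (by simp) hxx
      obtain ⟨y, hy, hyF⟩ := Finset.exists_mem_notMem_of_card_lt_card
        (s := F) (t := Y.filter (fun y => R x y ∧ R y x'))
        (by simp only [List.length_cons] at hc; omega)
      simp only [Finset.mem_filter] at hy
      obtain ⟨hyY, hxy, hyx⟩ := hy
      obtain ⟨l, l1, l2, l3, l4, l5, l6⟩ := ih (by simp) (List.nodup_cons.1 hnd).2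
        (fun z hz => hY z (List.mem_cons_of_mem _ hz)) (insert y F) (by
          intro a ha b hb hab
          have := hF a (List.mem_cons_of_mem _ ha) b (List.mem_cons_of_mem _ hb) hab
          have h2 := Finset.card_insert_le y F
          simp only [List.length_cons] at this ⊢
          omega)
      have hyl : y ∉ l := by
        intro h
        rcases l6 y h with h | h
        · exact hY y (List.mem_cons_of_mem _ h) hyY
        · exact h.2 (Finset.mem_insert_self _ _)
      have hxl : x ∉ l := by
        intro h
        rcases l6 x h with h | h
        · exact (List.nodup_cons.1 hnd).1 h
        · exact hY x (by simp) h.1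
      have hxny : x ≠ y := by
        intro h; exact hY x (by simp) (h ▸ hyY)
      refine ⟨x :: y :: l, ?_, ?_, ?_, ?_, ?_, ?_⟩
      · simp only [List.length_cons] at l1 ⊢; omega
      · simp [hxl, hyl, l2, hxny]
      · rw [List.isChain_cons_cons, List.isChain_cons]
        refine ⟨hxy, ?_, l3⟩
        rw [l4]; simpa using hyx
      · simp
      · cases l with
        | nil => simp at l1; omega
        | cons a l => simpa using l5
      · intro v hv
        simp only [List.mem_cons] at hv
        rcases hv with rfl | rfl | hv
        · simp
        · exact Or.inr ⟨hyY, hyF⟩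
        · rcases l6 v hv with h | h
          · exact Or.inl (List.mem_cons_of_mem _ h)
          · exact Or.inr ⟨h.1, fun h' => h.2 (Finset.mem_insert_of_mem h')⟩

open Classical in
/-- Lemma Z: close up a zigzag through `xs` with a path `q`. -/
theorem hasC_zigzag {V : Type*} (R : V → V → Prop) (Y : Finset V) (xs q : List V)
    (hxs : xs ≠ []) (hq : q ≠ []) (hxnd : xs.Nodup) (hxY : ∀ x ∈ xs, x ∉ Y)
    (hqnd : q.Nodup) (hqc : q.IsChain R) (hqx : ∀ v ∈ q, v ∉ xs)
    (h1 : ∀ a ∈ xs.getLast?, ∀ b ∈ q.head?, R a b)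
    (h2 : ∀ a ∈ q.getLast?, ∀ b ∈ xs.head?, R a b)
    (hF : ∀ x ∈ xs, ∀ x' ∈ xs, x ≠ x' →
      q.length + (xs.length - 1) ≤ (Y.filter (fun y => R x y ∧ R y x')).card)
    (L : ℕ) (hL : L + 1 = 2 * xs.length + q.length) : HasC R L := by
  obtain ⟨l, l1, l2, l3, l4, l5, l6⟩ := zigzag R Y xs hxs hxnd hxY q.toFinset (by
    intro a ha b hb hab
    have := hF a ha b hb hab
    have h := List.toFinset_card_le q
    omega)
  have hx0 : 0 < xs.length := List.length_pos_iff.2 hxs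
  have hlne : l ≠ [] := by
    rw [← List.length_pos_iff]; omega
  refine ⟨l ++ q, ?_, ?_, ?_, ?_⟩
  · rw [List.length_append]; omega
  · rw [List.nodup_append]
    refine ⟨l2, hqnd, ?_⟩
    rintro a ha b hb rfl
    rcases l6 a ha with h | h
    · exact hqx a hb h
    · exact h.2 (by simpa using hb)
  · rw [List.isChain_append]
    refine ⟨l3, hqc, ?_⟩
    rw [l5]; exact h1
  · rw [List.head?_append_of_ne_nil _ hlne, List.getLast?_append_of_ne_nil _ hq, l4]
    exact fun x hx y hy => h2 y hy x hx

open Classical in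
/-- Ore-type crossing step for balanced bipartite graphs. -/
theorem ore_step {V : Type*} (n : ℕ) (hn : 2 ≤ n) (S T : Finset V) (hST : Disjoint S T)
    (hS : S.card = n) (hT : T.card = n) (G : V → V → Prop) (hsymm : ∀ x y, G x y → G y x)
    (hbip : ∀ x y, G x y → (x ∈ S ∧ y ∈ T) ∨ (x ∈ T ∧ y ∈ S))
    (f : ℕ → V) (hinj : ∀ i < 2 * n, ∀ j < 2 * n, f i = f j → i = j)
    (hch : ∀ i, i + 1 < 2 * n → G (f i) (f (i + 1)))
    (h0 : f 0 ∈ S) (hl : f (2 * n - 1) ∈ T)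
    (hdeg : n + 1 ≤ (T.filter (fun y => G (f 0) y)).card +
      (S.filter (fun x => G x (f (2 * n - 1)))).card) : HasC G (2 * n) := by
  have hmem : ∀ i < 2 * n, f i ∈ S ∪ T := by
    intro i hi
    rcases Nat.eq_zero_or_pos i with rfl | hp
    · exact Finset.mem_union_left _ h0
    · obtain ⟨j, rfl⟩ : ∃ j, i = j + 1 := ⟨i - 1, by omega⟩
      rcases hbip _ _ (hch j hi) with h | h
      · exact Finset.mem_union_right _ h.2
      · exact Finset.mem_union_left _ h.2
  have hsurj : ∀ v ∈ S ∪ T, ∃ i < 2 * n, f i = v := by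
    have h1 : (Finset.range (2 * n)).image f = S ∪ T := by
      apply Finset.eq_of_subset_of_card_le
      · intro v hv
        simp only [Finset.mem_image, Finset.mem_range] at hv
        obtain ⟨i, hi, rfl⟩ := hv
        exact hmem i hi
      · rw [Finset.card_union_of_disjoint hST, Finset.card_image_of_injOn, Finset.card_range]
        · omega
        · intro i hi j hj h
          exact hinj i (by simpa using hi) j (by simpa using hj) h
    intro v hv
    rw [← h1] at hv
    simpa using hv
  let A := (Finset.range (2 * n - 1)).filter (fun i => G (f 0) (f (i + 1)))
  let B := (Finset.range (2 * n - 1)).filter (fun i => G (f i) (f (2 * n - 1)))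
  have hdisj : ∀ v, v ∈ S → v ∈ T → False := fun v h1 h2 =>
    (Finset.disjoint_left.1 hST) h1 h2
  have hA : (T.filter (fun y => G (f 0) y)).card ≤ A.card := by
    refine (Finset.card_le_card (t := A.image (fun i => f (i + 1))) ?_).trans
      Finset.card_image_le
    intro v hv
    simp only [Finset.mem_filter] at hv
    obtain ⟨i, hi, rfl⟩ := hsurj v (Finset.mem_union_right _ hv.1)
    rcases Nat.eq_zero_or_pos i with rfl | hp
    · exact (hdisj _ h0 hv.1).elim
    · obtain ⟨j, rfl⟩ : ∃ j, i = j + 1 := ⟨i - 1, by omega⟩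
      simp only [Finset.mem_image]
      exact ⟨j, by simp only [A, Finset.mem_filter, Finset.mem_range]; exact ⟨by omega, hv.2⟩, rfl⟩
  have hB : (S.filter (fun x => G x (f (2 * n - 1)))).card ≤ B.card := by
    refine (Finset.card_le_card (t := B.image f) ?_).trans
      Finset.card_image_le
    intro v hv
    simp only [Finset.mem_filter] at hv
    obtain ⟨i, hi, rfl⟩ := hsurj v (Finset.mem_union_left _ hv.1)
    have hne : i ≠ 2 * n - 1 := by
      rintro rfl
      exact hdisj _ hv.1 hl
    simp only [Finset.mem_image]
    exact ⟨i, by simp only [B, Finset.mem_filter, Finset.mem_range]; exact ⟨by omega, hv.2⟩, rfl⟩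
  have hAB : (A ∪ B).card ≤ n := by
    rw [← hT]
    apply Finset.card_le_card_of_injOn (fun i => f (i + 1))
    · intro i hi
      simp only [A, B, Finset.coe_union, Set.mem_union, Finset.mem_coe, Finset.mem_filter,
        Finset.mem_range] at hi
      rcases hi with ⟨hi, h⟩ | ⟨hi, h⟩
      · rcases hbip _ _ h with h | h
        · exact h.2
        · exact (hdisj _ h0 h.1).elim
      · rcases hbip _ _ h with h | h
        · rcases hbip _ _ (hch i (by omega)) with h' | h'
          · exact h'.2
          · exact (hdisj _ h.1 h'.1).elim
        · exact (hdisj _ h.2 hl).elim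
    · intro i hi j hj h
      simp only [A, B, Finset.coe_union, Set.mem_union, Finset.mem_coe, Finset.mem_filter,
        Finset.mem_range] at hi hj
      have := hinj (i + 1) (by omega) (j + 1) (by omega) h
      omega
  have hAiB : (A ∩ B).Nonempty := by
    rw [← Finset.card_pos]
    have := Finset.card_union_add_card_inter A B
    omega
  obtain ⟨j, hj⟩ := hAiB
  simp only [A, B, Finset.mem_inter, Finset.mem_filter, Finset.mem_range] at hj
  obtain ⟨⟨hj, hj1⟩, -, hj2⟩ := hj
  -- new cycle: f 0 .. f j, f (2n-1), ..., f (j+1)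
  refine hasC_of_fun (by omega) (fun i => if i ≤ j then f i else f (2 * n + j - i)) ?_ ?_ ?_
  · intro a ha b hb hab
    split_ifs at hab with h1 h2 h2
    · exact hinj _ ha _ hb hab
    · have := hinj _ ha _ (by omega) hab
      omega
    · have := hinj _ (by omega) _ hb hab
      omega
    · have := hinj _ (by omega) _ (by omega) hab
      omega
  · intro i hi
    split_ifs with h1 h2 h2
    · exact hch i hi
    · have : i = j := by omega
      subst this
      have h3 : 2 * n + i - (i + 1) = 2 * n - 1 := by omega
      rw [h3]; exact hj2
    · omega
    · have h3 : 2 * n + j - i = 2 * n + j - (i + 1) + 1 := by omega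
      rw [h3]
      exact hsymm _ _ (hch _ (by omega))
  · rw [if_neg (by omega), if_pos (by omega)]
    have h3 : 2 * n + j - (2 * n - 1) = j + 1 := by omega
    rw [h3]
    exact hsymm _ _ hj1

open Classical in
theorem ore_close {V : Type*} (n : ℕ) (hn : 2 ≤ n) (S T : Finset V) (hST : Disjoint S T)
    (hS : S.card = n) (hT : T.card = n) (G : V → V → Prop) (hsymm : ∀ x y, G x y → G y x)
    (hbip : ∀ x y, G x y → (x ∈ S ∧ y ∈ T) ∨ (x ∈ T ∧ y ∈ S)) (s t : V) (hs : s ∈ S) (ht : t ∈ T)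
    (hdeg : n + 1 ≤ (T.filter (fun y => G s y)).card + (S.filter (fun x => G x t)).card)
    (h : HasC (fun x y => G x y ∨ (x = s ∧ y = t) ∨ (x = t ∧ y = s)) (2 * n)) :
    HasC G (2 * n) := by
  obtain ⟨c, c1, c2, c3⟩ := h.exists_periodic (by omega)
  by_cases hall : ∀ i, G (c i) (c (i + 1))
  · refine hasC_of_fun (by omega) c ?_ (fun i _ => hall i) ?_
    · intro i hi j hj hij
      have := c2 i j hij
      rwa [Nat.mod_eq_of_lt hi, Nat.mod_eq_of_lt hj] at this
    · have h1 := hall (2 * n - 1)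
      have h2 := c1 0
      rw [show 2 * n - 1 + 1 = 0 + 2 * n by omega, h2] at h1
      exact h1
  · push Not at hall
    obtain ⟨i0, hi0⟩ := hall
    have hst : s ≠ t := by
      rintro rfl; exact Finset.disjoint_left.1 hST hs ht
    have hinj : ∀ i < 2 * n, ∀ j < 2 * n, c (i0 + 1 + i) = c (i0 + 1 + j) → i = j := by
      intro i hi j hj hij
      have h1 : i ≡ j [MOD 2 * n] := Nat.ModEq.add_left_cancel' (i0 + 1) (c2 _ _ hij)
      have h2 : i % (2 * n) = j % (2 * n) := h1
      rwa [Nat.mod_eq_of_lt hi, Nat.mod_eq_of_lt hj] at h2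
    have hlast : c (i0 + 1 + (2 * n - 1)) = c i0 := by
      rw [show i0 + 1 + (2 * n - 1) = i0 + 2 * n by omega, c1]
    have hb := (c3 i0).resolve_left hi0
    have hch : ∀ i, i + 1 < 2 * n → G (c (i0 + 1 + i)) (c (i0 + 1 + (i + 1))) := by
      intro i hi
      rcases c3 (i0 + 1 + i) with h | h
      · exact h
      · exfalso
        rw [← hlast] at hb
        have e1 : i0 + 1 + i + 1 = i0 + 1 + (i + 1) := by omega
        have e2 : i0 + 1 = i0 + 1 + 0 := by omega
        rw [e1] at h
        rw [show c (i0 + 1) = c (i0 + 1 + 0) from rfl] at hb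
        have k1 := hinj i (by omega) 0 (by omega)
        have k2 := hinj (i + 1) (by omega) 0 (by omega)
        have k3 := hinj i (by omega) (2 * n - 1) (by omega)
        have k4 := hinj (i + 1) (by omega) (2 * n - 1) (by omega)
        rcases h with ⟨a1, a2⟩ | ⟨a1, a2⟩ <;> rcases hb with ⟨b1, b2⟩ | ⟨b1, b2⟩
        · have := k3 (a1.trans b1.symm); omega
        · have := k4 (a2.trans b1.symm); have := k1 (a1.trans b2.symm); omega
        · have := k4 (a2.trans b1.symm); have := k1 (a1.trans b2.symm); omega
        · have := k3 (a1.trans b1.symm); omega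
    rcases hb with ⟨b1, b2⟩ | ⟨b1, b2⟩
    · -- c i0 = s, c (i0+1) = t
      refine ore_step n hn T S hST.symm hT hS G hsymm (fun x y h => (hbip x y h).symm)
        (fun i => c (i0 + 1 + i)) hinj hch ?_ ?_ ?_
      · simpa [b2] using ht
      · simp only [hlast, b1]; exact hs
      · simp only [hlast, b1, add_zero, b2]
        have e1 : S.filter (fun y => G t y) = S.filter (fun y => G y t) := by
          ext x; simp only [Finset.mem_filter]
          exact ⟨fun h => ⟨h.1, hsymm _ _ h.2⟩, fun h => ⟨h.1, hsymm _ _ h.2⟩⟩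
        have e2 : T.filter (fun y => G y s) = T.filter (fun y => G s y) := by
          ext x; simp only [Finset.mem_filter]
          exact ⟨fun h => ⟨h.1, hsymm _ _ h.2⟩, fun h => ⟨h.1, hsymm _ _ h.2⟩⟩
        rw [e1, e2]; omega
    · refine ore_step n hn S T hST hS hT G hsymm hbip
        (fun i => c (i0 + 1 + i)) hinj hch ?_ ?_ ?_
      · simpa [b2] using hs
      · simp only [hlast, b1]; exact ht
      · simp only [hlast, b1, add_zero, b2]; exact hdeg

open Classical in
/-- Complete bipartite graphs have alternating cycles. -/
theorem hasC_bip {V : Type*} (n : ℕ) (hn : 1 ≤ n) (S T : Finset V) (hST : Disjoint S T)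
    (hS : S.card = n) (hT : n ≤ T.card) (R : V → V → Prop) (hR : ∀ x ∈ S, ∀ y ∈ T, R x y ∧ R y x) :
    HasC R (2 * n) := by
  obtain ⟨t, ht⟩ : T.Nonempty := by rw [← Finset.card_pos]; omega
  have hl : S.toList.length = n := by simp [hS]
  refine hasC_zigzag R T S.toList [t] ?_ (by simp) (Finset.nodup_toList S) ?_ (by simp) (by simp)
    ?_ ?_ ?_ ?_ _ ?_
  · rw [← List.length_pos_iff]; omega
  · intro x hx; exact Finset.disjoint_left.1 hST (by simpa using hx)
  · intro v hv
    simp only [List.mem_singleton] at hv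
    subst hv
    intro h
    exact Finset.disjoint_left.1 hST (by simpa using h) ht
  · intro a ha b hb
    have h1 := List.mem_of_getLast? ha
    simp only [List.head?_cons, Option.mem_def, Option.some.injEq] at hb
    subst hb
    exact (hR a (by simpa using h1) t ht).1
  · intro a ha b hb
    have h1 := List.mem_of_head? hb
    simp only [List.getLast?_singleton, Option.mem_def, Option.some.injEq] at ha
    subst ha
    exact (hR b (by simpa using h1) t ht).2
  · intro x hx x' hx' _
    rw [Finset.filter_true_of_mem]
    · simp only [List.length_singleton]; omega
    · intro y hy
      exact ⟨(hR x (by simpa using hx) y hy).1, (hR x' (by simpa using hx') y hy).2⟩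
  · simp only [List.length_singleton]; omega

open Classical in
/-- The hole lemma. -/
theorem hole {V : Type*} (n : ℕ) (S T : Finset V) (hST : Disjoint S T)
    (hS : S.card = n) (hT : T.card = n) (hn : 2 ≤ n) (R same : V → V → Prop)
    (hsymm : ∀ x y, R x y → R y x)
    (s2 : ∀ x y, same x y → same y x)
    (s3 : ∀ x y z, same x y → same y z → same x z)
    (hpart : ∀ x, ((S ∪ T).filter (fun y => same x y)).card ≤ n - 1)
    (hR : ∀ x ∈ S, ∀ y ∈ T, same x y ∨ R x y) : HasC R (2 * n) := by
  let G : V → V → Prop := fun x y => ((x ∈ S ∧ y ∈ T) ∨ (x ∈ T ∧ y ∈ S)) ∧ ¬ same x y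
  let GM : Finset (V × V) → V → V → Prop := fun M x y => G x y ∨ (x, y) ∈ M ∨ (y, x) ∈ M
  have hG : ∀ x y, G x y → R x y := by
    rintro x y ⟨h | h, hs⟩
    · exact (hR x h.1 y h.2).resolve_left hs
    · exact hsymm _ _ ((hR y h.2 x h.1).resolve_left (fun h => hs (s2 _ _ h)))
  suffices h : ∀ M : Finset (V × V), (∀ p ∈ M, p.1 ∈ S ∧ p.2 ∈ T ∧ same p.1 p.2) →
      HasC (GM M) (2 * n) → HasC R (2 * n) by
    refine h ((S ×ˢ T).filter (fun p => same p.1 p.2)) ?_ ?_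
    · intro p hp
      simp only [Finset.mem_filter, Finset.mem_product] at hp
      exact ⟨hp.1.1, hp.1.2, hp.2⟩
    · refine hasC_bip n (by omega) S T hST hS hT.ge _ ?_
      intro x hx y hy
      by_cases hxy : same x y
      · constructor
        · right; left; simp [hx, hy, hxy]
        · right; right; simp [hx, hy, hxy]
      · exact ⟨Or.inl ⟨Or.inl ⟨hx, hy⟩, hxy⟩, Or.inl ⟨Or.inr ⟨hy, hx⟩, fun h => hxy (s2 _ _ h)⟩⟩
  intro M
  induction M using Finset.induction_on with
  | empty =>
    intro _ h
    refine h.mono ?_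
    rintro x y (h | h | h)
    · exact hG _ _ h
    · simp at h
    · simp at h
  | insert p M hp ih =>
    intro hM h
    refine ih (fun q hq => hM q (Finset.mem_insert_of_mem hq)) ?_
    obtain ⟨hs, ht, hst⟩ := hM p (Finset.mem_insert_self _ _)
    obtain ⟨s, t⟩ := p
    simp only at hs ht hst
    refine ore_close n hn S T hST hS hT (GM M) ?_ ?_ s t hs ht ?_ ?_
    · rintro x y (h | h | h)
      · exact Or.inl ⟨h.1.symm.imp (fun h => ⟨h.2, h.1⟩) (fun h => ⟨h.2, h.1⟩),
          fun h' => h.2 (s2 _ _ h')⟩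
      · exact Or.inr (Or.inr h)
      · exact Or.inr (Or.inl h)
    · rintro x y (h | h | h)
      · exact h.1
      · have := hM _ (Finset.mem_insert_of_mem h)
        exact Or.inl ⟨this.1, this.2.1⟩
      · have := hM _ (Finset.mem_insert_of_mem h)
        exact Or.inr ⟨this.2.1, this.1⟩
    · have hp := hpart s
      rw [Finset.filter_union, Finset.card_union_of_disjoint
        (Finset.disjoint_filter_filter hST)] at hp
      have a1 := Finset.card_filter_add_card_filter_not (s := T) (fun y => same s y)
      have a2 := Finset.card_filter_add_card_filter_not (s := S) (fun y => same s y)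
      refine le_trans ?_ (Nat.add_le_add
        (Finset.card_le_card (s := T.filter (fun y => ¬ same s y)) ?_)
        (Finset.card_le_card (s := S.filter (fun y => ¬ same s y)) ?_))
      · omega
      · intro y hy
        simp only [Finset.mem_filter] at hy ⊢
        exact ⟨hy.1, Or.inl ⟨Or.inl ⟨hs, hy.1⟩, hy.2⟩⟩
      · intro y hy
        simp only [Finset.mem_filter] at hy ⊢
        exact ⟨hy.1, Or.inl ⟨Or.inl ⟨hy.1, ht⟩, fun h => hy.2 (s3 _ _ _ hst (s2 _ _ h))⟩⟩
    · refine h.mono ?_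
      rintro x y (h | h | h)
      · exact Or.inl (Or.inl h)
      · rw [Finset.mem_insert] at h
        rcases h with h | h
        · simp only [Prod.mk.injEq] at h
          exact Or.inr (Or.inl h)
        · exact Or.inl (Or.inr (Or.inl h))
      · rw [Finset.mem_insert] at h
        rcases h with h | h
        · simp only [Prod.mk.injEq] at h
          exact Or.inr (Or.inr ⟨h.2, h.1⟩)
        · exact Or.inl (Or.inr (Or.inr h))

open Classical in
theorem dfs_state {V : Type*} (R : V → V → Prop) (A : Finset V) : ∀ k ≤ A.card,
    ∃ (S T : Finset V) (l : List V), l.Nodup ∧ l.IsChain R ∧ S ⊆ A ∧ T ⊆ A ∧ (∀ v ∈ l, v ∈ A) ∧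
      Disjoint S T ∧ (∀ v ∈ l, v ∉ S ∧ v ∉ T) ∧ S.card + T.card + l.length = A.card ∧
      (∀ s ∈ S, ∀ t ∈ T, ¬ R t s) ∧ T.card + k = A.card + S.card := by
  intro k
  induction k with
  | zero =>
    intro _
    exact ⟨∅, A, [], by simp, by simp, by simp, by simp, by simp, by simp, by simp, by simp,
      by simp, by simp⟩
  | succ k ih =>
    intro hk
    obtain ⟨S, T, l, h1, h2, h3, h4, h5, h6, h7, h8, h9, h10⟩ := ih (by omega)
    have push : ∀ u ∈ T, (∀ v ∈ l.head?, R u v) → ∃ (S T : Finset V) (l : List V),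
      l.Nodup ∧ l.IsChain R ∧ S ⊆ A ∧ T ⊆ A ∧ (∀ v ∈ l, v ∈ A) ∧
      Disjoint S T ∧ (∀ v ∈ l, v ∉ S ∧ v ∉ T) ∧ S.card + T.card + l.length = A.card ∧
      (∀ s ∈ S, ∀ t ∈ T, ¬ R t s) ∧ T.card + (k + 1) = A.card + S.card := by
      intro u hu hR
      have hc := Finset.card_erase_add_one hu
      refine ⟨S, T.erase u, u :: l, ?_, ?_, h3, (Finset.erase_subset _ _).trans h4, ?_, ?_, ?_,
        ?_, ?_, ?_⟩
      · exact List.nodup_cons.2 ⟨fun h => (h7 u h).2 hu, h1⟩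
      · rw [List.isChain_cons]; exact ⟨hR, h2⟩
      · intro v hv
        rcases List.mem_cons.1 hv with rfl | hv
        · exact h4 hu
        · exact h5 v hv
      · exact h6.mono_right (Finset.erase_subset _ _)
      · intro v hv
        rcases List.mem_cons.1 hv with rfl | hv
        · exact ⟨fun h => Finset.disjoint_left.1 h6 h hu, by simp⟩
        · exact ⟨(h7 v hv).1, fun h => (h7 v hv).2 (Finset.mem_of_mem_erase h)⟩
      · simp only [List.length_cons]; omega
      · exact fun s hs t ht => h9 s hs t (Finset.mem_of_mem_erase ht)
      · omega
    cases l with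
    | nil =>
      obtain ⟨u, hu⟩ : T.Nonempty := by
        rw [← Finset.card_pos]; omega
      exact push u hu (by simp)
    | cons v l =>
      by_cases hex : ∃ u ∈ T, R u v
      · obtain ⟨u, hu, huv⟩ := hex
        exact push u hu (by simpa using huv)
      · push Not at hex
        have hv := h7 v (by simp)
        have hc := Finset.card_insert_of_notMem hv.1
        refine ⟨insert v S, T, l, (List.nodup_cons.1 h1).2, (List.isChain_cons.1 h2).2, ?_, h4, ?_,
          ?_, ?_, ?_, ?_, ?_⟩
        · exact Finset.insert_subset (h5 v (by simp)) h3
        · exact fun w hw => h5 w (List.mem_cons_of_mem _ hw)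
        · exact Finset.disjoint_insert_left.2 ⟨hv.2, h6⟩
        · intro w hw
          have hw' := h7 w (List.mem_cons_of_mem _ hw)
          refine ⟨?_, hw'.2⟩
          rw [Finset.mem_insert]
          rintro (rfl | h)
          · exact (List.nodup_cons.1 h1).1 hw
          · exact hw'.1 h
        · simp only [List.length_cons] at h8; omega
        · intro s hs t ht
          rcases Finset.mem_insert.1 hs with rfl | hs
          · exact hex t ht
          · exact h9 s hs t ht
        · omega

theorem dfs {V : Type*} (R : V → V → Prop) (A : Finset V) (n : ℕ) :
    (∃ S T : Finset V, S ⊆ A ∧ T ⊆ A ∧ Disjoint S T ∧ S.card = n ∧ T.card = n ∧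
      ∀ s ∈ S, ∀ t ∈ T, ¬ R t s) ∨
    ∃ l : List V, l.Nodup ∧ l.IsChain R ∧ (∀ v ∈ l, v ∈ A) ∧ A.card + 2 ≤ l.length + 2 * n := by
  obtain ⟨S, T, l, h1, h2, h3, h4, h5, h6, h7, h8, h9, h10⟩ := dfs_state R A A.card le_rfl
  by_cases hS : n ≤ S.card
  · left
    obtain ⟨S', hS', cS⟩ := Finset.exists_subset_card_eq hS
    obtain ⟨T', hT', cT⟩ := Finset.exists_subset_card_eq (show n ≤ T.card by omega)
    exact ⟨S', T', hS'.trans h3, hT'.trans h4, h6.mono hS' hT', cS, cT,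
      fun s hs t ht => h9 s (hS' hs) t (hT' ht)⟩
  · right
    exact ⟨l, h1, h2, h5, by omega⟩

/-- A symmetric edge colouring with no rainbow triangle. -/
def Gal {V κ : Type*} (col : V → V → κ) : Prop :=
  (∀ x y, col x y = col y x) ∧ ∀ x y z, x ≠ y → x ≠ z → y ≠ z →
    col x y = col x z ∨ col x y = col y z ∨ col x z = col y z

theorem Gal.comp {V W κ : Type*} {col : V → V → κ} (h : Gal col) (f : W → V)
    (hf : Function.Injective f) : Gal (fun x y => col (f x) (f y)) :=
  ⟨fun x y => h.1 _ _, fun x y z h1 h2 h3 => h.2 _ _ _ (hf.ne h1) (hf.ne h2) (hf.ne h3)⟩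

/-- The graph of edges of colour `a`. -/
def cg {V κ : Type*} (col : V → V → κ) (hs : ∀ x y, col x y = col y x) (a : κ) : SimpleGraph V where
  Adj x y := x ≠ y ∧ col x y = a
  symm := ⟨fun x y h => ⟨h.1.symm, (hs y x).trans h.2⟩⟩
  loopless := ⟨fun x h => h.1 rfl⟩

theorem gal_homog {V κ : Type*} {col : V → V → κ} (h : Gal col) (a : κ) {x x' y : V}
    (hx : (cg col h.1 a).Reachable x x') (hy : ¬ (cg col h.1 a).Reachable x y) :
    col x y = col x' y := by
  obtain ⟨w⟩ := hx
  induction w with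
  | nil => rfl
  | @cons x u x' hadj w ih =>
    have hu : ¬ (cg col h.1 a).Reachable u y := fun hh => hy (hadj.reachable.trans hh)
    rw [← ih hu]
    have hxy : x ≠ y := by rintro rfl; exact hy (SimpleGraph.Reachable.refl _)
    have huy : u ≠ y := by rintro rfl; exact hu (SimpleGraph.Reachable.refl _)
    have h1 : col x y ≠ a := fun hh =>
      hy (SimpleGraph.Adj.reachable (show (cg col h.1 a).Adj x y from ⟨hxy, hh⟩))
    have h2 : col u y ≠ a := fun hh =>
      hu (SimpleGraph.Adj.reachable (show (cg col h.1 a).Adj u y from ⟨huy, hh⟩))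
    have h3 : col x u = a := hadj.2
    rcases h.2 x u y hadj.1 hxy huy with h4 | h4 | h4
    · exact absurd (h4.symm.trans h3) h1
    · exact absurd (h4.symm.trans h3) h2
    · exact h4

theorem gal_reach_v {V κ : Type*} {col : V → V → κ} (h : Gal col) (a : κ) (v : V)
    {x z : V} (w : (cg col h.1 a).Walk x z) (hz : z = v) (hx : x ≠ v) :
    ∃ y : {x // x ≠ v}, (cg _ (h.comp _ (Subtype.val_injective (p := fun x => x ≠ v))).1 a).Reachable
      ⟨x, hx⟩ y ∧ col v y = a := by
  induction w with
  | nil => exact absurd hz hx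
  | @cons x u z hadj w ih =>
    by_cases hu : u = v
    · subst hu
      exact ⟨⟨x, hx⟩, SimpleGraph.Reachable.refl _, (h.1 _ _).trans hadj.2⟩
    · obtain ⟨y, hy, hy'⟩ := ih hz hu
      refine ⟨y, SimpleGraph.Reachable.trans (SimpleGraph.Adj.reachable ?_) hy, hy'⟩
      exact ⟨fun hh => hadj.1 (congrArg Subtype.val hh), hadj.2⟩

theorem gal_exists_edge {V κ : Type*} {col : V → V → κ} (h : Gal col) (b : κ) {v p : V}
    (hb : (cg col h.1 b).Preconnected) (hp : p ≠ v) : ∃ x, x ≠ v ∧ col v x = b := by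
  obtain ⟨w⟩ := hb v p
  cases w with
  | nil => exact absurd rfl hp
  | cons hadj w => exact ⟨_, hadj.1.symm, hadj.2⟩

theorem gal_L3_step {V κ : Type*} {col : V → V → κ} (h : Gal col) (a b c : κ) (v : V)
    (hab : a ≠ b) (hac : a ≠ c) (hbc : b ≠ c)
    (ha : (cg col h.1 a).Preconnected) (hb : (cg col h.1 b).Preconnected)
    (hc : (cg col h.1 c).Preconnected)
    (hd : ¬ (cg _ (h.comp _ (Subtype.val_injective (p := fun x => x ≠ v))).1 a).Preconnected) :
    False := by
  have h' := h.comp _ (Subtype.val_injective (p := fun x => x ≠ v))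
  have hto : ∀ p : {x // x ≠ v}, ∃ y : {x // x ≠ v}, (cg _ h'.1 a).Reachable p y ∧ col v y = a := by
    intro p
    obtain ⟨w⟩ := ha p v
    exact gal_reach_v h a v w rfl p.2
  unfold SimpleGraph.Preconnected at hd
  push Not at hd
  obtain ⟨p, q, hpq⟩ := hd
  obtain ⟨x0, hx0, hx⟩ := gal_exists_edge h b hb p.2
  obtain ⟨x0', hx0', hx'⟩ := gal_exists_edge h c hc p.2
  obtain ⟨x, rfl⟩ : ∃ x : {x // x ≠ v}, x.1 = x0 := ⟨⟨x0, hx0⟩, rfl⟩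
  obtain ⟨x', rfl⟩ : ∃ x : {x // x ≠ v}, x.1 = x0' := ⟨⟨x0', hx0'⟩, rfl⟩
  have key : ∀ (u y : {x // x ≠ v}) (e : κ), col v u = e → col v y = a → e ≠ a →
      ¬ (cg _ h'.1 a).Reachable u y → col u y = e := by
    intro u y e hu hy he hr
    have huy : u ≠ y := by rintro rfl; exact hr (SimpleGraph.Reachable.refl _)
    have h1 : col u y ≠ a := fun hh =>
      hr (SimpleGraph.Adj.reachable (show (cg _ h'.1 a).Adj u y from ⟨huy, hh⟩))
    rcases h.2 v u y u.2.symm y.2.symm (fun hh => huy (Subtype.ext hh)) with h4 | h4 | h4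
    · exact absurd (hu.symm.trans (h4.trans hy)) he
    · exact h4.symm.trans hu
    · exact absurd (h4.symm.trans hy) h1
  by_cases hr : (cg _ h'.1 a).Reachable x x'
  · obtain ⟨p', hp'⟩ : ∃ p', ¬ (cg _ h'.1 a).Reachable x p' := by
      by_contra hcon
      push Not at hcon
      exact hpq ((hcon p).symm.trans (hcon q))
    obtain ⟨y, hy, hvy⟩ := hto p'
    have n1 : ¬ (cg _ h'.1 a).Reachable x y := fun hh => hp' (hh.trans hy.symm)
    have n2 : ¬ (cg _ h'.1 a).Reachable x' y := fun hh => n1 (hr.trans hh)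
    have e1 := key x y b hx hvy hab.symm n1
    have e2 := key x' y c hx' hvy hac.symm n2
    have e3 := gal_homog h' a hr n1
    exact hbc (e1.symm.trans (e3.trans e2))
  · obtain ⟨y, hy, hvy⟩ := hto x'
    obtain ⟨y', hy', hvy'⟩ := hto x
    have n1 : ¬ (cg _ h'.1 a).Reachable x y := fun hh => hr (hh.trans hy.symm)
    have n2 : ¬ (cg _ h'.1 a).Reachable x' y' := fun hh => hr (hy'.trans hh.symm)
    have e1 := key x y b hx hvy hab.symm n1
    have e2 := key x' y' c hx' hvy' hac.symm n2
    have e3 : col x y = col y' y := gal_homog h' a hy' n1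
    have e4 : col x' y' = col y y' := gal_homog h' a hy n2
    exact hbc (e1.symm.trans (e3.trans ((h.1 _ _).trans (e4.symm.trans e2))))

theorem gal_L3 {κ : Type*} : ∀ (m : ℕ) {V : Type*} [Finite V] {col : V → V → κ} (h : Gal col)
    (a b c : κ), Nat.card V = m → 2 ≤ m → a ≠ b → a ≠ c → b ≠ c →
    (cg col h.1 a).Preconnected → (cg col h.1 b).Preconnected → (cg col h.1 c).Preconnected →
    False := by
  intro m
  induction m with
  | zero => intro V _ col h a b c _ h2; omega
  | succ m ih =>
    intro V _ col h a b c hV h2 hab hac hbc ha hb hc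
    have hnt : Nontrivial V := by
      rw [← Finite.one_lt_card_iff_nontrivial]; omega
    obtain ⟨v, p, hvp⟩ := exists_pair_ne V
    have h' := h.comp _ (Subtype.val_injective (p := fun x => x ≠ v))
    have hcard : Nat.card {x // x ≠ v} = m := by
      have := Set.ncard_add_ncard_compl {v}
      have e : ({v} : Set V)ᶜ.ncard = Nat.card {x // x ≠ v} := rfl
      rw [Set.ncard_singleton, e] at this
      omega
    by_cases hm : 2 ≤ m
    · have := ih h' a b c hcard hm hab hac hbc
      by_cases da : (cg _ h'.1 a).Preconnected
      · by_cases db : (cg _ h'.1 b).Preconnected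
        · by_cases dc : (cg _ h'.1 c).Preconnected
          · exact this da db dc
          · exact gal_L3_step h c a b v hac.symm hbc.symm hab hc ha hb dc
        · exact gal_L3_step h b a c v hab.symm hbc hac hb ha hc db
      · exact gal_L3_step h a b c v hab hac hbc ha hb hc da
    · obtain ⟨x, hx, hxa⟩ := gal_exists_edge h a ha hvp.symm
      obtain ⟨y, hy, hyb⟩ := gal_exists_edge h b hb hvp.symm
      have hsub : Subsingleton {x // x ≠ v} := by
        rw [← Finite.card_le_one_iff_subsingleton]; omega
      have : x = y := congrArg Subtype.val (hsub.elim (⟨x, hx⟩ : {x // x ≠ v}) ⟨y, hy⟩)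
      subst this
      exact hab (hxa.symm.trans hyb)

/-- Gallai partition. -/
theorem gallai_partition {κ : Type*} : ∀ (m : ℕ) {V : Type*} [Finite V] {col : V → V → κ}
    (_ : Gal col), Nat.card V = m → 2 ≤ m →
    ∃ (s : Setoid V) (r b : κ), (∃ x y, ¬ s x y) ∧ (∀ x y, ¬ s x y → col x y = r ∨ col x y = b) ∧
      ∀ x x' y, s x x' → ¬ s x y → col x y = col x' y := by
  intro m
  induction m using Nat.strong_induction_on with
  | _ m ih =>
    intro V _ col h hV h2
    have hnt : Nontrivial V := by
      rw [← Finite.one_lt_card_iff_nontrivial]; omega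
    by_cases htwo : ∃ r b, ∀ x y, x ≠ y → col x y = r ∨ col x y = b
    · obtain ⟨r, b, hrb⟩ := htwo
      obtain ⟨x, y, hxy⟩ := exists_pair_ne V
      refine ⟨⊥, r, b, ⟨x, y, fun hh => hxy (by simpa using hh)⟩, ?_, ?_⟩
      · intro x y hh
        exact hrb x y (fun e => hh (by simpa using e))
      · intro x x' y e _
        have : x = x' := by simpa using e
        rw [this]
    · push Not at htwo
      obtain ⟨x1, y1, hxy1⟩ := exists_pair_ne V
      obtain ⟨x2, y2, hxy2, hr2, -⟩ := htwo (col x1 y1) (col x1 y1)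
      obtain ⟨x3, y3, hxy3, hr3, hr3'⟩ := htwo (col x1 y1) (col x2 y2)
      have hL := gal_L3 m h (col x1 y1) (col x2 y2) (col x3 y3) hV h2 hr2.symm hr3.symm hr3'.symm
      obtain ⟨x, y, hxy, hg⟩ : ∃ x y, x ≠ y ∧ ¬ (cg col h.1 (col x y)).Preconnected := by
        by_contra hcon
        push Not at hcon
        exact hL (hcon _ _ hxy1) (hcon _ _ hxy2) (hcon _ _ hxy3)
      set g := col x y with hgdef
      let Q := (cg col h.1 g).ConnectedComponent
      have hout : ∀ q : Q, (cg col h.1 g).connectedComponentMk q.out = q := fun q => Quot.out_eq q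
      have hoinj : Function.Injective (fun q : Q => q.out) := by
        intro q q' hqq
        rw [← hout q, ← hout q']
        exact congrArg _ hqq
      have hQ : Gal (fun a b : Q => col a.out b.out) := h.comp _ hoinj
      have hmk : Function.Surjective (cg col h.1 g).connectedComponentMk := fun q => ⟨q.out, hout q⟩
      have hfin : Finite Q := Finite.of_surjective _ hmk
      have hlt : Nat.card Q < m := by
        rw [← hV]
        refine lt_of_le_of_ne (Nat.card_le_card_of_surjective _ hmk) ?_
        intro heq
        have hbij := (Nat.bijective_iff_surjective_and_card (cg col h.1 g).connectedComponentMk).2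
          ⟨hmk, heq.symm⟩
        refine hxy (hbij.1 ?_)
        rw [SimpleGraph.ConnectedComponent.eq]
        exact SimpleGraph.Adj.reachable ⟨hxy, rfl⟩
      have hge : 2 ≤ Nat.card Q := by
        show 1 < Nat.card Q
        rw [Finite.one_lt_card_iff_nontrivial]
        unfold SimpleGraph.Preconnected at hg
        push Not at hg
        obtain ⟨u, w, huw⟩ := hg
        exact ⟨_, _, fun e => huw (SimpleGraph.ConnectedComponent.eq.1 e)⟩
      obtain ⟨s, r, b, ⟨q1, q2, hq⟩, hs1, hs2⟩ := ih _ hlt hQ rfl hge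
      have hcol : ∀ x y, ¬ s ((cg col h.1 g).connectedComponentMk x)
          ((cg col h.1 g).connectedComponentMk y) →
          col x y = col (Quot.out ((cg col h.1 g).connectedComponentMk x))
            (Quot.out ((cg col h.1 g).connectedComponentMk y)) := by
        intro x y hxy
        have hr : ¬ (cg col h.1 g).Reachable x y := by
          intro hh
          apply hxy
          rw [SimpleGraph.ConnectedComponent.eq.2 hh]
        have hrx : (cg col h.1 g).Reachable x
            (Quot.out ((cg col h.1 g).connectedComponentMk x)) :=
          SimpleGraph.ConnectedComponent.eq.1 (hout _).symm
        have hry : (cg col h.1 g).Reachable y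
            (Quot.out ((cg col h.1 g).connectedComponentMk y)) :=
          SimpleGraph.ConnectedComponent.eq.1 (hout _).symm
        rw [gal_homog h g hrx hr, h.1, gal_homog h g hry, h.1]
        exact fun hh => hr (hrx.trans hh.symm)
      refine ⟨s.comap (cg col h.1 g).connectedComponentMk, r, b, ⟨q1.out, q2.out, ?_⟩, ?_, ?_⟩
      · intro hh
        rw [Setoid.comap_rel, hout, hout] at hh
        exact hq hh
      · intro x y hxy
        rw [hcol x y hxy]
        exact hs1 _ _ hxy
      · intro x x' y hxx hxy
        rw [hcol x y hxy, hcol x' y]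
        · exact hs2 _ _ _ hxx hxy
        · intro hh
          exact hxy (s.trans hxx hh)

/-- A two-coloured system: a complete multipartite graph with classes of `same`,
edges coloured red and blue, with classes consisting of twins. -/
structure Sys {W : Type*} (red blue same : W → W → Prop) : Prop where
  same_refl : ∀ x, same x x
  same_symm : ∀ x y, same x y → same y x
  same_trans : ∀ x y z, same x y → same y z → same x z
  red_symm : ∀ x y, red x y → red y x
  blue_symm : ∀ x y, blue x y → blue y x
  red_not_blue : ∀ x y, red x y → ¬ blue x y
  red_not_same : ∀ x y, red x y → ¬ same x y
  blue_not_same : ∀ x y, blue x y → ¬ same x y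
  tri : ∀ x y, same x y ∨ red x y ∨ blue x y
  red_twin : ∀ x x' y, same x x' → red x y → red x' y
  blue_twin : ∀ x x' y, same x x' → blue x y → blue x' y

theorem Sys.swap {W : Type*} {red blue same : W → W → Prop} (h : Sys red blue same) :
    Sys blue red same where
  same_refl := h.same_refl
  same_symm := h.same_symm
  same_trans := h.same_trans
  red_symm := h.blue_symm
  blue_symm := h.red_symm
  red_not_blue := fun x y hb hr => h.red_not_blue x y hr hb
  red_not_same := h.blue_not_same
  blue_not_same := h.red_not_same
  tri := fun x y => (h.tri x y).imp_right Or.symm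
  red_twin := h.blue_twin
  blue_twin := h.red_twin

open Classical in
theorem commons_bound {W : Type*} (R : W → W → Prop) (hs : ∀ x y, R x y → R y x) (U : Finset W)
    (x x' : W) : U.card ≤ (U.filter (fun y => R x y ∧ R y x')).card +
      (U.filter (fun y => ¬ R x y)).card + (U.filter (fun y => ¬ R x' y)).card := by
  have : U ⊆ (U.filter (fun y => R x y ∧ R y x')) ∪ (U.filter (fun y => ¬ R x y)) ∪
      (U.filter (fun y => ¬ R x' y)) := by
    intro y hy
    simp only [Finset.mem_union, Finset.mem_filter]
    by_cases h1 : R x y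
    · by_cases h2 : R x' y
      · exact Or.inl (Or.inl ⟨hy, h1, hs _ _ h2⟩)
      · exact Or.inr ⟨hy, h2⟩
    · exact Or.inl (Or.inr ⟨hy, h1⟩)
  refine (Finset.card_le_card this).trans ((Finset.card_union_le _ _).trans ?_)
  exact Nat.add_le_add_right (Finset.card_union_le _ _) _

open Classical in
/-- Zigzag through `x 0, …, x (m-1)` closed by a path on three vertices. -/
theorem zig3 {W : Type*} (R : W → W → Prop) (hs : ∀ x y, R x y → R y x) (U : Finset W)
    (m : ℕ) (hm : 1 ≤ m) (x : ℕ → W) (hinj : ∀ i < m, ∀ j < m, x i = x j → i = j)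
    (hxU : ∀ i < m, x i ∉ U) (hU : 3 * m + 2 ≤ U.card)
    (hD : ∀ i < m, (U.filter (fun y => ¬ R (x i) y)).card ≤ m)
    (p q r : W) (hpq : p ≠ q) (hpr : p ≠ r) (hqr : q ≠ r) (hp : ∀ i < m, x i ≠ p)
    (hq : ∀ i < m, x i ≠ q) (hr : ∀ i < m, x i ≠ r)
    (h1 : R (x (m - 1)) p) (h2 : R p q) (h3 : R q r) (h4 : R r (x 0)) : HasC R (2 * m + 2) := by
  have hmem : ∀ v ∈ (List.range m).map x, ∃ i < m, x i = v := by
    intro v hv; simpa using hv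
  refine hasC_zigzag R U ((List.range m).map x) [p, q, r] ?_ (by simp) ?_ ?_ ?_ ?_ ?_ ?_ ?_ ?_ _ ?_
  · rw [← List.length_pos_iff, List.length_map, List.length_range]; omega
  · rw [List.nodup_map_iff_inj_on List.nodup_range]
    intro i hi j hj h
    exact hinj i (by simpa using hi) j (by simpa using hj) h
  · intro v hv
    obtain ⟨i, hi, rfl⟩ := hmem v hv
    exact hxU i hi
  · simp [hpq, hpr, hqr]
  · simp [h2, h3]
  · intro v hv hv'
    obtain ⟨i, hi, rfl⟩ := hmem v hv'
    simp only [List.mem_cons, List.not_mem_nil, or_false] at hv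
    rcases hv with h | h | h
    · exact hp i hi h
    · exact hq i hi h
    · exact hr i hi h
  · intro a ha b hb
    rw [List.getLast?_map, List.getLast?_range, if_neg (by omega)] at ha
    simp only [Option.map_some, Option.mem_def, Option.some.injEq, List.head?_cons] at ha hb
    subst ha hb
    exact h1
  · intro a ha b hb
    rw [List.head?_map, List.head?_range, if_neg (by omega)] at hb
    simp at ha hb
    subst ha hb
    exact h4
  · intro v hv w hw _
    obtain ⟨i, hi, rfl⟩ := hmem v hv
    obtain ⟨j, hj, rfl⟩ := hmem w hw
    have := commons_bound R hs U (x i) (x j)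
    have a1 := hD i hi
    have a2 := hD j hj
    simp only [List.length_cons, List.length_nil, List.length_map, List.length_range]
    omega
  · simp only [List.length_cons, List.length_nil, List.length_map, List.length_range]

/-- The properties of a pair of consecutive cycle vertices. -/
structure PairOK {W : Type*} (blue : W → W → Prop) (U : Finset W) (x h : W) : Prop where
  xU : x ∉ U
  hU : h ∉ U
  edge : blue x h
  f1 : ∀ z ∈ U, ∀ z' ∈ U, blue x z → blue z z' → blue z' h → False
  noins : ∀ v ∈ U, blue x v → blue h v → False

theorem PairOK.swap {W : Type*} {red blue same : W → W → Prop} (hS : Sys red blue same)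
    {U : Finset W} {x h : W} (H : PairOK blue U x h) : PairOK blue U h x where
  xU := H.hU
  hU := H.xU
  edge := hS.blue_symm _ _ H.edge
  f1 := fun z hz z' hz' h1 h2 h3 =>
    H.f1 z' hz' z hz (hS.blue_symm _ _ h3) (hS.blue_symm _ _ h2) (hS.blue_symm _ _ h1)
  noins := fun v hv h1 h2 => H.noins v hv h2 h1

open Classical in
/-- Either all non-red vertices of `U` are blue to `x`, or there are few of them. -/
theorem pair_dichotomy {W : Type*} [Fintype W] {red blue same : W → W → Prop}
    (hS : Sys red blue same) (n : ℕ)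
    (hpart : ∀ x, (Finset.univ.filter (fun y => same x y)).card ≤ n - 1)
    {U : Finset W} {x h : W} (H : PairOK blue U x h) :
    (∀ y ∈ U, ¬ red x y → blue x y) ∨ (U.filter (fun y => ¬ red x y)).card + 2 ≤ n := by
  by_cases hv : ∃ v ∈ U, same x v
  · right
    obtain ⟨v, hvU, hv⟩ := hv
    have hB : ∀ z ∈ U, ¬ blue x z := by
      intro z hz hb
      exact H.f1 z hz v hvU hb (hS.blue_symm _ _ (hS.blue_twin x v z hv hb))
        (hS.blue_twin x v h hv H.edge)
    have hsub : insert x (U.filter (fun y => ¬ red x y)) ⊆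
        Finset.univ.filter (fun y => same x y) := by
      intro y hy
      rw [Finset.mem_insert, Finset.mem_filter] at hy
      simp only [Finset.mem_filter, Finset.mem_univ, true_and]
      rcases hy with rfl | ⟨hy, hyr⟩
      · exact hS.same_refl _
      · rcases hS.tri x y with h1 | h1 | h1
        · exact h1
        · exact absurd h1 hyr
        · exact absurd h1 (hB y hy)
    have hc := Finset.card_le_card hsub
    rw [Finset.card_insert_of_notMem (by simp [H.xU])] at hc
    have := hpart x
    omega
  · left
    push Not at hv
    intro y hy hyr
    rcases hS.tri x y with h1 | h1 | h1
    · exact absurd h1 (hv y hy)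
    · exact absurd h1 hyr
    · exact h1

open Classical in
theorem pair_hole {W : Type*} [Fintype W] {red blue same : W → W → Prop}
    (hS : Sys red blue same) (n : ℕ) (hn : 2 ≤ n)
    (hpart : ∀ x, (Finset.univ.filter (fun y => same x y)).card ≤ n - 1)
    (S T : Finset W) (hST : Disjoint S T) (hs : n ≤ S.card) (ht : n ≤ T.card)
    (hno : ∀ s ∈ S, ∀ t ∈ T, ¬ blue s t) : HasC red (2 * n) := by
  obtain ⟨S', hS', cS⟩ := Finset.exists_subset_card_eq hs
  obtain ⟨T', hT', cT⟩ := Finset.exists_subset_card_eq ht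
  refine hole n S' T' (hST.mono hS' hT') cS cT hn red same hS.red_symm hS.same_symm hS.same_trans
    ?_ ?_
  · intro x
    refine (Finset.card_le_card ?_).trans (hpart x)
    exact Finset.filter_subset_filter _ (Finset.subset_univ _)
  · intro x hx y hy
    rcases hS.tri x y with h1 | h1 | h1
    · exact Or.inl h1
    · exact Or.inr h1
    · exact absurd h1 (hno x (hS' hx) y (hT' hy))

open Classical in
theorem pair_light {W : Type*} [Fintype W] {red blue same : W → W → Prop}
    (hS : Sys red blue same) (n : ℕ) (hn : 2 ≤ n)
    (hpart : ∀ x, (Finset.univ.filter (fun y => same x y)).card ≤ n - 1)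
    (hnr : ¬ HasC red (2 * n))
    {U : Finset W} {x h : W} (H : PairOK blue U x h)
    (hx : n ≤ (U.filter (fun y => ¬ red x y)).card) :
    (U.filter (fun y => ¬ red h y)).card + 2 ≤ n := by
  rcases pair_dichotomy hS n hpart H with h1 | h1
  swap
  · omega
  rcases pair_dichotomy hS n hpart (H.swap hS) with h2 | h2
  swap
  · exact h2
  by_contra hcon
  apply hnr
  refine pair_hole hS n hn hpart (insert h (U.filter (fun y => ¬ red h y)))
    (U.filter (fun y => ¬ red x y)) ?_ ?_ hx ?_
  · rw [Finset.disjoint_left]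
    intro v hv hv'
    rw [Finset.mem_filter] at hv'
    rw [Finset.mem_insert, Finset.mem_filter] at hv
    rcases hv with rfl | hv
    · exact H.hU hv'.1
    · exact H.noins v hv.1 (h1 v hv.1 hv'.2) (h2 v hv.1 hv.2)
  · rw [Finset.card_insert_of_notMem (by simp [H.hU])]
    omega
  · intro s hs t ht hb
    rw [Finset.mem_filter] at ht
    rw [Finset.mem_insert, Finset.mem_filter] at hs
    rcases hs with rfl | hs
    · exact H.noins t ht.1 (h1 t ht.1 ht.2) hb
    · exact H.f1 t ht.1 s hs.1 (h1 t ht.1 ht.2) (hS.blue_symm _ _ hb)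
        (hS.blue_symm _ _ (h2 s hs.1 hs.2))

theorem path3 {W : Type*} {red blue same : W → W → Prop} (hS : Sys red blue same)
    (g a b : W) (hab : a ≠ b) (hga : ¬ same g a) (hgb : ¬ same g b) (P : W → Prop)
    (pg : P g) (pa : P a) (pb : P b) :
    ∃ p q r, P p ∧ P q ∧ P r ∧ p ≠ q ∧ p ≠ r ∧ q ≠ r ∧
      ((red p q ∧ red q r) ∨ (blue p q ∧ blue q r)) := by
  have nga : g ≠ a := by rintro rfl; exact hga (hS.same_refl _)
  have ngb : g ≠ b := by rintro rfl; exact hgb (hS.same_refl _)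
  rcases (hS.tri g a).resolve_left hga with h1 | h1 <;>
    rcases (hS.tri g b).resolve_left hgb with h2 | h2
  · exact ⟨a, g, b, pa, pg, pb, nga.symm, hab, ngb, Or.inl ⟨hS.red_symm _ _ h1, h2⟩⟩
  · have hs : ¬ same a b := fun hs =>
      hS.red_not_blue _ _ (hS.red_symm _ _ (hS.red_twin a b g hs (hS.red_symm _ _ h1))) h2
    rcases (hS.tri a b).resolve_left hs with h3 | h3
    · exact ⟨g, a, b, pg, pa, pb, nga, ngb, hab, Or.inl ⟨h1, h3⟩⟩
    · exact ⟨g, b, a, pg, pb, pa, ngb, nga, hab.symm, Or.inr ⟨h2, hS.blue_symm _ _ h3⟩⟩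
  · have hs : ¬ same a b := fun hs =>
      hS.red_not_blue _ _ h2 (hS.blue_symm _ _ (hS.blue_twin a b g hs (hS.blue_symm _ _ h1)))
    rcases (hS.tri a b).resolve_left hs with h3 | h3
    · exact ⟨g, b, a, pg, pb, pa, ngb, nga, hab.symm, Or.inl ⟨h2, hS.red_symm _ _ h3⟩⟩
    · exact ⟨g, a, b, pg, pa, pb, nga, ngb, hab, Or.inr ⟨h1, h3⟩⟩
  · exact ⟨a, g, b, pa, pg, pb, nga.symm, hab, ngb, Or.inr ⟨hS.blue_symm _ _ h1, h2⟩⟩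

open Classical in
theorem config_false' {W : Type*} [Fintype W] {red blue same : W → W → Prop}
    (hS : Sys red blue same) (m : ℕ) (hm : 1 ≤ m)
    (hpart : ∀ x, (Finset.univ.filter (fun y => same x y)).card ≤ m)
    (hnr : ¬ HasC red (2 * (m + 1))) (hnb : ¬ HasC blue (2 * (m + 1)))
    (U : Finset W) (hU : 3 * m + 2 ≤ U.card) (x h : ℕ → W)
    (hok : ∀ t < m, PairOK blue U (x t) (h t))
    (dx : ∀ i < m, ∀ j < m, x i = x j → i = j) (dh : ∀ i < m, ∀ j < m, h i = h j → i = j)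
    (dxh : ∀ i < m, ∀ j < m, x i ≠ h j)
    (hl : ∀ t < m, (U.filter (fun y => ¬ red (x t) y)).card ≤ m) : False := by
  have sdr : ∀ t < m, ∀ y ∈ U, ∀ y' ∈ U, y ≠ y' → red (h t) y → red (x (m - 1)) y →
      red (h t) y' → red (x 0) y' → False := by
    intro t ht y hy y' hy' hne r1 r2 r3 r4
    apply hnr
    have hy1 : ∀ i < m, x i ≠ y := fun i hi e => (hok i hi).xU (e ▸ hy)
    have hy2 : ∀ i < m, x i ≠ y' := fun i hi e => (hok i hi).xU (e ▸ hy')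
    have hh1 : y ≠ h t := fun e => (hok t ht).hU (e ▸ hy)
    have hh2 : h t ≠ y' := fun e => (hok t ht).hU (e ▸ hy')
    exact zig3 red hS.red_symm U m hm x dx (fun i hi => (hok i hi).xU) hU hl y (h t) y'
      hh1 hne hh2 hy1 (fun i hi => dxh i hi t ht) hy2 r2 (hS.red_symm _ _ r1) r3
      (hS.red_symm _ _ r4)
  -- bound on red neighbourhoods of the other vertices
  have hRbound : ∀ d, (U.filter (fun y => ¬ red (x 0) y)).card ≤ d →
      (U.filter (fun y => ¬ red (x (m - 1)) y)).card ≤ d → ∀ t < m,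
      (U.filter (fun y => red (h t) y)).card ≤ d + 1 := by
    intro d h0 hlast t ht
    by_contra hcon
    have c1 : 1 < (U.filter (fun y => red (h t) y) \ U.filter (fun y => ¬ red (x 0) y)).card := by
      have := Finset.le_card_sdiff (U.filter (fun y => ¬ red (x 0) y))
        (U.filter (fun y => red (h t) y))
      omega
    have c2 : 0 < (U.filter (fun y => red (h t) y) \
        U.filter (fun y => ¬ red (x (m - 1)) y)).card := by
      have := Finset.le_card_sdiff (U.filter (fun y => ¬ red (x (m - 1)) y))
        (U.filter (fun y => red (h t) y))
      omega
    obtain ⟨y, hy⟩ := Finset.card_pos.1 c2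
    obtain ⟨y', hy', hne⟩ := Finset.exists_mem_ne c1 y
    simp only [Finset.mem_sdiff, Finset.mem_filter, not_and, not_not] at hy hy'
    exact sdr t ht y hy.1.1 y' hy'.1.1 hne.symm hy.1.2 (hy.2 hy.1.1) hy'.1.2 (hy'.2 hy'.1.1)
  have hDR : ∀ v, (U.filter (fun y => red v y)).card + (U.filter (fun y => ¬ red v y)).card
      = U.card := fun v => Finset.card_filter_add_card_filter_not _
  have hheavy : ∀ t < m, m + 1 ≤ (U.filter (fun y => ¬ red (h t) y)).card := by
    intro t ht
    have h1 := hRbound m (hl 0 (by omega)) (hl (m - 1) (by omega)) t ht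
    have h2 := hDR (h t)
    omega
  have hl2 : ∀ t < m, (U.filter (fun y => ¬ red (x t) y)).card + 1 ≤ m := by
    intro t ht
    have := pair_light hS (m + 1) (by omega) hpart hnr ((hok t ht).swap hS) (hheavy t ht)
    omega
  have hblue : ∀ t < m, ∀ y ∈ U, ¬ red (h t) y → blue (h t) y := by
    intro t ht
    rcases pair_dichotomy hS (m + 1) hpart ((hok t ht).swap hS) with h1 | h1
    · exact h1
    · have := hheavy t ht
      omega
  have hR2 : ∀ t < m, (U.filter (fun y => red (h t) y)).card ≤ m := by
    intro t ht
    have h0 := hl2 0 (by omega)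
    have h1 := hl2 (m - 1) (by omega)
    have h2 := hRbound (m - 1) (by omega) (by omega) t ht
    omega
  have hR3 : ∀ t < m, (U.filter (fun y => red (h t) y ∧ red (x 0) y ∧ red (x (m - 1)) y)).card
      ≤ 1 := by
    intro t ht
    rw [Finset.card_le_one]
    intro y hy y' hy'
    simp only [Finset.mem_filter] at hy hy'
    by_contra hne
    exact sdr t ht y hy.1 y' hy'.1 hne hy.2.1 hy.2.2.2 hy'.2.1 hy'.2.2.1
  have hbl : ∀ t < m, (U.filter (fun y => ¬ blue (h t) y)).card ≤ m := by
    intro t ht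
    refine (Finset.card_le_card ?_).trans (hR2 t ht)
    intro y hy
    simp only [Finset.mem_filter] at hy ⊢
    refine ⟨hy.1, ?_⟩
    by_contra hc
    exact hy.2 (hblue t ht y hy.1 hc)
  let G := U.filter (fun y => red (x 0) y ∧ red (x (m - 1)) y ∧ blue (h 0) y ∧ blue (h (m - 1)) y)
  have hG : m + 2 ≤ G.card := by
    have hsub : U ⊆ G ∪ (U.filter (fun y => ¬ red (x 0) y) ∪
        (U.filter (fun y => ¬ red (x (m - 1)) y) ∪
        (U.filter (fun y => red (h 0) y ∧ red (x 0) y ∧ red (x (m - 1)) y) ∪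
        U.filter (fun y => red (h (m - 1)) y ∧ red (x 0) y ∧ red (x (m - 1)) y)))) := by
      intro y hy
      simp only [G, Finset.mem_union, Finset.mem_filter, hy, true_and]
      by_cases h1 : red (x 0) y
      · by_cases h2 : red (x (m - 1)) y
        · by_cases h3 : red (h 0) y
          · exact Or.inr (Or.inr (Or.inr (Or.inl ⟨h3, h1, h2⟩)))
          · by_cases h4 : red (h (m - 1)) y
            · exact Or.inr (Or.inr (Or.inr (Or.inr ⟨h4, h1, h2⟩)))
            · exact Or.inl ⟨h1, h2, hblue 0 (by omega) y hy h3, hblue (m - 1) (by omega) y hy h4⟩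
        · exact Or.inr (Or.inr (Or.inl h2))
      · exact Or.inr (Or.inl h1)
    have e0 := Finset.card_le_card hsub
    have e1 := Finset.card_union_le G (U.filter (fun y => ¬ red (x 0) y) ∪
        (U.filter (fun y => ¬ red (x (m - 1)) y) ∪
        (U.filter (fun y => red (h 0) y ∧ red (x 0) y ∧ red (x (m - 1)) y) ∪
        U.filter (fun y => red (h (m - 1)) y ∧ red (x 0) y ∧ red (x (m - 1)) y))))
    have e2 := Finset.card_union_le (U.filter (fun y => ¬ red (x 0) y))
        (U.filter (fun y => ¬ red (x (m - 1)) y) ∪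
        (U.filter (fun y => red (h 0) y ∧ red (x 0) y ∧ red (x (m - 1)) y) ∪
        U.filter (fun y => red (h (m - 1)) y ∧ red (x 0) y ∧ red (x (m - 1)) y)))
    have e3 := Finset.card_union_le (U.filter (fun y => ¬ red (x (m - 1)) y))
        (U.filter (fun y => red (h 0) y ∧ red (x 0) y ∧ red (x (m - 1)) y) ∪
        U.filter (fun y => red (h (m - 1)) y ∧ red (x 0) y ∧ red (x (m - 1)) y))
    have e4 := Finset.card_union_le
        (U.filter (fun y => red (h 0) y ∧ red (x 0) y ∧ red (x (m - 1)) y))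
        (U.filter (fun y => red (h (m - 1)) y ∧ red (x 0) y ∧ red (x (m - 1)) y))
    have f1 := hl2 0 (by omega)
    have f2 := hl2 (m - 1) (by omega)
    have f3 := hR3 0 (by omega)
    have f4 := hR3 (m - 1) (by omega)
    omega
  obtain ⟨g, hg⟩ : G.Nonempty := by rw [← Finset.card_pos]; omega
  have hcard : 1 < (G \ Finset.univ.filter (fun y => same g y)).card := by
    have := Finset.le_card_sdiff (Finset.univ.filter (fun y => same g y)) G
    have := hpart g
    omega
  obtain ⟨a, ha, b, hb, hab⟩ := Finset.one_lt_card.1 hcard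
  simp only [Finset.mem_sdiff, Finset.mem_filter, Finset.mem_univ, true_and] at ha hb
  obtain ⟨p, q, r, hp, hq, hr, hpq, hpr, hqr, hcase⟩ := path3 hS g a b hab ha.2 hb.2
    (fun v => v ∈ G) hg ha.1 hb.1
  simp only [G, Finset.mem_filter] at hp hq hr
  have nx : ∀ v ∈ U, ∀ i < m, x i ≠ v := fun v hv i hi e => (hok i hi).xU (e ▸ hv)
  have nh : ∀ v ∈ U, ∀ i < m, h i ≠ v := fun v hv i hi e => (hok i hi).hU (e ▸ hv)
  rcases hcase with ⟨c1, c2⟩ | ⟨c1, c2⟩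
  · exact hnr (zig3 red hS.red_symm U m hm x dx (fun i hi => (hok i hi).xU) hU hl p q r
      hpq hpr hqr (nx p hp.1) (nx q hq.1) (nx r hr.1) hp.2.2.1 c1 c2 (hS.red_symm _ _ hr.2.1))
  · exact hnb (zig3 blue hS.blue_symm U m hm h dh (fun i hi => (hok i hi).hU) hU hbl p q r
      hpq hpr hqr (nh p hp.1) (nh q hq.1) (nh r hr.1) hp.2.2.2.2 c1 c2
      (hS.blue_symm _ _ hr.2.2.2.1))

open Classical in
theorem config_false {W : Type*} [Fintype W] {red blue same : W → W → Prop}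
    (hS : Sys red blue same) (m : ℕ) (hm : 1 ≤ m)
    (hpart : ∀ x, (Finset.univ.filter (fun y => same x y)).card ≤ m)
    (hnr : ¬ HasC red (2 * (m + 1))) (hnb : ¬ HasC blue (2 * (m + 1)))
    (U : Finset W) (hU : 3 * m + 2 ≤ U.card) (a b : ℕ → W)
    (hok : ∀ t < m, PairOK blue U (a t) (b t))
    (da : ∀ i < m, ∀ j < m, a i = a j → i = j) (db : ∀ i < m, ∀ j < m, b i = b j → i = j)
    (dab : ∀ i < m, ∀ j < m, a i ≠ b j) : False := by
  let P : ℕ → Prop := fun t => (U.filter (fun y => ¬ red (a t) y)).card ≤ m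
  refine config_false' hS m hm hpart hnr hnb U hU (fun t => if P t then a t else b t)
    (fun t => if P t then b t else a t) ?_ ?_ ?_ ?_ ?_
  · intro t ht
    by_cases hP : P t
    · simp only [hP, if_true]; exact hok t ht
    · simp only [hP, if_false]; exact (hok t ht).swap hS
  · intro i hi j hj hij
    split_ifs at hij
    · exact da i hi j hj hij
    · exact (dab i hi j hj hij).elim
    · exact (dab j hj i hi hij.symm).elim
    · exact db i hi j hj hij
  · intro i hi j hj hij
    split_ifs at hij
    · exact db i hi j hj hij
    · exact (dab j hj i hi hij.symm).elim
    · exact (dab i hi j hj hij).elim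
    · exact da i hi j hj hij
  · intro i hi j hj hij
    by_cases h1 : P i <;> by_cases h2 : P j
    · simp only [h1, h2, if_true] at hij; exact dab i hi j hj hij
    · simp only [h1, h2, if_true, if_false] at hij
      have := da i hi j hj hij
      subst this; exact h2 h1
    · simp only [h1, h2, if_true, if_false] at hij
      have := db i hi j hj hij
      subst this; exact h1 h2
    · simp only [h1, h2, if_false] at hij; exact dab j hj i hi hij.symm
  · intro t ht
    by_cases hP : P t
    · simp only [hP, if_true]; exact hP
    · simp only [hP, if_false]
      have := pair_light hS (m + 1) (by omega) hpart hnr (hok t ht)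
        (by simp only [P, not_le] at hP; omega)
      omega

open Classical in
theorem fstep {W : Type*} [Fintype W] {red blue same : W → W → Prop}
    (hS : Sys red blue same) (m : ℕ) (hm : 1 ≤ m)
    (hpart : ∀ x, (Finset.univ.filter (fun y => same x y)).card ≤ m)
    (hW : 5 * m + 3 ≤ Fintype.card W) (hC : HasC blue (2 * m)) :
    HasC red (2 * (m + 1)) ∨ HasC blue (2 * (m + 1)) := by
  by_contra hcon
  rw [not_or] at hcon
  obtain ⟨hnr, hnb⟩ := hcon
  obtain ⟨c, c1, c2, c3⟩ := hC.exists_periodic (by omega)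
  have cmul : ∀ k i, c (i + k * (2 * m)) = c i := by
    intro k
    induction k with
    | zero => intro i; simp
    | succ k ih =>
      intro i
      rw [Nat.succ_mul, ← Nat.add_assoc, c1, ih]
  have cmod : ∀ i, c (i % (2 * m)) = c i := by
    intro i
    conv_rhs => rw [← Nat.mod_add_div' i (2 * m)]
    rw [cmul]
  have ccongr : ∀ i j, i % (2 * m) = j % (2 * m) → c i = c j := by
    intro i j hij
    rw [← cmod i, ← cmod j, hij]
  have cinj : ∀ s, ∀ i < 2 * m, ∀ j < 2 * m, c (s + i) = c (s + j) → i = j := by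
    intro s i hi j hj hij
    have h1 : i ≡ j [MOD 2 * m] := Nat.ModEq.add_left_cancel' s (c2 _ _ hij)
    have h2 : i % (2 * m) = j % (2 * m) := h1
    rwa [Nat.mod_eq_of_lt hi, Nat.mod_eq_of_lt hj] at h2
  -- F1
  have F1 : ∀ i z z', (∀ j, c j ≠ z) → (∀ j, c j ≠ z') → blue (c i) z → blue z z' →
      blue z' (c (i + 1)) → False := by
    intro i z z' hz hz' b1 b2 b3
    have hzz : z ≠ z' := by
      rintro rfl; exact hS.blue_not_same _ _ b2 (hS.same_refl _)
    apply hnb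
    refine hasC_of_fun (by omega)
      (fun j => if j < 2 * m then c (i + 1 + j) else if j = 2 * m then z else z') ?_ ?_ ?_
    · intro p hp q hq hpq
      have k1 := cinj (i + 1) p
      have k2 := hz (i + 1 + p)
      have k3 := hz' (i + 1 + p)
      have k4 := hz (i + 1 + q)
      have k5 := hz' (i + 1 + q)
      split_ifs at hpq with h1 h2 h3 h2 h2 h3 h2 h2
      · exact k1 h1 q h2 hpq
      · exact absurd hpq k2
      · exact absurd hpq k3
      · exact absurd hpq.symm k4
      · omega
      · exact absurd hpq hzz
      · exact absurd hpq.symm k5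
      · exact absurd hpq.symm hzz
      · omega
    · intro p hp
      by_cases h1 : p + 1 < 2 * m
      · rw [if_pos (by omega), if_pos h1]
        exact c3 (i + 1 + p)
      · by_cases h2 : p + 1 = 2 * m
        · rw [if_pos (by omega), if_neg h1, if_pos h2]
          rw [show i + 1 + p = i + 2 * m by omega, c1]
          exact b1
        · rw [if_neg (by omega), if_pos (by omega), if_neg h1, if_neg h2]
          exact b2
    · rw [if_neg (by omega), if_neg (by omega), if_pos (by omega)]
      exact b3
  have F1' : ∀ i j u u', u ≠ u' → (∀ j, c j ≠ u) → (∀ j, c j ≠ u') →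
      i % (2 * m) ≠ j % (2 * m) → blue (c i) u → blue u (c (i + 1)) → blue (c j) u' →
      blue u' (c (j + 1)) → False := by
    intro i j u u' huu hu hu' hij b1 b2 b3 b4
    apply hnb
    obtain ⟨a, ha, hja⟩ : ∃ a < 2 * m, (i + 1 + a) % (2 * m) = j % (2 * m) := by
      refine ⟨(j + (i + 1) * (2 * m - 1)) % (2 * m), Nat.mod_lt _ (by omega), ?_⟩
      rw [Nat.add_mod_mod]
      have : i + 1 + (j + (i + 1) * (2 * m - 1)) = j + (i + 1) * (2 * m) := by
        obtain ⟨M, hM⟩ : ∃ M, 2 * m = M + 1 := ⟨2 * m - 1, by omega⟩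
        rw [hM]; simp only [Nat.add_sub_cancel]; ring
      rw [this, Nat.add_mul_mod_self_right]
    have ha' : a + 1 < 2 * m := by
      by_contra hc
      apply hij
      rw [← hja, show i + 1 + a = i + 2 * m by omega, Nat.add_mod_right]
    have e1 : c (i + 1 + a) = c j := ccongr _ _ hja
    have e2 : c (i + 1 + a + 1) = c (j + 1) := ccongr _ _ (by
      rw [Nat.add_mod, hja, ← Nat.add_mod])
    refine hasC_of_fun (by omega)
      (fun t => if t ≤ a then c (i + 1 + t) else if t = a + 1 then u' else
        if t ≤ 2 * m then c (i + 1 + (t - 1)) else u) ?_ ?_ ?_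
    · intro p hp q hq hpq
      by_cases p1 : p ≤ a
      · rw [if_pos p1] at hpq
        by_cases q1 : q ≤ a
        · rw [if_pos q1] at hpq
          exact cinj _ _ (by omega) _ (by omega) hpq
        · rw [if_neg q1] at hpq
          by_cases q2 : q = a + 1
          · rw [if_pos q2] at hpq
            exact absurd hpq (hu' _)
          · rw [if_neg q2] at hpq
            by_cases q3 : q ≤ 2 * m
            · rw [if_pos q3] at hpq
              have := cinj _ _ (by omega) _ (by omega) hpq
              omega
            · rw [if_neg q3] at hpq
              exact absurd hpq (hu _)
      · rw [if_neg p1] at hpq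
        by_cases p2 : p = a + 1
        · rw [if_pos p2] at hpq
          by_cases q1 : q ≤ a
          · rw [if_pos q1] at hpq
            exact absurd hpq.symm (hu' _)
          · rw [if_neg q1] at hpq
            by_cases q2 : q = a + 1
            · omega
            · rw [if_neg q2] at hpq
              by_cases q3 : q ≤ 2 * m
              · rw [if_pos q3] at hpq
                exact absurd hpq.symm (hu' _)
              · rw [if_neg q3] at hpq
                exact absurd hpq.symm huu
        · rw [if_neg p2] at hpq
          by_cases p3 : p ≤ 2 * m
          · rw [if_pos p3] at hpq
            by_cases q1 : q ≤ a
            · rw [if_pos q1] at hpq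
              have := cinj _ _ (by omega) _ (by omega) hpq
              omega
            · rw [if_neg q1] at hpq
              by_cases q2 : q = a + 1
              · rw [if_pos q2] at hpq
                exact absurd hpq (hu' _)
              · rw [if_neg q2] at hpq
                by_cases q3 : q ≤ 2 * m
                · rw [if_pos q3] at hpq
                  have := cinj _ _ (by omega) _ (by omega) hpq
                  omega
                · rw [if_neg q3] at hpq
                  exact absurd hpq (hu _)
          · rw [if_neg p3] at hpq
            by_cases q1 : q ≤ a
            · rw [if_pos q1] at hpq
              exact absurd hpq.symm (hu _)
            · rw [if_neg q1] at hpq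
              by_cases q2 : q = a + 1
              · rw [if_pos q2] at hpq
                exact absurd hpq huu
              · rw [if_neg q2] at hpq
                by_cases q3 : q ≤ 2 * m
                · rw [if_pos q3] at hpq
                  exact absurd hpq.symm (hu _)
                · omega
    · intro p hp
      by_cases p1 : p + 1 ≤ a
      · rw [if_pos (by omega), if_pos p1]
        exact c3 _
      · rw [if_neg p1]
        by_cases p2 : p = a
        · rw [if_pos (by omega), if_pos (by omega), p2, e1]
          exact b3
        · rw [if_neg (by omega), if_neg (show ¬ (p + 1 = a + 1) by omega)]
          by_cases p3 : p = a + 1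
          · rw [if_pos p3, if_pos (by omega), show i + 1 + (p + 1 - 1) = i + 1 + a + 1 by omega, e2]
            exact b4
          · rw [if_neg p3, if_pos (by omega)]
            by_cases p4 : p + 1 ≤ 2 * m
            · rw [if_pos p4, show i + 1 + (p + 1 - 1) = i + 1 + (p - 1) + 1 by omega]
              exact c3 _
            · rw [if_neg p4, show i + 1 + (p - 1) = i + 2 * m by omega, c1]
              exact b1
    · rw [if_neg (by omega), if_neg (by omega), if_neg (by omega), if_pos (by omega)]
      exact b2
  obtain ⟨u, e0, hue⟩ : ∃ (u : W) (e0 : ℕ), ∀ v, (∀ j, c j ≠ v) → v ≠ u → ∀ i, blue (c i) v →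
      blue v (c (i + 1)) → i % (2 * m) = e0 % (2 * m) := by
    by_cases hex : ∃ (u : W) (e0 : ℕ), (∀ j, c j ≠ u) ∧ blue (c e0) u ∧ blue u (c (e0 + 1))
    · obtain ⟨u, e0, h1, h2, h3⟩ := hex
      refine ⟨u, e0, ?_⟩
      intro v hv hvu i b1 b2
      by_contra hne
      exact F1' i e0 v u hvu hv h1 hne b1 b2 h2 h3
    · push Not at hex
      exact ⟨c 0, 0, fun v hv _ i b1 b2 => absurd b2 (hex v i hv b1)⟩
  let U : Finset W := Finset.univ.filter (fun v => (∀ j, c j ≠ v) ∧ v ≠ u)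
  have hUc : 3 * m + 2 ≤ U.card := by
    have hsub : (Finset.univ : Finset W) ⊆ U ∪ ((Finset.range (2 * m)).image c ∪ {u}) := by
      intro v _
      simp only [U, Finset.mem_union, Finset.mem_filter, Finset.mem_univ, true_and,
        Finset.mem_image, Finset.mem_range, Finset.mem_singleton]
      by_cases h1 : v = u
      · exact Or.inr (Or.inr h1)
      · by_cases h2 : ∃ j, c j = v
        · obtain ⟨j, rfl⟩ := h2
          exact Or.inr (Or.inl ⟨j % (2 * m), Nat.mod_lt _ (by omega), cmod j⟩)
        · push Not at h2
          exact Or.inl ⟨h2, h1⟩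
    have k1 := Finset.card_le_card hsub
    have k2 := Finset.card_union_le U ((Finset.range (2 * m)).image c ∪ {u})
    have k3 := Finset.card_union_le ((Finset.range (2 * m)).image c) {u}
    have k4 := Finset.card_image_le (s := Finset.range (2 * m)) (f := c)
    rw [Finset.card_univ] at k1
    rw [Finset.card_range] at k4
    rw [Finset.card_singleton] at k3
    omega
  have hmU : ∀ v ∈ U, (∀ j, c j ≠ v) ∧ v ≠ u := by
    intro v hv
    simpa [U] using hv
  refine config_false hS m hm hpart hnr hnb U hUc (fun t => c (e0 + 1 + 2 * t))
    (fun t => c (e0 + 1 + (2 * t + 1))) ?_ ?_ ?_ ?_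
  · intro t ht
    refine ⟨fun h => (hmU _ h).1 _ rfl, fun h => (hmU _ h).1 _ rfl, c3 _, ?_, ?_⟩
    · intro z hz z' hz' b1 b2 b3
      exact F1 _ z z' (hmU z hz).1 (hmU z' hz').1 b1 b2 b3
    · intro v hv b1 b2
      have h1 := hue v (hmU v hv).1 (hmU v hv).2 (e0 + 1 + 2 * t) b1 (hS.blue_symm _ _ b2)
      have h2 : 1 + 2 * t ≡ 0 [MOD 2 * m] := by
        apply Nat.ModEq.add_left_cancel' e0
        rw [← Nat.add_assoc]
        exact h1
      have h3 : (1 + 2 * t) % (2 * m) = 0 := h2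
      rw [Nat.mod_eq_of_lt (by omega)] at h3
      omega
  · intro i hi j hj hij
    have := cinj _ _ (by omega) _ (by omega) hij
    omega
  · intro i hi j hj hij
    have := cinj _ _ (by omega) _ (by omega) hij
    omega
  · intro i hi j hj hij
    have := cinj _ _ (by omega) _ (by omega) hij
    omega

open Classical in
theorem fthm {W : Type*} [Fintype W] {red blue same : W → W → Prop}
    (hS : Sys red blue same) : ∀ m : ℕ,
    (∀ x, (Finset.univ.filter (fun y => same x y)).card ≤ m) →
    5 * m + 3 ≤ Fintype.card W →
    HasC red (2 * (m + 1)) ∨ HasC blue (2 * (m + 1)) := by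
  intro m
  induction m with
  | zero =>
    intro hpart hW
    obtain ⟨x⟩ : Nonempty W := by
      rw [← Fintype.card_pos_iff]; omega
    have h1 := hpart x
    have h2 : x ∈ Finset.univ.filter (fun y => same x y) := by simp [hS.same_refl]
    have h3 := Finset.card_pos.2 ⟨x, h2⟩
    omega
  | succ m ih =>
    intro hpart hW
    have hcyc : HasC red (2 * (m + 1)) ∨ HasC blue (2 * (m + 1)) := by
      by_cases hex : ∃ x, (Finset.univ.filter (fun y => same x y)).card = m + 1
      · obtain ⟨x, hx⟩ := hex
        have hsub : (Finset.univ : Finset W) ⊆ Finset.univ.filter (fun y => same x y) ∪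
            (Finset.univ.filter (fun y => red x y) ∪ Finset.univ.filter (fun y => blue x y)) := by
          intro v _
          simp only [Finset.mem_union, Finset.mem_filter, Finset.mem_univ, true_and]
          exact hS.tri x v
        have k1 := Finset.card_le_card hsub
        have k2 := Finset.card_union_le (Finset.univ.filter (fun y => same x y))
          (Finset.univ.filter (fun y => red x y) ∪ Finset.univ.filter (fun y => blue x y))
        have k3 := Finset.card_union_le (Finset.univ.filter (fun y => red x y))
          (Finset.univ.filter (fun y => blue x y))
        rw [Finset.card_univ] at k1
        by_cases hr : m + 1 ≤ (Finset.univ.filter (fun y => red x y)).card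
        · left
          refine hasC_bip (m + 1) (by omega) _ _ ?_ hx hr red ?_
          · rw [Finset.disjoint_left]
            intro v hv hv'
            simp only [Finset.mem_filter, Finset.mem_univ, true_and] at hv hv'
            exact hS.red_not_same _ _ hv' hv
          · intro v hv y hy
            simp only [Finset.mem_filter, Finset.mem_univ, true_and] at hv hy
            have := hS.red_twin x v y hv hy
            exact ⟨this, hS.red_symm _ _ this⟩
        · right
          refine hasC_bip (m + 1) (by omega) _ (Finset.univ.filter (fun y => blue x y)) ?_ hx
            (by omega) blue ?_
          · rw [Finset.disjoint_left]
            intro v hv hv'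
            simp only [Finset.mem_filter, Finset.mem_univ, true_and] at hv hv'
            exact hS.blue_not_same _ _ hv' hv
          · intro v hv y hy
            simp only [Finset.mem_filter, Finset.mem_univ, true_and] at hv hy
            have := hS.blue_twin x v y hv hy
            exact ⟨this, hS.blue_symm _ _ this⟩
      · push Not at hex
        refine ih ?_ (by omega)
        intro x
        have h1 := hpart x
        have h2 := hex x
        omega
    rcases hcyc with h | h
    · exact (fstep hS.swap (m + 1) (by omega) hpart hW h).symm
    · exact fstep hS (m + 1) (by omega) hpart hW h

theorem gallai_fin {V κ : Type*} {col : V → V → κ} (h : Gal col) (A : Finset V) (hA : 2 ≤ A.card) :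
    ∃ (s : Setoid V) (r b : κ), (∃ x ∈ A, ∃ y ∈ A, ¬ s x y) ∧
      (∀ x ∈ A, ∀ y ∈ A, ¬ s x y → col x y = r ∨ col x y = b) ∧
      ∀ x ∈ A, ∀ x' ∈ A, ∀ y ∈ A, s x x' → ¬ s x y → col x y = col x' y := by
  classical
  obtain ⟨s, r, b, ⟨x, y, hxy⟩, h1, h2⟩ := gallai_partition A.card
    (h.comp _ (Subtype.val_injective (p := fun x => x ∈ A))) (by simp) hA
  let p : V → Option (Quotient s) := fun x => if h : x ∈ A then some (Quotient.mk s ⟨x, h⟩) else none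
  have hp : ∀ x (hx : x ∈ A) y (hy : y ∈ A), Setoid.ker p x y ↔ s ⟨x, hx⟩ ⟨y, hy⟩ := by
    intro x hx y hy
    rw [Setoid.ker_def]
    simp only [p, hx, hy, dif_pos, Option.some.injEq]
    exact Quotient.eq
  refine ⟨Setoid.ker p, r, b, ⟨x, x.2, y, y.2, ?_⟩, ?_, ?_⟩
  · rw [hp x x.2 y y.2]; exact hxy
  · intro x hx y hy hn
    rw [hp x hx y hy] at hn
    exact h1 _ _ hn
  · intro x hx x' hx' y hy e hn
    rw [hp x hx y hy] at hn
    rw [hp x hx x' hx'] at e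
    exact h2 _ _ _ e hn

open Classical in
theorem core {V κ : Type*} {col : V → V → κ} (h : Gal col) (m : ℕ) (hm : 1 ≤ m) :
    ∀ (M : ℕ) (A : Finset V), A.card = M → m + 1 ≤ A.card →
    ∃ (B : Finset V) (d : V → κ) (s : Setoid V) (r b : κ), B ⊆ A ∧ m + 1 ≤ B.card ∧
      (∀ v ∈ A, v ∉ B → ∀ a ∈ B, col v a = d v) ∧
      (∀ x ∈ B, ∀ y ∈ B, ¬ s x y → col x y = r ∨ col x y = b) ∧
      (∀ x ∈ B, ∀ x' ∈ B, ∀ y ∈ B, s x x' → ¬ s x y → col x y = col x' y) ∧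
      (∀ x ∈ B, (B.filter (fun y => s x y)).card ≤ m) := by
  intro M
  induction M using Nat.strong_induction_on with
  | _ M ih =>
    intro A hAM hA
    obtain ⟨s, r, b, ⟨x0, hx0, y0, hy0, hxy0⟩, h1, h2⟩ := gallai_fin h A (by omega)
    by_cases hall : ∀ x ∈ A, (A.filter (fun y => s x y)).card ≤ m
    · exact ⟨A, fun v => col v x0, s, r, b, subset_rfl, hA, fun v hv hv' => absurd hv hv', h1, h2, hall⟩
    · push Not at hall
      obtain ⟨x, hx, hxc⟩ := hall
      have hlt : (A.filter (fun y => s x y)).card < M := by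
        rw [← hAM]
        apply Finset.card_lt_card
        rw [Finset.filter_ssubset]
        by_contra hcon
        push Not at hcon
        exact hxy0 (s.trans (s.symm (hcon x0 hx0)) (hcon y0 hy0))
      obtain ⟨B, d, s', r', b', k1, k0, k2, k3, k4, k5⟩ := ih _ hlt (A.filter (fun y => s x y)) rfl hxc
      refine ⟨B, fun v => if v ∈ A.filter (fun y => s x y) then d v else col v x, s', r', b',
        k1.trans (Finset.filter_subset _ _), k0, ?_, k3, k4, k5⟩
      intro v hv hvB a ha
      show col v a = if v ∈ A.filter (fun y => s x y) then d v else col v x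
      by_cases hvP : v ∈ A.filter (fun y => s x y)
      · rw [if_pos hvP]
        exact k2 v hvP hvB a ha
      · rw [if_neg hvP]
        have ha' := Finset.mem_filter.1 (k1 ha)
        have hns : ¬ s x v := fun hh => hvP (Finset.mem_filter.2 ⟨hv, hh⟩)
        rw [h.1 v a, h.1 v x]
        exact (h2 x hx a ha'.1 v hv ha'.2 hns).symm

/-- The relation of being joined by an edge of colour `i`. -/
def crel {V κ : Type*} (col : V → V → κ) (i : κ) : V → V → Prop := fun x y => x ≠ y ∧ col x y = i

open Classical in
theorem caseD {V κ : Type*} {col : V → V → κ} (h : Gal col) (m : ℕ) (hm : 1 ≤ m)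
    (B D : Finset V) (s : Setoid V) (r b : κ) (hBD : Disjoint B D) (hD0 : 1 ≤ D.card)
    (hDm : D.card ≤ m) (hB : 4 * m + 3 ≤ B.card + D.card)
    (hd : ∀ v ∈ D, ∀ a ∈ B, col v a = r)
    (hrb : ∀ x ∈ B, ∀ y ∈ B, ¬ s x y → col x y = r ∨ col x y = b)
    (hpart : ∀ x ∈ B, (B.filter (fun y => s x y)).card ≤ m) :
    HasC (crel col r) (2 * (m + 1)) ∨ HasC (crel col b) (2 * (m + 1)) := by
  have hsymm : ∀ i x y, crel col i x y → crel col i y x := fun i x y hh =>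
    ⟨hh.1.symm, (h.1 _ _).trans hh.2⟩
  have hDB : ∀ v ∈ D, ∀ a ∈ B, crel col r v a := fun v hv a ha =>
    ⟨fun e => Finset.disjoint_left.1 hBD ha (e ▸ hv), hd v hv a ha⟩
  rcases dfs (crel col r) B (m + 1) with ⟨S, T, hSB, hTB, hST, cS, cT, hno⟩ | ⟨l, l1, l2, l3, l4⟩
  · right
    refine hole (m + 1) S T hST cS cT (by omega) (crel col b) s (hsymm b)
      (fun x y => s.symm) (fun x y z => s.trans) ?_ ?_
    · intro x
      by_cases hne : ∃ y ∈ B, s x y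
      · obtain ⟨y, hy, hxy⟩ := hne
        refine (Finset.card_le_card ?_).trans (hpart y hy)
        intro z hz
        simp only [Finset.mem_filter, Finset.mem_union] at hz ⊢
        exact ⟨hz.1.elim (fun h => hSB h) (fun h => hTB h), s.trans (s.symm hxy) hz.2⟩
      · push Not at hne
        rw [Finset.filter_false_of_mem]
        · simp
        · intro y hy
          exact hne y ((Finset.mem_union.1 hy).elim (fun h => hSB h) (fun h => hTB h))
    · intro x hx y hy
      by_cases hs : s x y
      · exact Or.inl hs
      · right
        have hne : x ≠ y := by rintro rfl; exact hs (s.refl _)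
        refine ⟨hne, ?_⟩
        rcases hrb x (hSB hx) y (hTB hy) hs with e | e
        · exact absurd (hsymm r _ _ ⟨hne, e⟩) (hno x hx y hy)
        · exact e
  · left
    have hq : (l.take (2 * m + 3 - 2 * D.card)).length = 2 * m + 3 - 2 * D.card := by
      rw [List.length_take]; omega
    have hDl : D.toList.length = D.card := by simp
    have hqB : ∀ v ∈ l.take (2 * m + 3 - 2 * D.card), v ∈ B := fun v hv =>
      l3 v (List.mem_of_mem_take hv)
    refine hasC_zigzag (crel col r) B D.toList (l.take (2 * m + 3 - 2 * D.card)) ?_ ?_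
      (Finset.nodup_toList _) ?_ ?_ ?_ ?_ ?_ ?_ ?_ _ ?_
    · rw [← List.length_pos_iff]; omega
    · rw [← List.length_pos_iff]; omega
    · intro x hx hx'
      exact Finset.disjoint_left.1 hBD hx' (by simpa using hx)
    · exact l1.sublist (List.take_sublist _ _)
    · exact l2.take _
    · intro v hv hv'
      exact Finset.disjoint_left.1 hBD (hqB v hv) (by simpa using hv')
    · intro a ha c hc
      exact hDB a (by simpa using List.mem_of_getLast? ha) c (hqB c (List.mem_of_head? hc))
    · intro a ha c hc
      exact hsymm _ _ _ (hDB c (by simpa using List.mem_of_head? hc) a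
        (hqB a (List.mem_of_getLast? ha)))
    · intro x hx x' hx' _
      rw [Finset.filter_true_of_mem]
      · omega
      · intro y hy
        exact ⟨hDB x (by simpa using hx) y hy, hsymm _ _ _ (hDB x' (by simpa using hx') y hy)⟩
    · omega

open Classical in
theorem caseEmpty {V κ : Type*} {col : V → V → κ} (h : Gal col) (m : ℕ)
    (B : Finset V) (s : Setoid V) (r b : κ) (hrbne : r ≠ b)
    (hB : 5 * m + 3 ≤ B.card)
    (hrb : ∀ x ∈ B, ∀ y ∈ B, ¬ s x y → col x y = r ∨ col x y = b)
    (htw : ∀ x ∈ B, ∀ x' ∈ B, ∀ y ∈ B, s x x' → ¬ s x y → col x y = col x' y)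
    (hpart : ∀ x ∈ B, (B.filter (fun y => s x y)).card ≤ m) :
    HasC (crel col r) (2 * (m + 1)) ∨ HasC (crel col b) (2 * (m + 1)) := by
  have hS : Sys (W := B) (fun x y => ¬ s x.1 y.1 ∧ col x y = r)
      (fun x y => ¬ s x.1 y.1 ∧ col x y = b) (fun x y => s x.1 y.1) := by
    refine ⟨fun x => s.refl _, fun x y => s.symm, fun x y z => s.trans, ?_, ?_, ?_, ?_, ?_, ?_, ?_,
      ?_⟩
    · exact fun x y hh => ⟨fun e => hh.1 (s.symm e), (h.1 _ _).trans hh.2⟩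
    · exact fun x y hh => ⟨fun e => hh.1 (s.symm e), (h.1 _ _).trans hh.2⟩
    · exact fun x y hh hh' => hrbne (hh.2.symm.trans hh'.2)
    · exact fun x y hh => hh.1
    · exact fun x y hh => hh.1
    · intro x y
      by_cases hs : s x.1 y.1
      · exact Or.inl hs
      · exact Or.inr ((hrb x x.2 y y.2 hs).imp (fun e => ⟨hs, e⟩) (fun e => ⟨hs, e⟩))
    · exact fun x x' y e hh => ⟨fun e' => hh.1 (s.trans e e'),
        (htw x x.2 x' x'.2 y y.2 e hh.1).symm.trans hh.2⟩
    · exact fun x x' y e hh => ⟨fun e' => hh.1 (s.trans e e'),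
        (htw x x.2 x' x'.2 y y.2 e hh.1).symm.trans hh.2⟩
  have hne : ∀ x y : B, ¬ s x.1 y.1 → x.1 ≠ y.1 := by
    intro x y hh e
    rw [e] at hh
    exact hh (s.refl _)
  have := fthm hS m ?_ ?_
  · rcases this with hc | hc
    · exact Or.inl (hc.map Subtype.val Subtype.val_injective (fun x y hh => ⟨hne x y hh.1, hh.2⟩))
    · exact Or.inr (hc.map Subtype.val Subtype.val_injective (fun x y hh => ⟨hne x y hh.1, hh.2⟩))
  · intro x
    refine le_trans ?_ (hpart x x.2)
    apply Finset.card_le_card_of_injOn Subtype.val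
    · intro y hy
      simp only [Finset.coe_filter, Finset.mem_univ, true_and, Set.mem_ofPred_eq] at hy ⊢
      exact ⟨y.2, hy⟩
    · exact Subtype.val_injective.injOn
  · simpa using hB

theorem main_col {V κ : Type*} [Fintype V] [Fintype κ] {col : V → V → κ} (h : Gal col) (m : ℕ)
    (hm : 1 ≤ m) (hk : 1 ≤ Fintype.card κ)
    (hV : m * Fintype.card κ + 3 * (m + 1) ≤ Fintype.card V) :
    ∃ i, HasC (crel col i) (2 * (m + 1)) := by
  classical
  by_contra hcon
  push Not at hcon
  have hbip : ∀ (i : κ) (S T : Finset V), Disjoint S T → m + 1 ≤ S.card → m + 1 ≤ T.card →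
      (∀ x ∈ S, ∀ y ∈ T, col x y = i) → False := by
    intro i S T hST hS hT hcol
    obtain ⟨S', hS', cS⟩ := Finset.exists_subset_card_eq hS
    refine hcon i (hasC_bip (m + 1) (by omega) S' T (hST.mono_left hS') cS hT _ ?_)
    intro x hx y hy
    have hne : x ≠ y := by
      rintro rfl; exact Finset.disjoint_left.1 hST (hS' hx) hy
    exact ⟨⟨hne, hcol x (hS' hx) y hy⟩, hne.symm, (h.1 _ _).trans (hcol x (hS' hx) y hy)⟩
  have hmk : m ≤ m * Fintype.card κ := Nat.le_mul_of_pos_right _ hk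
  obtain ⟨B, d, s, r, b0, -, hBn, hd, hrb0, htw, hpart⟩ := core h m hm _ (Finset.univ : Finset V) rfl
    (by rw [Finset.card_univ]; omega)
  by_cases hk1 : Fintype.card κ = 1
  · have hsub : Subsingleton κ := by
      rw [← Fintype.card_le_one_iff_subsingleton]; omega
    obtain ⟨S, -, cS⟩ := Finset.exists_subset_card_eq (s := (Finset.univ : Finset V))
      (n := m + 1) (by rw [Finset.card_univ]; omega)
    refine hbip r S Sᶜ disjoint_compl_right cS.ge ?_ (fun x _ y _ => Subsingleton.elim _ _)
    rw [Finset.card_compl]; omega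
  have hnt : Nontrivial κ := by
    rw [← Fintype.one_lt_card_iff_nontrivial]; omega
  obtain ⟨b, hrbne, hrb⟩ : ∃ b, r ≠ b ∧
      ∀ x ∈ B, ∀ y ∈ B, ¬ s x y → col x y = r ∨ col x y = b := by
    by_cases e : r = b0
    · obtain ⟨b, hb⟩ := exists_ne r
      refine ⟨b, hb.symm, fun x hx y hy hn => Or.inl ?_⟩
      rcases hrb0 x hx y hy hn with e' | e'
      · exact e'
      · rw [e', e]
    · exact ⟨b0, e, hrb0⟩
  let D : κ → Finset V := fun i => Bᶜ.filter (fun v => d v = i)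
  have hBD : ∀ i, Disjoint B (D i) := by
    intro i
    rw [Finset.disjoint_left]
    intro v hv hv'
    simp only [D, Finset.mem_filter, Finset.mem_compl] at hv'
    exact hv'.1 hv
  have hDcol : ∀ i, ∀ v ∈ D i, ∀ a ∈ B, col v a = i := by
    intro i v hv a ha
    simp only [D, Finset.mem_filter, Finset.mem_compl] at hv
    rw [← hv.2]
    exact hd v (Finset.mem_univ _) hv.1 a ha
  have hsum : Bᶜ.card = ∑ i, (D i).card :=
    Finset.card_eq_sum_card_fiberwise (fun v _ => Finset.mem_univ _)
  have hDm : ∀ i, (D i).card ≤ m := by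
    intro i
    by_contra hc
    exact hbip i (D i) B (hBD i).symm (by omega) hBn (hDcol i)
  have hsum2 : ∑ i, (D i).card ≤ (D r).card + (D b).card + m * (Fintype.card κ - 2) := by
    have e1 := Finset.add_sum_erase (Finset.univ : Finset κ) (fun i => (D i).card)
      (Finset.mem_univ r)
    have hb : b ∈ (Finset.univ : Finset κ).erase r := by simp [hrbne.symm]
    have e2 := Finset.add_sum_erase _ (fun i => (D i).card) hb
    have e3 := Finset.sum_le_card_nsmul (((Finset.univ : Finset κ).erase r).erase b)
      (fun i => (D i).card) m (fun i _ => hDm i)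
    rw [Finset.card_erase_of_mem hb, Finset.card_erase_of_mem (Finset.mem_univ _),
      Finset.card_univ, smul_eq_mul, Nat.sub_sub, Nat.mul_comm] at e3
    have e4 : (1 + 1 : ℕ) = 2 := rfl
    rw [e4] at e3
    omega
  have hk2 : m * (Fintype.card κ - 2) + 2 * m = m * Fintype.card κ := by
    obtain ⟨j, hj⟩ : ∃ j, Fintype.card κ = j + 2 := ⟨Fintype.card κ - 2, by omega⟩
    rw [hj]; simp only [Nat.add_sub_cancel]; ring
  have hBc := Finset.card_add_card_compl B
  have hBig : 5 * m + 3 ≤ B.card + (D r).card + (D b).card := by omega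
  have hr := hDm r
  have hb := hDm b
  by_cases h1 : 1 ≤ (D r).card
  · rcases caseD h m hm B (D r) s r b (hBD r) h1 hr (by omega) (hDcol r) hrb hpart with e | e
    · exact hcon r e
    · exact hcon b e
  · by_cases h2 : 1 ≤ (D b).card
    · rcases caseD h m hm B (D b) s b r (hBD b) h2 hb (by omega) (hDcol b)
        (fun x hx y hy hn => (hrb x hx y hy hn).symm) hpart with e | e
      · exact hcon b e
      · exact hcon r e
    · rcases caseEmpty h m B s r b hrbne (by omega) hrb htw hpart with e | e
      · exact hcon r e
      · exact hcon b e

theorem hasMonoCopyIn_of_hasC {V κ : Type*} (c : Sym2 V → κ) (i : κ) (L : ℕ) (hL : 1 ≤ L)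
    (h : HasC (crel (fun x y => c s(x, y)) i) L) : HasMonoCopyIn c (cycleGraph L) i := by
  obtain ⟨f, h1, h2, h3⟩ := h.exists_fun hL
  have key : ∀ u v : Fin L, (u - v).val = 1 → c s(f v, f u) = i := by
    intro u v huv
    by_cases hle : v ≤ u
    · rw [Fin.sub_val_of_le hle] at huv
      have hle' : v.val ≤ u.val := hle
      have e : u.val = v.val + 1 := by omega
      have hu := u.2
      rw [e]
      exact (h2 v.val (by omega)).2
    · have hlt : u < v := not_le.1 hle
      rw [Fin.coe_sub_iff_lt.2 hlt] at huv
      have hu := u.2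
      have hv := v.2
      have e1 : u.val = 0 := by omega
      have e2 : v.val = L - 1 := by omega
      rw [e1, e2]
      exact h3.2
  refine ⟨⟨fun u => f u, fun u v huv => Fin.ext (h1 _ u.2 _ v.2 huv)⟩, ?_⟩
  intro u v huv
  rw [SimpleGraph.cycleGraph_adj'] at huv
  rcases huv with e | e
  · rw [Sym2.eq_swap]; exact key u v e
  · exact key v u e

theorem gallai_ramsey_even_cycles_upper (n k : ℕ) (hn : 2 ≤ n) (hk : 1 ≤ k) :
    gr k (cycleGraph (2 * n)) ≤ (n - 1) * k + 3 * n ∧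
    (∀ N : ℕ, (n - 1) * k + 3 * n ≤ N → ∀ c : Sym2 (Fin N) → Fin k,
      HasRainbowTriangle c ∨ HasMonoCopy c (cycleGraph (2 * n))) := by
  have main : ∀ N : ℕ, (n - 1) * k + 3 * n ≤ N → ∀ c : Sym2 (Fin N) → Fin k,
      HasRainbowTriangle c ∨ HasMonoCopy c (cycleGraph (2 * n)) := by
    intro N hN c
    by_cases hrb : HasRainbowTriangle c
    · exact Or.inl hrb
    · right
      have hG : Gal (fun x y => c s(x, y)) := by
        refine ⟨fun x y => congrArg c Sym2.eq_swap, fun x y z h1 h2 h3 => ?_⟩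
        by_contra hc
        rw [not_or, not_or] at hc
        exact hrb ⟨x, y, z, h1, h2, h3, hc.1, hc.2.1, hc.2.2⟩
      obtain ⟨m, rfl⟩ : ∃ m, n = m + 1 := ⟨n - 1, by omega⟩
      simp only [Nat.add_sub_cancel] at hN
      obtain ⟨i, hi⟩ := main_col hG m (by omega) (by simpa using hk) (by simpa using hN)
      exact ⟨i, hasMonoCopyIn_of_hasC c i _ (by omega) hi⟩
  exact ⟨Nat.sInf_le main, main⟩
end
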